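/- Stabilization for ℓ_2: Let ε > 0, 1 < p < ∞, and let T : ℓ_2 → L_p[0,1] be an isomorphism onto its range. Then there is an infinite-dimensional subspace X ⊆ ℓ_2 such that T restricted to X is a (1+ε)-isomorphism and T(X) is complemented in L_p by a projection of norm at most (1+ε)γ_p for p > 2 and (1+ε)γ_{p/(p-1)} for 1 < p < 2. -/

import Mathlib

open MeasureTheory ProbabilityTheory
open scoped ENNReal

noncomputable def μ01 : Measure ℝ := volume.restrict (Set.Icc (0 : ℝ) 1)

noncomputable def gaussNorm (r : ℝ) : ℝ :=
  (∫ x, |x| ^ r ∂(gaussianReal 0 1)) ^ (1 / r)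

/-- The space `ℓ₂`. -/
noncomputable abbrev ell2 := lp (fun _ : ℕ => ℝ) 2

section Stabilization

open Filter Topology

/-- The standard Gaussian measure on the line. -/
noncomputable abbrev stdG : Measure ℝ := gaussianReal 0 1

/-- Continuous functions of at most polynomial growth. -/
def PolyGrowth (f : ℝ → ℝ) : Prop :=
  Continuous f ∧ ∃ (C : ℝ) (m : ℕ), ∀ x, |f x| ≤ C * (1 + |x|) ^ m

/-- The average of `f` against the Gaussian measure with mean `x` and standard deviation `|σ|`. -/
noncomputable def gavg (f : ℝ → ℝ) (x σ : ℝ) : ℝ := ∫ z, f (x + σ * z) ∂stdG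

lemma integrable_add_mul_abs_pow_stdG (c d : ℝ) (m : ℕ) :
    Integrable (fun z : ℝ => (c + d * |z|) ^ m) stdG := by
  have h : MemLp (fun z : ℝ => c + d * |z|) (m : ℝ≥0∞) stdG := by
    refine (memLp_const c).add (MemLp.const_mul ?_ d)
    exact (memLp_id_gaussianReal' (μ := 0) (v := 1) (m : ℝ≥0∞) (by simp)).abs
  rcases Nat.eq_zero_or_pos m with rfl | hm
  · simp
  · refine (integrable_norm_iff (by fun_prop)).1 ?_
    simpa only [norm_pow] using h.integrable_norm_pow hm.ne'

lemma integrable_pow_stdG (m : ℕ) : Integrable (fun z : ℝ => z ^ m) stdG := by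
  have h : MemLp (fun z : ℝ => z) (m : ℝ≥0∞) stdG :=
    memLp_id_gaussianReal' (μ := 0) (v := 1) (m : ℝ≥0∞) (by simp)
  rcases Nat.eq_zero_or_pos m with rfl | hm
  · simp
  · refine (integrable_norm_iff (by fun_prop)).1 ?_
    simpa only [norm_pow] using h.integrable_norm_pow hm.ne'

lemma integral_id_stdG : ∫ z, z ∂stdG = 0 := integral_id_gaussianReal

lemma integral_sq_stdG : ∫ z, z ^ 2 ∂stdG = 1 := by
  have h := variance_fun_id_gaussianReal (μ := 0) (v := 1)
  rw [variance_eq_integral (by fun_prop)] at h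
  simpa [integral_id_gaussianReal] using h

lemma PolyGrowth.nonneg_const {f : ℝ → ℝ} (hf : PolyGrowth f) :
    ∃ (C : ℝ) (m : ℕ), 0 ≤ C ∧ ∀ x, |f x| ≤ C * (1 + |x|) ^ m := by
  obtain ⟨-, C, m, h⟩ := hf
  refine ⟨C, m, ?_, h⟩
  have := h 0
  simp at this
  exact (abs_nonneg _).trans this

lemma integrable_of_polyBound {f : ℝ → ℝ} (hc : Continuous f) {C c d : ℝ} {m : ℕ}
    (h : ∀ z, |f z| ≤ C * (c + d * |z|) ^ m) : Integrable f stdG :=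
  ((integrable_add_mul_abs_pow_stdG c d m).const_mul C).mono' hc.aestronglyMeasurable
    (Eventually.of_forall h)

lemma abs_add_mul_le_of_le {x σ R z : ℝ} (hx : |x| ≤ R) (hσ : |σ| ≤ R) :
    1 + |x + σ * z| ≤ (1 + R) + R * |z| := by
  have h1 := abs_add_le x (σ * z)
  rw [abs_mul] at h1
  have h2 := mul_le_mul_of_nonneg_right hσ (abs_nonneg z)
  linarith

lemma PolyGrowth.integrable {f : ℝ → ℝ} (hf : PolyGrowth f) (x σ : ℝ) :
    Integrable (fun z => f (x + σ * z)) stdG := by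
  obtain ⟨C, m, hC, h⟩ := hf.nonneg_const
  refine integrable_of_polyBound (C := C) (c := 1 + max |x| |σ|) (d := max |x| |σ|) (m := m)
    (hf.1.comp (by fun_prop)) fun z => (h _).trans ?_
  have := abs_add_mul_le_of_le (z := z) (le_max_left |x| |σ|) (le_max_right |x| |σ|)
  exact mul_le_mul_of_nonneg_left (pow_le_pow_left₀ (by positivity) this m) hC

lemma PolyGrowth.continuous_gavg {f : ℝ → ℝ} (hf : PolyGrowth f) :
    Continuous (fun p : ℝ × ℝ => gavg f p.1 p.2) := by
  obtain ⟨C, m, hC, h⟩ := hf.nonneg_const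
  rw [continuous_iff_continuousAt]
  intro p
  have hev : ∀ᶠ q : ℝ × ℝ in 𝓝 p, |q.1| ≤ |p.1| + |p.2| + 1 ∧ |q.2| ≤ |p.1| + |p.2| + 1 := by
    have h1 : ∀ᶠ q : ℝ × ℝ in 𝓝 p, |q.1| < |p.1| + |p.2| + 1 :=
      (continuous_fst.abs.tendsto p).eventually_lt_const (by linarith [abs_nonneg p.2])
    have h2 : ∀ᶠ q : ℝ × ℝ in 𝓝 p, |q.2| < |p.1| + |p.2| + 1 :=
      (continuous_snd.abs.tendsto p).eventually_lt_const (by linarith [abs_nonneg p.1])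
    filter_upwards [h1, h2] with q a b using ⟨a.le, b.le⟩
  refine continuousAt_of_dominated (bound := fun z => C * ((1 + (|p.1| + |p.2| + 1)) +
    (|p.1| + |p.2| + 1) * |z|) ^ m) ?_ ?_ ?_ ?_
  · exact Eventually.of_forall fun q => (hf.1.comp (by fun_prop)).aestronglyMeasurable
  · filter_upwards [hev] with q hq
    refine Eventually.of_forall fun z => (h _).trans ?_
    have := abs_add_mul_le_of_le (z := z) hq.1 hq.2
    exact mul_le_mul_of_nonneg_left (pow_le_pow_left₀ (by positivity) this m) hC
  · exact (integrable_add_mul_abs_pow_stdG _ _ _).const_mul C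
  · exact Eventually.of_forall fun z => (hf.1.comp (by fun_prop)).continuousAt

/-- Averaging against independent Gaussians adds up variances. -/
lemma PolyGrowth.gavg_of_sq_add_sq {f : ℝ → ℝ} (hf : PolyGrowth f) (x : ℝ) {σ t τ : ℝ}
    (h : τ ^ 2 = σ ^ 2 + t ^ 2) :
    gavg f x τ = ∫ z, gavg f (x + t * z) σ ∂stdG := by
  have hcont : Continuous fun w => f (x + w) := by
    have := hf.1
    fun_prop
  have key : ∀ s : ℝ, stdG.map (fun z => s * z) = gaussianReal 0 (s ^ 2).toNNReal := by
    intro s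
    have := gaussianReal_map_const_mul (μ := 0) (v := 1) s
    rw [mul_zero, mul_one] at this
    rw [this]
    congr 1
    ext
    simp [sq_nonneg]
  have h_int : ∀ s : ℝ, Integrable (fun w => f (x + w)) (gaussianReal 0 (s ^ 2).toNNReal) := by
    intro s
    rw [← key s, integrable_map_measure hcont.aestronglyMeasurable (by fun_prop)]
    exact hf.integrable x s
  have hτ : gavg f x τ = ∫ w, f (x + w) ∂(gaussianReal 0 (τ ^ 2).toNNReal) := by
    rw [← key τ, integral_map (by fun_prop) hcont.aestronglyMeasurable]
    rfl
  have hconv : gaussianReal 0 (τ ^ 2).toNNReal =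
      (gaussianReal 0 (t ^ 2).toNNReal) ∗ (gaussianReal 0 (σ ^ 2).toNNReal) := by
    rw [gaussianReal_conv_gaussianReal, ← Real.toNNReal_add (sq_nonneg t) (sq_nonneg σ), h,
      add_comm, zero_add]
  have hi := h_int τ
  rw [hτ]
  rw [hconv] at hi ⊢
  have hin : ∀ y, ∫ w, f (x + (y + w)) ∂(gaussianReal 0 (σ ^ 2).toNNReal) = gavg f (x + y) σ := by
    intro y
    rw [← key σ, integral_map (by fun_prop)]
    · simp only [gavg, add_assoc]
    · have := hf.1
      exact Continuous.aestronglyMeasurable (by fun_prop)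
  rw [integral_conv hi]
  simp only [hin]
  rw [← key t, integral_map (by fun_prop)]
  have := hf.continuous_gavg
  exact (this.comp (by fun_prop : Continuous fun y : ℝ => (x + y, σ))).aestronglyMeasurable

end Stabilization

section Stabilization

open Filter Topology

/-- A convex `C²` function whose second order Taylor remainder is controlled, up to an arbitrarily
small multiple of `h ^ 2 * (1 + F'')`, by the `e`-th power of large increments. -/
structure TaylorData (F F' F'' : ℝ → ℝ) (e : ℝ) : Prop where
  growth : PolyGrowth F
  growth' : PolyGrowth F'
  growth'' : PolyGrowth F''
  nonneg : ∀ x, 0 ≤ F x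
  nonneg'' : ∀ x, 0 ≤ F'' x
  dominated : ∃ C, 0 ≤ C ∧ ∀ x, 1 + F'' x ≤ C * (1 + F x)
  two_le : 2 ≤ e
  tangent : ∀ x h, F x + F' x * h ≤ F (x + h)
  remainder : ∀ η > 0, ∃ K ≥ 0, ∃ κ > 0, ∀ x h,
    |F (x + h) - F x - F' x * h - F'' x * h ^ 2 / 2| ≤
      η * h ^ 2 * (1 + F'' x) + if κ < |h| then K * |h| ^ e else 0

variable {F F' F'' : ℝ → ℝ} {e : ℝ}

lemma TaylorData.gavg_nonneg (hF : TaylorData F F' F'' e) (x σ : ℝ) : 0 ≤ gavg F x σ :=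
  integral_nonneg fun _ => hF.nonneg _

lemma TaylorData.gavg_nonneg'' (hF : TaylorData F F' F'' e) (x σ : ℝ) : 0 ≤ gavg F'' x σ :=
  integral_nonneg fun _ => hF.nonneg'' _

lemma TaylorData.gavg_dominated (hF : TaylorData F F' F'' e) :
    ∃ C, 0 ≤ C ∧ ∀ x σ, 1 + gavg F'' x σ ≤ C * (1 + gavg F x σ) := by
  obtain ⟨C, hC, h⟩ := hF.dominated
  refine ⟨C, hC, fun x σ => ?_⟩
  have h1 : 1 + gavg F'' x σ = ∫ z, (1 + F'' (x + σ * z)) ∂stdG := by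
    rw [integral_add (integrable_const _) (hF.growth''.integrable x σ)]
    simp [gavg]
  have h2 : C * (1 + gavg F x σ) = ∫ z, C * (1 + F (x + σ * z)) ∂stdG := by
    rw [integral_const_mul, integral_add (integrable_const _) (hF.growth.integrable x σ)]
    simp [gavg]
  rw [h1, h2]
  exact integral_mono ((integrable_const _).add (hF.growth''.integrable x σ))
    (((integrable_const _).add (hF.growth.integrable x σ)).const_mul C) fun z => h _

/-- The Taylor expansion of a Gaussian average under a translation. -/
lemma TaylorData.abs_gavg_add_sub_le (hF : TaylorData F F' F'' e) {η K κ : ℝ}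
    (hR : ∀ x h, |F (x + h) - F x - F' x * h - F'' x * h ^ 2 / 2| ≤
      η * h ^ 2 * (1 + F'' x) + if κ < |h| then K * |h| ^ e else 0) (x h σ : ℝ) :
    |gavg F (x + h) σ - gavg F x σ - gavg F' x σ * h - gavg F'' x σ * h ^ 2 / 2| ≤
      η * h ^ 2 * (1 + gavg F'' x σ) + if κ < |h| then K * |h| ^ e else 0 := by
  have i0 := hF.growth.integrable x σ
  have i1 := hF.growth'.integrable x σ
  have i2 := hF.growth''.integrable x σ
  have i3 := hF.growth.integrable (x + h) σ
  have e1 : gavg F (x + h) σ - gavg F x σ - gavg F' x σ * h - gavg F'' x σ * h ^ 2 / 2 =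
      ∫ z, (F (x + σ * z + h) - F (x + σ * z) - F' (x + σ * z) * h -
        F'' (x + σ * z) * h ^ 2 / 2) ∂stdG := by
    have : ∀ z, x + σ * z + h = x + h + σ * z := fun z => by ring
    simp only [this]
    rw [integral_sub, integral_sub, integral_sub i3 i0, integral_mul_const, integral_div,
      integral_mul_const]
    · rfl
    · exact i3.sub i0
    · exact i1.mul_const h
    · exact (i3.sub i0).sub (i1.mul_const h)
    · exact (i2.mul_const _).div_const _
  have i4 : Integrable (fun z => η * h ^ 2 * (1 + F'' (x + σ * z))) stdG :=
    ((integrable_const (1 : ℝ)).add i2).const_mul _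
  have e2 : η * h ^ 2 * (1 + gavg F'' x σ) + (if κ < |h| then K * |h| ^ e else 0) =
      ∫ z, (η * h ^ 2 * (1 + F'' (x + σ * z)) + if κ < |h| then K * |h| ^ e else 0) ∂stdG := by
    rw [integral_add i4 (integrable_const _),
      integral_const_mul, integral_add (integrable_const _) i2]
    simp [gavg]
  rw [e1, e2]
  have i5 : Integrable (fun z => η * h ^ 2 * (1 + F'' (x + σ * z)) +
      if κ < |h| then K * |h| ^ e else 0) stdG := i4.add (integrable_const _)
  rw [← Real.norm_eq_abs]
  refine norm_integral_le_of_norm_le i5 (Eventually.of_forall fun z => ?_)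
  rw [Real.norm_eq_abs]
  exact hR _ _

lemma TaylorData.integrable_gavg (hf : PolyGrowth F) (x t σ : ℝ) :
    Integrable (fun z => gavg F (x + t * z) σ) stdG := by
  obtain ⟨C, m, hC, h⟩ := hf.nonneg_const
  have hc : Continuous fun z => gavg F (x + t * z) σ := by
    have := hf.continuous_gavg
    exact this.comp (by fun_prop : Continuous fun z : ℝ => (x + t * z, σ))
  refine integrable_of_polyBound hc
    (C := C * ∫ z, (1 + |σ| * |z|) ^ m ∂stdG) (c := 1 + |x|) (d := |t|) (m := m) fun z => ?_
  have hb : ∀ w, ‖F (x + t * z + σ * w)‖ ≤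
      C * (1 + |x| + |t| * |z|) ^ m * (1 + |σ| * |w|) ^ m := by
    intro w
    refine (h _).trans ?_
    rw [mul_assoc, ← mul_pow]
    refine mul_le_mul_of_nonneg_left (pow_le_pow_left₀ (by positivity) ?_ m) hC
    have h1 := abs_add_le (x + t * z) (σ * w)
    have h2 := abs_add_le x (t * z)
    rw [abs_mul] at h1 h2
    have : 0 ≤ (|x| + |t| * |z|) * (|σ| * |w|) := by positivity
    nlinarith
  have := norm_integral_le_of_norm_le
    ((integrable_add_mul_abs_pow_stdG 1 |σ| m).const_mul (C * (1 + |x| + |t| * |z|) ^ m))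
    (Eventually.of_forall hb)
  rw [integral_const_mul] at this
  calc |gavg F (x + t * z) σ| ≤ _ := this
    _ = _ := by ring

lemma integrable_ite_rpow_stdG {K κ t : ℝ} (he : 0 ≤ e) :
    Integrable (fun z => if κ < |t * z| then K * |t * z| ^ e else 0) stdG := by
  have h1 : Integrable (fun z : ℝ => |K| * (1 + |t| * |z|) ^ ⌈e⌉₊) stdG :=
    (integrable_add_mul_abs_pow_stdG 1 |t| _).const_mul _
  refine h1.mono' ?_ (Eventually.of_forall fun z => ?_)
  · refine Measurable.aestronglyMeasurable ?_
    refine Measurable.ite ?_ (by fun_prop) (by fun_prop)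
    exact measurableSet_lt measurable_const (by fun_prop)
  · have h2 : |t * z| ^ e ≤ (1 + |t| * |z|) ^ ⌈e⌉₊ := by
      rw [abs_mul]
      calc (|t| * |z|) ^ e ≤ (1 + |t| * |z|) ^ e := by
            apply Real.rpow_le_rpow (by positivity) (by linarith) he
        _ ≤ (1 + |t| * |z|) ^ (⌈e⌉₊ : ℝ) := by
            apply Real.rpow_le_rpow_of_exponent_le _ (Nat.le_ceil e)
            have : 0 ≤ |t| * |z| := by positivity
            linarith
        _ = _ := Real.rpow_natCast _ _
    split_ifs
    · rw [norm_mul, Real.norm_eq_abs, Real.norm_eq_abs, abs_of_nonneg (by positivity : 0 ≤ |t * z| ^ e)]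
      exact mul_le_mul_of_nonneg_left h2 (abs_nonneg K)
    · simp; positivity

/-- The Taylor expansion of a Gaussian average under an increase of the variance. -/
lemma TaylorData.abs_gavg_sub_le (hF : TaylorData F F' F'' e) {η K κ : ℝ}
    (hR : ∀ x h, |F (x + h) - F x - F' x * h - F'' x * h ^ 2 / 2| ≤
      η * h ^ 2 * (1 + F'' x) + if κ < |h| then K * |h| ^ e else 0) (x : ℝ) {σ t τ : ℝ}
    (h : τ ^ 2 = σ ^ 2 + t ^ 2) :
    |gavg F x τ - gavg F x σ - gavg F'' x σ * t ^ 2 / 2| ≤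
      η * t ^ 2 * (1 + gavg F'' x σ) +
        ∫ z, (if κ < |t * z| then K * |t * z| ^ e else 0) ∂stdG := by
  have he : 0 ≤ e := by linarith [hF.two_le]
  have i0 := TaylorData.integrable_gavg hF.growth x t σ
  have i1 : Integrable (fun z : ℝ => z) stdG := by simpa using integrable_pow_stdG 1
  have i2 := integrable_pow_stdG 2
  have e1 : gavg F x τ - gavg F x σ - gavg F'' x σ * t ^ 2 / 2 =
      ∫ z, (gavg F (x + t * z) σ - gavg F x σ - gavg F' x σ * (t * z) -
        gavg F'' x σ * (t * z) ^ 2 / 2) ∂stdG := by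
    rw [hF.growth.gavg_of_sq_add_sq x h, integral_sub, integral_sub, integral_sub i0,
      integral_const_mul, integral_const_mul, integral_id_stdG, integral_div, integral_const_mul]
    · simp only [mul_pow]
      rw [integral_const_mul, integral_sq_stdG]
      simp
    · exact integrable_const _
    · exact i0.sub (integrable_const _)
    · exact (i1.const_mul t).const_mul _
    · exact (i0.sub (integrable_const _)).sub ((i1.const_mul t).const_mul _)
    · simp only [mul_pow]
      exact ((i2.const_mul _).const_mul _).div_const _
  have e2 : η * t ^ 2 * (1 + gavg F'' x σ) +
        ∫ z, (if κ < |t * z| then K * |t * z| ^ e else 0) ∂stdG =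
      ∫ z, (η * (t * z) ^ 2 * (1 + gavg F'' x σ) +
        if κ < |t * z| then K * |t * z| ^ e else 0) ∂stdG := by
    rw [integral_add _ (integrable_ite_rpow_stdG he), integral_mul_const, integral_const_mul]
    · simp only [mul_pow]
      rw [integral_const_mul, integral_sq_stdG]
      simp
    · simp only [mul_pow]
      exact ((i2.const_mul _).const_mul _).mul_const _
  rw [e1, e2]
  have i3 : Integrable (fun z => η * (t * z) ^ 2 * (1 + gavg F'' x σ)) stdG := by
    simp only [mul_pow]
    exact ((i2.const_mul _).const_mul _).mul_const _
  have i4 : Integrable (fun z => η * (t * z) ^ 2 * (1 + gavg F'' x σ) +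
      if κ < |t * z| then K * |t * z| ^ e else 0) stdG := i3.add (integrable_ite_rpow_stdG he)
  rw [← Real.norm_eq_abs]
  refine norm_integral_le_of_norm_le i4 (Eventually.of_forall fun z => ?_)
  rw [Real.norm_eq_abs]
  exact hF.abs_gavg_add_sub_le hR _ _ _

lemma TaylorData.gavg_mono (hF : TaylorData F F' F'' e) (x : ℝ) {σ t τ : ℝ}
    (h : τ ^ 2 = σ ^ 2 + t ^ 2) : gavg F x σ ≤ gavg F x τ := by
  have i0 := hF.growth.integrable x σ
  have i1 : Integrable (fun z : ℝ => z) stdG := by simpa using integrable_pow_stdG 1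
  have key : ∀ y, gavg F x σ + gavg F' x σ * y ≤ gavg F (x + y) σ := by
    intro y
    have : gavg F x σ + gavg F' x σ * y = ∫ z, (F (x + σ * z) + F' (x + σ * z) * y) ∂stdG := by
      rw [integral_add i0 ((hF.growth'.integrable x σ).mul_const y), integral_mul_const]
      rfl
    rw [this]
    refine integral_mono (i0.add ((hF.growth'.integrable x σ).mul_const y))
      (hF.growth.integrable _ _) fun z => ?_
    have := hF.tangent (x + σ * z) y
    simpa [add_right_comm] using this
  have h1 : gavg F x σ = ∫ z, (gavg F x σ + gavg F' x σ * (t * z)) ∂stdG := by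
    rw [integral_add (integrable_const _) ((i1.const_mul t).const_mul _), integral_const_mul,
      integral_const_mul, integral_id_stdG]
    simp
  rw [h1, hF.growth.gavg_of_sq_add_sq x h]
  exact integral_mono ((integrable_const _).add ((i1.const_mul t).const_mul _))
    (TaylorData.integrable_gavg hF.growth x t σ) fun z => key _

/-- The Gaussian tail term is of third order. -/
lemma integral_ite_rpow_stdG_le (he : 2 ≤ e) {K κ : ℝ} (hK : 0 ≤ K) (hκ : 0 < κ) (M : ℝ) :
    ∃ D, 0 ≤ D ∧ ∀ t c, |t| ≤ 1 → |c| ≤ M →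
      ∫ z, (if κ < |t * c * z| then K * |t * c * z| ^ e else 0) ∂stdG ≤ D * |t| ^ 3 := by
  have h_int : Integrable (fun z : ℝ => (0 + |M| * |z|) ^ (e + 1)) stdG := by
    have := integrable_ite_rpow_stdG (K := 1) (κ := -1) (t := M) (e := e + 1) (by linarith)
    refine this.congr (Eventually.of_forall fun z => ?_)
    have h0 : (-1 : ℝ) < |M * z| := by linarith [abs_nonneg (M * z)]
    beta_reduce
    rw [if_pos h0, one_mul, abs_mul, zero_add]
  refine ⟨K / κ * ∫ z, (0 + |M| * |z|) ^ (e + 1) ∂stdG, ?_, fun t c ht hc => ?_⟩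
  · exact mul_nonneg (by positivity) (integral_nonneg fun z => by positivity)
  have hcM : |c| ≤ |M| := hc.trans (le_abs_self M)
  have : K / κ * (∫ z, (0 + |M| * |z|) ^ (e + 1) ∂stdG) * |t| ^ 3 =
      ∫ z, K / κ * |t| ^ 3 * (0 + |M| * |z|) ^ (e + 1) ∂stdG := by
    rw [integral_const_mul]; ring
  rw [this]
  refine integral_mono (integrable_ite_rpow_stdG (by linarith)) (h_int.const_mul _) fun z => ?_
  have hb : |t * c * z| ≤ |t| * (0 + |M| * |z|) := by
    rw [abs_mul, abs_mul, zero_add, mul_assoc]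
    gcongr
  simp only
  split_ifs with h
  · have hpos : 0 < |t * c * z| := hκ.trans h
    have ht3 : |t| ^ (e + 1) ≤ |t| ^ 3 := by
      rw [← Real.rpow_natCast]
      rcases (abs_nonneg t).eq_or_lt with h0 | h0
      · rw [← h0, Real.zero_rpow (by linarith), Real.zero_rpow (by norm_num)]
      · exact Real.rpow_le_rpow_of_exponent_ge h0 ht (by push_cast; linarith)
    calc K * |t * c * z| ^ e ≤ K / κ * |t * c * z| ^ (e + 1) := by
          rw [Real.rpow_add hpos, Real.rpow_one, div_mul_eq_mul_div, le_div_iff₀ hκ]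
          have : 0 ≤ K * |t * c * z| ^ e := by positivity
          nlinarith
      _ ≤ K / κ * (|t| * (0 + |M| * |z|)) ^ (e + 1) := by
          gcongr
      _ = K / κ * |t| ^ (e + 1) * (0 + |M| * |z|) ^ (e + 1) := by
          rw [Real.mul_rpow (abs_nonneg t) (by positivity)]; ring
      _ ≤ _ := by gcongr
  · positivity

end Stabilization

section Stabilization

open Filter Topology

lemma exists_taylor_two {F F' F'' : ℝ → ℝ} (h1 : ∀ x, HasDerivAt F (F' x) x)
    (h2 : ∀ x, HasDerivAt F' (F'' x) x) (x h : ℝ) :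
    ∃ ξ, |ξ - x| ≤ |h| ∧ F (x + h) - F x - F' x * h = F'' ξ * h ^ 2 / 2 := by
  set R := F (x + h) - F x - F' x * h with hR
  have hlin : ∀ s : ℝ, HasDerivAt (fun s => x + s * h) h s := fun s => by
    simpa using ((hasDerivAt_id s).mul_const h).const_add x
  set φ : ℝ → ℝ := fun s => F (x + s * h) - F x - F' x * (s * h) - R * s ^ 2
  set φ' : ℝ → ℝ := fun s => F' (x + s * h) * h - F' x * h - R * (2 * s)
  have hφ : ∀ s, HasDerivAt φ (φ' s) s := fun s => by
    have a1 := ((h1 (x + s * h)).comp s (hlin s)).sub_const (F x)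
    have a2 := ((hasDerivAt_id s).mul_const h).const_mul (F' x)
    have a3 := ((hasDerivAt_id s).pow 2).const_mul R
    refine ((a1.sub a2).sub a3).congr_deriv ?_
    simp [φ']
  have hφ' : ∀ s, HasDerivAt φ' (F'' (x + s * h) * h * h - R * 2) s := fun s => by
    have a1 := (((h2 (x + s * h)).comp s (hlin s)).mul_const h).sub_const (F' x * h)
    have a3 := ((hasDerivAt_id s).const_mul 2).const_mul R
    refine (a1.sub a3).congr_deriv ?_
    ring
  obtain ⟨s1, ⟨hs1, hs1'⟩, e1⟩ := exists_hasDerivAt_eq_zero (f := φ) (f' := φ') zero_lt_one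
    (fun s _ => (hφ s).continuousAt.continuousWithinAt) (by simp [φ, hR]) (fun s _ => hφ s)
  obtain ⟨s2, ⟨hs2, hs2'⟩, e2⟩ := exists_hasDerivAt_eq_zero (f := φ') hs1
    (fun s _ => (hφ' s).continuousAt.continuousWithinAt) (by rw [e1]; simp [φ'])
    (fun s _ => hφ' s)
  refine ⟨x + s2 * h, ?_, by linarith⟩
  rw [add_sub_cancel_left, abs_mul, abs_of_pos hs2]
  have := abs_nonneg h
  nlinarith

/-- Constructor for `TaylorData` from a modulus of continuity of the second derivative. -/
lemma TaylorData.of_modulus {F F' F'' : ℝ → ℝ} {e : ℝ} (h1 : ∀ x, HasDerivAt F (F' x) x)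
    (h2 : ∀ x, HasDerivAt F' (F'' x) x) (g : PolyGrowth F) (g' : PolyGrowth F')
    (g'' : PolyGrowth F'') (nonneg : ∀ x, 0 ≤ F x) (nonneg'' : ∀ x, 0 ≤ F'' x)
    (dominated : ∃ C, 0 ≤ C ∧ ∀ x, 1 + F'' x ≤ C * (1 + F x)) (two_le : 2 ≤ e)
    (modulus : ∀ η > 0, ∃ K ≥ 0, ∃ κ > 0, ∀ x h,
      |F'' (x + h) - F'' x| ≤ η * (1 + F'' x) + if κ < |h| then K * |h| ^ (e - 2) else 0) :
    TaylorData F F' F'' e where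
  growth := g
  growth' := g'
  growth'' := g''
  nonneg := nonneg
  nonneg'' := nonneg''
  dominated := dominated
  two_le := two_le
  tangent x h := by
    obtain ⟨ξ, -, hξ⟩ := exists_taylor_two h1 h2 x h
    have : 0 ≤ F'' ξ * h ^ 2 / 2 := by have := nonneg'' ξ; positivity
    linarith
  remainder η hη := by
    obtain ⟨K, hK, κ, hκ, hm⟩ := modulus η hη
    refine ⟨K, hK, κ, hκ, fun x h => ?_⟩
    obtain ⟨ξ, hle, hξ⟩ := exists_taylor_two h1 h2 x h
    have h3 := hm x (ξ - x)
    rw [add_sub_cancel] at h3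
    have h4 : (if κ < |ξ - x| then K * |ξ - x| ^ (e - 2) else 0) ≤
        if κ < |h| then K * |h| ^ (e - 2) else 0 := by
      by_cases c : κ < |ξ - x|
      · rw [if_pos c, if_pos (c.trans_le hle)]
        have : |ξ - x| ^ (e - 2) ≤ |h| ^ (e - 2) :=
          Real.rpow_le_rpow (abs_nonneg _) hle (by linarith)
        exact mul_le_mul_of_nonneg_left this hK
      · rw [if_neg c]
        split_ifs <;> positivity
    have h5 : (if κ < |h| then K * |h| ^ (e - 2) else 0) * h ^ 2 =
        if κ < |h| then K * |h| ^ e else 0 := by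
      split_ifs with c
      · have : 0 < |h| := hκ.trans c
        rw [mul_assoc, ← sq_abs h, ← Real.rpow_natCast, ← Real.rpow_add this]
        norm_num
      · simp
    have h6 : F (x + h) - F x - F' x * h - F'' x * h ^ 2 / 2 = (F'' ξ - F'' x) * (h ^ 2 / 2) := by
      rw [hξ]; ring
    rw [h6, abs_mul, abs_of_nonneg (by positivity : 0 ≤ h ^ 2 / 2), ← h5]
    have h7 : 0 ≤ η * (1 + F'' x) := by have := nonneg'' x; positivity
    have h8 : 0 ≤ if κ < |h| then K * |h| ^ (e - 2) else 0 := by split_ifs <;> positivity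
    calc |F'' ξ - F'' x| * (h ^ 2 / 2)
        ≤ (η * (1 + F'' x) + if κ < |h| then K * |h| ^ (e - 2) else 0) * (h ^ 2 / 2) := by
          refine mul_le_mul_of_nonneg_right (h3.trans (by linarith)) (by positivity)
      _ ≤ (η * (1 + F'' x) + if κ < |h| then K * |h| ^ (e - 2) else 0) * h ^ 2 := by
          refine mul_le_mul_of_nonneg_left ?_ (by linarith)
          linarith [sq_nonneg h]
      _ = _ := by ring

lemma PolyGrowth.of_rpow {f : ℝ → ℝ} (hc : Continuous f) {C s : ℝ} (hC : 0 ≤ C)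
    (h : ∀ x, |f x| ≤ C * (1 + |x|) ^ s) : PolyGrowth f := by
  refine ⟨hc, C, ⌈s⌉₊, fun x => (h x).trans ?_⟩
  rw [← Real.rpow_natCast]
  refine mul_le_mul_of_nonneg_left ?_ hC
  exact Real.rpow_le_rpow_of_exponent_le (by linarith [abs_nonneg x]) (Nat.le_ceil s)

lemma abs_rpow_le_one_add {x s : ℝ} (hs : 0 ≤ s) : |x| ^ s ≤ (1 + |x|) ^ s :=
  Real.rpow_le_rpow (abs_nonneg x) (by linarith [abs_nonneg x]) hs

/-- Modulus of continuity of `|x| ^ s`, relative to its size. -/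
lemma exists_abs_rpow_sub_le {s : ℝ} (hs : 0 < s) {η : ℝ} (hη : 0 < η) :
    ∃ K ≥ 0, ∀ x h : ℝ, |(|x + h| ^ s - |x| ^ s)| ≤ η * |x| ^ s + K * |h| ^ s := by
  have hc : ContinuousAt (fun u : ℝ => |u| ^ s) 1 := by
    exact (continuous_abs.rpow_const fun _ => Or.inr hs.le).continuousAt
  obtain ⟨δ, hδ, hd⟩ := Metric.continuousAt_iff.1 hc η hη
  refine ⟨(1 + 2 / δ) ^ s + (2 / δ) ^ s, by positivity, fun x h => ?_⟩
  rcases lt_or_ge |h| (δ * |x|) with hlt | hge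
  · have hx : 0 < |x| := by
      by_contra hx
      have : |x| = 0 := le_antisymm (not_lt.1 hx) (abs_nonneg _)
      rw [this, mul_zero] at hlt
      exact absurd hlt (not_lt.2 (abs_nonneg h))
    have hx' : x ≠ 0 := abs_pos.1 hx
    have h1 := @hd (1 + h / x) (by
      rw [Real.dist_eq, add_sub_cancel_left, abs_div, div_lt_iff₀ hx]; exact hlt)
    rw [Real.dist_eq] at h1
    have h2 : |x + h| = |x| * |1 + h / x| := by
      rw [← abs_mul]; congr 1; field_simp
    rw [h2, Real.mul_rpow (abs_nonneg _) (abs_nonneg _)]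
    have h3 : |x| ^ s * |1 + h / x| ^ s - |x| ^ s = |x| ^ s * (|1 + h / x| ^ s - |(1 : ℝ)| ^ s) := by
      simp; ring
    rw [h3, abs_mul, abs_of_nonneg (by positivity : 0 ≤ |x| ^ s)]
    have : |x| ^ s * |(|1 + h / x| ^ s - |(1 : ℝ)| ^ s)| ≤ |x| ^ s * η :=
      mul_le_mul_of_nonneg_left h1.le (by positivity)
    have : 0 ≤ ((1 + 2 / δ) ^ s + (2 / δ) ^ s) * |h| ^ s := by positivity
    linarith
  · have hx : |x| ≤ 2 / δ * |h| := by
      rw [div_mul_eq_mul_div, le_div_iff₀ hδ]; nlinarith [abs_nonneg h, abs_nonneg x]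
    have h1 : |x + h| ≤ (1 + 2 / δ) * |h| := by linarith [abs_add_le x h]
    have h2 : |x + h| ^ s ≤ (1 + 2 / δ) ^ s * |h| ^ s := by
      rw [← Real.mul_rpow (by positivity) (abs_nonneg _)]
      exact Real.rpow_le_rpow (abs_nonneg _) h1 hs.le
    have h3 : |x| ^ s ≤ (2 / δ) ^ s * |h| ^ s := by
      rw [← Real.mul_rpow (by positivity) (abs_nonneg _)]
      exact Real.rpow_le_rpow (abs_nonneg _) hx hs.le
    have h4 : 0 ≤ |x + h| ^ s := by positivity
    have h5 : 0 ≤ |x| ^ s := by positivity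
    have h6 : 0 ≤ η * |x| ^ s := by positivity
    rw [abs_le]
    constructor <;> nlinarith

lemma hasDerivAt_abs_rpow_mul_self {s : ℝ} (hs : 0 < s) (x : ℝ) :
    HasDerivAt (fun x : ℝ => |x| ^ s * x) ((s + 1) * |x| ^ s) x := by
  rcases eq_or_ne x 0 with rfl | hx
  · rw [hasDerivAt_iff_tendsto_slope]
    have hc : Continuous (fun u : ℝ => |u| ^ s) := continuous_abs.rpow_const fun _ => Or.inr hs.le
    have := (hc.tendsto 0).mono_left (nhdsWithin_le_nhds (s := {0}ᶜ))
    simp only [abs_zero, Real.zero_rpow hs.ne', mul_zero] at this ⊢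
    refine this.congr' ?_
    filter_upwards [self_mem_nhdsWithin] with y hy
    have : y ≠ 0 := hy
    rw [slope_def_field]
    field_simp
    simp [Real.zero_rpow hs.ne']
  · have h1 : HasDerivAt (fun x : ℝ => |x| ^ s) (s * |x| ^ (s - 1) * (SignType.sign x : ℝ)) x := by
      have := (hasDerivAt_abs hx).rpow_const (p := s) (Or.inl (abs_ne_zero.2 hx))
      convert this using 1; ring
    have h2 := h1.mul (hasDerivAt_id x)
    refine h2.congr_deriv ?_
    have h3 : (SignType.sign x : ℝ) * x = |x| := by simp
    have h4 : |x| ^ s = |x| ^ (s - 1) * |x| := by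
      rw [← Real.rpow_add_one (abs_ne_zero.2 hx)]; norm_num
    simp only [id, mul_one]
    rw [mul_assoc, h3, mul_assoc, ← h4]; ring

lemma taylorData_abs_rpow {r : ℝ} (hr : 2 < r) :
    TaylorData (fun x => |x| ^ r) (fun x => r * |x| ^ (r - 2) * x)
      (fun x => r * (r - 1) * |x| ^ (r - 2)) r := by
  have hs : 0 < r - 2 := by linarith
  have c1 : Continuous fun x : ℝ => |x| ^ r := continuous_abs.rpow_const fun _ => Or.inr (by linarith)
  have c2 : Continuous fun x : ℝ => |x| ^ (r - 2) := continuous_abs.rpow_const fun _ => Or.inr hs.le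
  have hr1 : 0 < r - 1 := by linarith
  have hr0 : 0 < r := by linarith
  refine .of_modulus (fun x => hasDerivAt_abs_rpow x (by linarith)) (fun x => ?_)
    (.of_rpow c1 (C := 1) (s := r) zero_le_one fun x => ?_)
    (.of_rpow (by fun_prop) (C := r) (s := r - 2 + 1) (by linarith) fun x => ?_)
    (.of_rpow (by fun_prop) (C := r * (r - 1)) (s := r - 2) (by positivity) fun x => ?_)
    (fun x => by positivity) (fun x => by positivity) ⟨1 + r * (r - 1), by positivity, fun x => ?_⟩
    hr.le (fun η hη => ?_)
  · have := (hasDerivAt_abs_rpow_mul_self hs x).const_mul r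
    simp only [← mul_assoc] at this
    refine this.congr_deriv ?_
    ring
  · rw [abs_of_nonneg (by positivity), one_mul]
    exact abs_rpow_le_one_add (by linarith)
  · have h0 : 0 ≤ |x| := abs_nonneg x
    rw [abs_mul, abs_mul, abs_of_pos hr0, abs_of_nonneg (by positivity : 0 ≤ |x| ^ (r - 2)),
      Real.rpow_add_one (by positivity), mul_assoc]
    have := abs_rpow_le_one_add (x := x) hs.le
    gcongr
    linarith
  · rw [abs_of_nonneg (by positivity)]
    exact mul_le_mul_of_nonneg_left (abs_rpow_le_one_add hs.le) (by positivity)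
  · have h0 : |x| ^ (r - 2) ≤ 1 + |x| ^ r := by
      have hx := abs_nonneg x
      rcases le_total |x| 1 with h | h
      · have := Real.rpow_le_one hx h hs.le
        have : 0 ≤ |x| ^ r := by positivity
        linarith
      · have := Real.rpow_le_rpow_of_exponent_le h (by linarith : r - 2 ≤ r)
        linarith
    have h1 : 0 ≤ |x| ^ r := by positivity
    have h2 := mul_le_mul_of_nonneg_left h0 (by positivity : 0 ≤ r * (r - 1))
    nlinarith
  · have hrr : 0 < r * (r - 1) := by positivity
    obtain ⟨K, hK, h⟩ := exists_abs_rpow_sub_le hs hη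
    obtain ⟨κ, hκ, hκ'⟩ : ∃ κ > 0, r * (r - 1) * K * κ ^ (r - 2) ≤ η := by
      have hc : Tendsto (fun u : ℝ => r * (r - 1) * K * u ^ (r - 2)) (𝓝[>] 0) (𝓝 0) := by
        have : Continuous fun u : ℝ => r * (r - 1) * K * u ^ (r - 2) :=
          (continuous_id.rpow_const fun _ => Or.inr hs.le).const_mul _
        have := (this.tendsto 0).mono_left (nhdsWithin_le_nhds (s := Set.Ioi 0))
        simpa [Real.zero_rpow hs.ne'] using this
      have h1 := hc.eventually (ge_mem_nhds hη)
      obtain ⟨κ, h2, h3⟩ := (h1.and self_mem_nhdsWithin).exists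
      exact ⟨κ, h3, h2⟩
    refine ⟨r * (r - 1) * K, by positivity, κ, hκ, fun x h' => ?_⟩
    rw [← mul_sub, abs_mul, abs_of_pos hrr]
    have h1 := mul_le_mul_of_nonneg_left (h x h') hrr.le
    have h2 : r * (r - 1) * K * |h'| ^ (r - 2) ≤
        η + if κ < |h'| then r * (r - 1) * K * |h'| ^ (r - 2) else 0 := by
      split_ifs with c
      · linarith
      · have : |h'| ^ (r - 2) ≤ κ ^ (r - 2) :=
          Real.rpow_le_rpow (abs_nonneg _) (not_lt.1 c) hs.le
        have := mul_le_mul_of_nonneg_left this (by positivity : 0 ≤ r * (r - 1) * K)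
        linarith
    nlinarith

lemma taylorData_one_add_sq_rpow {r : ℝ} (hr : 1 < r) (hr2 : r < 2) :
    TaylorData (fun x => (1 + x ^ 2) ^ (r / 2)) (fun x => r * x * (1 + x ^ 2) ^ (r / 2 - 1))
      (fun x => r * (1 + x ^ 2) ^ (r / 2 - 2) * (1 + (r - 1) * x ^ 2)) 2 := by
  have hpos : ∀ x : ℝ, 0 < 1 + x ^ 2 := fun x => by positivity
  have hone : ∀ x : ℝ, 1 ≤ 1 + x ^ 2 := fun x => by linarith [sq_nonneg x]
  have hcont : ∀ s : ℝ, Continuous fun x : ℝ => (1 + x ^ 2) ^ s := fun s =>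
    (by fun_prop : Continuous fun x : ℝ => 1 + x ^ 2).rpow_const fun x => Or.inl (hpos x).ne'
  have c1 := hcont (r / 2)
  have c2 := hcont (r / 2 - 1)
  have c3 := hcont (r / 2 - 2)
  have hder : ∀ s x : ℝ, HasDerivAt (fun x : ℝ => (1 + x ^ 2) ^ s)
      (2 * s * x * (1 + x ^ 2) ^ (s - 1)) x := fun s x => by
    have h1 : HasDerivAt (fun x : ℝ => 1 + x ^ 2) (2 * x) x := by
      simpa using (hasDerivAt_pow 2 x).const_add 1
    refine (h1.rpow_const (p := s) (Or.inl (hpos x).ne')).congr_deriv ?_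
    ring
  have hnn : ∀ x : ℝ, 0 ≤ r * (1 + x ^ 2) ^ (r / 2 - 2) * (1 + (r - 1) * x ^ 2) := fun x => by
    have : 0 ≤ r - 1 := by linarith
    positivity
  have hle : ∀ x : ℝ, r * (1 + x ^ 2) ^ (r / 2 - 2) * (1 + (r - 1) * x ^ 2) ≤
      r * (1 + x ^ 2) ^ (r / 2 - 1) := fun x => by
    have : (1 + x ^ 2) ^ (r / 2 - 1) = (1 + x ^ 2) ^ (r / 2 - 2) * (1 + x ^ 2) := by
      rw [← Real.rpow_add_one (hpos x).ne']; congr 1; ring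
    rw [this, ← mul_assoc]
    refine mul_le_mul_of_nonneg_left ?_ (by positivity)
    nlinarith [sq_nonneg x]
  have hle2 : ∀ x : ℝ, r * (1 + x ^ 2) ^ (r / 2 - 2) * (1 + (r - 1) * x ^ 2) ≤ 2 := fun x => by
    have := Real.rpow_le_one_of_one_le_of_nonpos (hone x) (by linarith : r / 2 - 1 ≤ 0)
    nlinarith [hle x]
  have hF : ∀ x : ℝ, 0 ≤ (1 + x ^ 2) ^ (r / 2) := fun x => by positivity
  have hunif : UniformContinuous fun x : ℝ =>
      r * (1 + x ^ 2) ^ (r / 2 - 2) * (1 + (r - 1) * x ^ 2) := by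
    refine Continuous.uniformContinuous_of_tendsto_cocompact (x := 0) (by fun_prop) ?_
    have h1 : Tendsto (fun x : ℝ => 1 + x ^ 2) (cocompact ℝ) atTop := by
      have : Tendsto (fun x : ℝ => ‖x‖ ^ 2) (cocompact ℝ) atTop :=
        (tendsto_pow_atTop two_ne_zero).comp tendsto_norm_cocompact_atTop
      simp only [Real.norm_eq_abs, sq_abs] at this
      exact tendsto_atTop_add_const_left _ _ this
    have h2 := (tendsto_rpow_neg_atTop (by linarith : 0 < 1 - r / 2)).comp h1
    have h3 := h2.const_mul r
    rw [mul_zero] at h3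
    refine tendsto_of_tendsto_of_tendsto_of_le_of_le tendsto_const_nhds h3 hnn fun x => ?_
    refine (hle x).trans (le_of_eq ?_)
    simp
  refine .of_modulus (fun x => ?_) (fun x => ?_)
    (.of_rpow c1 (C := 1) (s := r) zero_le_one fun x => ?_)
    (.of_rpow (by fun_prop) (C := 2) (s := 1) (by linarith) fun x => ?_)
    (.of_rpow (by fun_prop) (C := 2) (s := 0) (by positivity) fun x => ?_)
    hF hnn ⟨3, by norm_num, fun x => ?_⟩ le_rfl (fun η hη => ?_)
  · refine (hder (r / 2) x).congr_deriv ?_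
    ring
  · have := ((hasDerivAt_id x).const_mul r).mul (hder (r / 2 - 1) x)
    refine this.congr_deriv ?_
    have e1 : (1 + x ^ 2) ^ (r / 2 - 1) = (1 + x ^ 2) ^ (r / 2 - 2) * (1 + x ^ 2) := by
      rw [← Real.rpow_add_one (hpos x).ne']; congr 1; ring
    have e2 : r / 2 - 1 - 1 = r / 2 - 2 := by ring
    rw [e2]
    simp only [id]
    rw [e1]
    ring
  · rw [abs_of_nonneg (hF x), one_mul]
    have h0 : 0 ≤ 1 + |x| := by positivity
    have : (1 + |x|) ^ r = ((1 + |x|) ^ 2) ^ (r / 2) := by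
      rw [← Real.rpow_natCast, ← Real.rpow_mul h0]; congr 1; push_cast; ring
    rw [this]
    refine Real.rpow_le_rpow (hpos x).le ?_ (by linarith)
    nlinarith [abs_nonneg x, sq_abs x]
  · have := Real.rpow_le_one_of_one_le_of_nonpos (hone x) (by linarith : r / 2 - 1 ≤ 0)
    have h1 : 0 ≤ (1 + x ^ 2) ^ (r / 2 - 1) := by positivity
    rw [abs_mul, abs_mul, abs_of_nonneg h1, abs_of_pos (by linarith : 0 < r), Real.rpow_one]
    have := abs_nonneg x
    calc r * |x| * (1 + x ^ 2) ^ (r / 2 - 1) ≤ 2 * |x| * 1 := by gcongr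
      _ ≤ _ := by linarith
  · rw [abs_of_nonneg (hnn x), Real.rpow_zero]
    linarith [hle2 x]
  · linarith [hle2 x, hF x]
  · obtain ⟨δ, hδ, hd⟩ := Metric.uniformContinuous_iff.1 hunif η hη
    refine ⟨2, by norm_num, δ / 2, by positivity, fun x h => ?_⟩
    have h0 : 0 ≤ η * (r * (1 + x ^ 2) ^ (r / 2 - 2) * (1 + (r - 1) * x ^ 2)) :=
      mul_nonneg hη.le (hnn x)
    split_ifs with c
    · rw [sub_self, Real.rpow_zero, abs_le]
      constructor <;> linarith [hle2 x, hle2 (x + h), hnn x, hnn (x + h)]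
    · have := hd (a := x + h) (b := x) (by rw [Real.dist_eq, add_sub_cancel_left]; linarith)
      rw [Real.dist_eq] at this
      linarith

end Stabilization

section Stabilization

open Filter Topology

variable {Ω ι : Type*} [MeasurableSpace Ω]

/-- Bounded measurable functions. -/
def BddMeas (f : Ω → ℝ) : Prop := Measurable f ∧ ∃ C, ∀ ω, |f ω| ≤ C

lemma BddMeas.integrable {f : Ω → ℝ} (hf : BddMeas f) {ν : Measure Ω} [IsFiniteMeasure ν] :
    Integrable f ν := by
  obtain ⟨h, C, hC⟩ := hf
  exact Integrable.of_bound h.aestronglyMeasurable C (Eventually.of_forall hC)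

lemma BddMeas.integrable_mul {f g : Ω → ℝ} (hf : BddMeas f) {ν : Measure Ω}
    (hg : Integrable g ν) : Integrable (fun ω => f ω * g ω) ν := by
  obtain ⟨h, C, hC⟩ := hf
  exact hg.bdd_mul h.aestronglyMeasurable (Eventually.of_forall hC)

lemma BddMeas.const (c : ℝ) : BddMeas (fun _ : Ω => c) := ⟨measurable_const, |c|, fun _ => le_rfl⟩

lemma BddMeas.add {f g : Ω → ℝ} (hf : BddMeas f) (hg : BddMeas g) :
    BddMeas fun ω => f ω + g ω := by
  obtain ⟨h, C, hC⟩ := hf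
  obtain ⟨h', C', hC'⟩ := hg
  exact ⟨h.add h', C + C', fun ω => (abs_add_le _ _).trans (add_le_add (hC ω) (hC' ω))⟩

lemma BddMeas.mul {f g : Ω → ℝ} (hf : BddMeas f) (hg : BddMeas g) :
    BddMeas fun ω => f ω * g ω := by
  obtain ⟨h, C, hC⟩ := hf
  obtain ⟨h', C', hC'⟩ := hg
  refine ⟨h.mul h', C * C', fun ω => ?_⟩
  rw [abs_mul]
  exact mul_le_mul (hC ω) (hC' ω) (abs_nonneg _) ((abs_nonneg _).trans (hC ω))

lemma BddMeas.pow {f : Ω → ℝ} (hf : BddMeas f) (n : ℕ) : BddMeas fun ω => f ω ^ n := by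
  obtain ⟨h, C, hC⟩ := hf
  refine ⟨h.pow_const n, C ^ n, fun ω => ?_⟩
  rw [abs_pow]
  exact pow_le_pow_left₀ (abs_nonneg _) (hC ω) n

lemma BddMeas.sub {f g : Ω → ℝ} (hf : BddMeas f) (hg : BddMeas g) :
    BddMeas fun ω => f ω - g ω := by
  simpa [sub_eq_add_neg] using hf.add ((BddMeas.const (-1)).mul hg)

lemma BddMeas.sum {α : Type*} (s : Finset α) {f : α → Ω → ℝ} (hf : ∀ i, BddMeas (f i)) :
    BddMeas fun ω => ∑ i ∈ s, f i ω := by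
  classical
  induction s using Finset.induction_on with
  | empty => simpa using BddMeas.const 0
  | insert a s ha ih => simpa [Finset.sum_insert ha] using (hf a).add ih

lemma BddMeas.comp₂ {g : ℝ × ℝ → ℝ} (hg : Continuous g) {u v : Ω → ℝ} (hu : BddMeas u)
    (hv : BddMeas v) : BddMeas fun ω => g (u ω, v ω) := by
  obtain ⟨h, C, hC⟩ := hu
  obtain ⟨h', C', hC'⟩ := hv
  obtain ⟨D, hD⟩ := (isCompact_Icc (a := ((-C, -C') : ℝ × ℝ)) (b := (C, C'))).exists_bound_of_continuousOn
    hg.continuousOn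
  refine ⟨hg.measurable.comp (h.prodMk h'), D, fun ω => hD _ ?_⟩
  have h1 := abs_le.1 (hC ω)
  have h2 := abs_le.1 (hC' ω)
  exact ⟨⟨h1.1, h2.1⟩, ⟨h1.2, h2.2⟩⟩

lemma BddMeas.comp {g : ℝ → ℝ} (hg : Continuous g) {u : Ω → ℝ} (hu : BddMeas u) :
    BddMeas fun ω => g (u ω) :=
  BddMeas.comp₂ (g := fun x => g x.1) (by fun_prop) hu hu

/-- Weak convergence is uniform on norm-compact families of bounded test functions. -/
lemma eventually_forall_integral_le {Θ : Type*} [TopologicalSpace Θ] {K : Set Θ}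
    (hK : IsCompact K) {ν : Measure Ω} [IsFiniteMeasure ν] {G : Θ → Ω → ℝ}
    (hG : ∀ θ, BddMeas (G θ))
    (hcont : ∀ θ₀ ∈ K, ∀ η > 0, ∀ᶠ θ in 𝓝 θ₀, ∀ ω, |G θ ω - G θ₀ ω| ≤ η)
    {w : ι → Ω → ℝ} (hw : ∀ i, Integrable (w i) ν) {𝓕 : Filter ι}
    {C : ℝ} (hC : ∀ᶠ i in 𝓕, ∫ ω, |w i ω| ∂ν ≤ C)
    (hlim : ∀ g, BddMeas g → Tendsto (fun i => ∫ ω, g ω * w i ω ∂ν) 𝓕 (𝓝 0))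
    {δ : ℝ} (hδ : 0 < δ) :
    ∀ᶠ i in 𝓕, ∀ θ ∈ K, |∫ ω, G θ ω * w i ω ∂ν| ≤ δ := by
  refine hK.induction_on (by simp) (fun s t hst h => h.mono fun i hi θ hθ => hi θ (hst hθ))
    (fun s t hs ht => (hs.and ht).mono fun i hi θ hθ => hθ.elim (hi.1 θ) (hi.2 θ))
    fun θ₀ hθ₀ => ?_
  refine ⟨_, mem_nhdsWithin_of_mem_nhds
    (hcont θ₀ hθ₀ (δ / 2 / (|C| + 1)) (by positivity)), ?_⟩
  have h2 : ∀ᶠ i in 𝓕, |∫ ω, G θ₀ ω * w i ω ∂ν| ≤ δ / 2 :=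
    ((hlim (G θ₀) (hG θ₀)).abs).eventually (ge_mem_nhds (by rw [abs_zero]; exact half_pos hδ))
  filter_upwards [h2, hC] with i hi hCi θ hθ
  have e1 : ∫ ω, G θ ω * w i ω ∂ν =
      (∫ ω, G θ₀ ω * w i ω ∂ν) + ∫ ω, (G θ ω - G θ₀ ω) * w i ω ∂ν := by
    rw [← integral_add ((hG θ₀).integrable_mul (hw i))
      (((hG θ).sub (hG θ₀)).integrable_mul (hw i))]
    exact integral_congr_ae (Eventually.of_forall fun ω => by ring)
  have e2 : |∫ ω, (G θ ω - G θ₀ ω) * w i ω ∂ν| ≤ δ / 2 := by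
    calc |∫ ω, (G θ ω - G θ₀ ω) * w i ω ∂ν|
        ≤ ∫ ω, δ / 2 / (|C| + 1) * |w i ω| ∂ν := by
          rw [← Real.norm_eq_abs]
          refine norm_integral_le_of_norm_le ((hw i).abs.const_mul _)
            (Eventually.of_forall fun ω => ?_)
          rw [Real.norm_eq_abs, abs_mul]
          exact mul_le_mul_of_nonneg_right (hθ ω) (abs_nonneg _)
      _ = δ / 2 / (|C| + 1) * ∫ ω, |w i ω| ∂ν := integral_const_mul _ _
      _ ≤ δ / 2 / (|C| + 1) * (|C| + 1) := by
          gcongr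
          linarith [le_abs_self C]
      _ = δ / 2 := by field_simp
  rw [e1]
  linarith [abs_add_le (∫ ω, G θ₀ ω * w i ω ∂ν) (∫ ω, (G θ ω - G θ₀ ω) * w i ω ∂ν)]

/-- The Gaussian perturbation functional of the Lindeberg replacement scheme. -/
noncomputable def gaussMean (ν : Measure Ω) (f : ℝ → ℝ) (ψ S : Ω → ℝ) (σ : ℝ) : ℝ :=
  ∫ ω, gavg f (S ω) (σ * ψ ω) ∂ν

variable {F F' F'' : ℝ → ℝ} {e : ℝ} {ν : Measure Ω} [IsFiniteMeasure ν]

lemma PolyGrowth.bddMeas_gavg {f : ℝ → ℝ} (hf : PolyGrowth f) {u v : Ω → ℝ} (hu : BddMeas u)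
    (hv : BddMeas v) : BddMeas fun ω => gavg f (u ω) (v ω) :=
  BddMeas.comp₂ (g := fun x => gavg f x.1 x.2) hf.continuous_gavg hu hv

lemma gavg_zero_right (f : ℝ → ℝ) (x : ℝ) : gavg f x 0 = f x := by
  simp [gavg]

lemma BddMeas.integrable_ite {y : Ω → ℝ} (hy : BddMeas y) (he : 0 ≤ e) (κ K t : ℝ) :
    Integrable (fun ω => if κ < |t * y ω| then K * |t * y ω| ^ e else 0) ν := by
  have h1 : BddMeas fun ω => K * |t * y ω| ^ e :=
    hy.comp (g := fun x => K * |t * x| ^ e)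
      (((continuous_const.mul continuous_id).abs.rpow_const fun _ => Or.inr he).const_mul K)
  have hm : MeasurableSet {ω | κ < |t * y ω|} :=
    measurableSet_lt measurable_const (hy.1.const_mul t).abs
  exact h1.integrable.indicator hm

set_option maxHeartbeats 1000000 in
/-- One replacement step of the Lindeberg scheme. -/
lemma TaylorData.lindeberg_step (hF : TaylorData F F' F'' e) {ψ : Ω → ℝ} (hψ : BddMeas ψ) :
    ∃ A, 0 ≤ A ∧ ∀ η > 0, η ≤ 1 → ∃ κ > 0, ∃ K ≥ 0, ∃ t₀ > 0, t₀ ≤ 1 ∧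
      ∀ S y : Ω → ℝ, BddMeas S → BddMeas y → ∀ σ t τ δ : ℝ, |t| ≤ t₀ → τ ^ 2 = σ ^ 2 + t ^ 2 →
      δ ≤ 1 →
      |∫ ω, gavg F' (S ω) (σ * ψ ω) * y ω ∂ν| ≤ δ →
      |∫ ω, gavg F'' (S ω) (σ * ψ ω) * (y ω ^ 2 - ψ ω ^ 2) ∂ν| ≤ δ →
      |∫ ω, (y ω ^ 2 - ψ ω ^ 2) ∂ν| ≤ δ →
      (∫ ω, (if κ < |t * y ω| then K * |t * y ω| ^ e else 0) ∂ν) ≤ η * t ^ 2 →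
      |gaussMean ν F ψ (fun ω => S ω + t * y ω) σ - gaussMean ν F ψ S τ| ≤
        4 * δ + η * A * t ^ 2 * (1 + gaussMean ν F ψ S τ) := by
  obtain ⟨C, hC, hdom⟩ := hF.gavg_dominated
  obtain ⟨hψm, M, hM⟩ := id hψ
  set V := ν.real Set.univ
  have hV : 0 ≤ V := measureReal_nonneg
  refine ⟨2 * M ^ 2 * C * (1 + V) + 2, by positivity, fun η hη hη1 => ?_⟩
  obtain ⟨K, hK, κ, hκ, hR⟩ := hF.remainder η hη
  obtain ⟨D, hD, htail⟩ := integral_ite_rpow_stdG_le hF.two_le hK hκ M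
  refine ⟨κ, hκ, K, hK, min 1 (η / (D * V + 1)), by positivity, min_le_left _ _, ?_⟩
  intro S y hS hy σ t τ δ ht hτ hδ h1 h2 h3 h4
  have ht1 : |t| ≤ 1 := ht.trans (min_le_left _ _)
  have htD : D * V * |t| ≤ η := by
    have := ht.trans (min_le_right _ _)
    rw [le_div_iff₀ (by positivity)] at this
    nlinarith [abs_nonneg t]
  have he : 0 ≤ e := by linarith [hF.two_le]
  have hσψ : ∀ s : ℝ, BddMeas fun ω => s * ψ ω := fun s => (BddMeas.const s).mul hψ
  have hty : BddMeas fun ω => t * y ω := (BddMeas.const t).mul hy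
  have b0 := hF.growth.bddMeas_gavg hS (hσψ σ)
  have b1 := hF.growth'.bddMeas_gavg hS (hσψ σ)
  have b2 := hF.growth''.bddMeas_gavg hS (hσψ σ)
  have b3 := hF.growth.bddMeas_gavg (hS.add hty) (hσψ σ)
  have b4 := hF.growth.bddMeas_gavg hS (hσψ τ)
  have hτω : ∀ ω, (τ * ψ ω) ^ 2 = (σ * ψ ω) ^ 2 + (t * ψ ω) ^ 2 := fun ω => by
    rw [mul_pow, mul_pow, mul_pow, hτ]; ring
  -- the mean of the pointwise errors
  have hpt : ∀ ω, |gavg F (S ω + t * y ω) (σ * ψ ω) - gavg F (S ω) (τ * ψ ω)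
      - gavg F' (S ω) (σ * ψ ω) * (t * y ω)
      - gavg F'' (S ω) (σ * ψ ω) * (t ^ 2 / 2 * (y ω ^ 2 - ψ ω ^ 2))| ≤
      η * t ^ 2 * ((y ω ^ 2 + ψ ω ^ 2) * (1 + gavg F'' (S ω) (σ * ψ ω))) +
        (if κ < |t * y ω| then K * |t * y ω| ^ e else 0) + D * |t| ^ 3 := by
    intro ω
    have a1 := hF.abs_gavg_add_sub_le hR (S ω) (t * y ω) (σ * ψ ω)
    have a2 := hF.abs_gavg_sub_le hR (S ω) (hτω ω)
    have a3 := htail t (ψ ω) ht1 (hM ω)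
    rw [abs_le] at a1 a2 ⊢
    constructor <;> nlinarith
  have i1 : Integrable (fun ω => gavg F (S ω + t * y ω) (σ * ψ ω) - gavg F (S ω) (τ * ψ ω)) ν :=
    (b3.sub b4).integrable
  have i2 : Integrable (fun ω => gavg F' (S ω) (σ * ψ ω) * (t * y ω)) ν := (b1.mul hty).integrable
  have by2 : BddMeas fun ω => y ω ^ 2 - ψ ω ^ 2 := (hy.pow 2).sub (hψ.pow 2)
  have i3 : Integrable (fun ω => gavg F'' (S ω) (σ * ψ ω) *
      (t ^ 2 / 2 * (y ω ^ 2 - ψ ω ^ 2))) ν :=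
    (b2.mul ((BddMeas.const _).mul by2)).integrable
  have b5 : BddMeas fun ω => (y ω ^ 2 + ψ ω ^ 2) * (1 + gavg F'' (S ω) (σ * ψ ω)) :=
    ((hy.pow 2).add (hψ.pow 2)).mul ((BddMeas.const 1).add b2)
  have i4 : Integrable (fun ω => η * t ^ 2 *
      ((y ω ^ 2 + ψ ω ^ 2) * (1 + gavg F'' (S ω) (σ * ψ ω)))) ν := b5.integrable.const_mul _
  have i5 := hy.integrable_ite (ν := ν) he κ K t
  have i6 : Integrable (fun ω => η * t ^ 2 *
      ((y ω ^ 2 + ψ ω ^ 2) * (1 + gavg F'' (S ω) (σ * ψ ω))) +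
        (if κ < |t * y ω| then K * |t * y ω| ^ e else 0)) ν := i4.add i5
  have i7 : Integrable (fun ω => η * t ^ 2 *
      ((y ω ^ 2 + ψ ω ^ 2) * (1 + gavg F'' (S ω) (σ * ψ ω))) +
        (if κ < |t * y ω| then K * |t * y ω| ^ e else 0) + D * |t| ^ 3) ν :=
    i6.add (integrable_const _)
  have hI : |gaussMean ν F ψ (fun ω => S ω + t * y ω) σ - gaussMean ν F ψ S τ
      - t * (∫ ω, gavg F' (S ω) (σ * ψ ω) * y ω ∂ν)
      - t ^ 2 / 2 * ∫ ω, gavg F'' (S ω) (σ * ψ ω) * (y ω ^ 2 - ψ ω ^ 2) ∂ν| ≤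
      η * t ^ 2 * (∫ ω, (y ω ^ 2 + ψ ω ^ 2) * (1 + gavg F'' (S ω) (σ * ψ ω)) ∂ν) +
        (∫ ω, (if κ < |t * y ω| then K * |t * y ω| ^ e else 0) ∂ν) + D * |t| ^ 3 * V := by
    have e1 : ∫ ω, (gavg F (S ω + t * y ω) (σ * ψ ω) - gavg F (S ω) (τ * ψ ω)
      - gavg F' (S ω) (σ * ψ ω) * (t * y ω)
      - gavg F'' (S ω) (σ * ψ ω) * (t ^ 2 / 2 * (y ω ^ 2 - ψ ω ^ 2))) ∂ν =
      gaussMean ν F ψ (fun ω => S ω + t * y ω) σ - gaussMean ν F ψ S τ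
      - t * (∫ ω, gavg F' (S ω) (σ * ψ ω) * y ω ∂ν)
      - t ^ 2 / 2 * ∫ ω, gavg F'' (S ω) (σ * ψ ω) * (y ω ^ 2 - ψ ω ^ 2) ∂ν := by
      have i12 : Integrable (fun ω => gavg F (S ω + t * y ω) (σ * ψ ω) - gavg F (S ω) (τ * ψ ω)
        - gavg F' (S ω) (σ * ψ ω) * (t * y ω)) ν := i1.sub i2
      rw [integral_sub i12 i3, integral_sub i1 i2,
        integral_sub b3.integrable b4.integrable, ← integral_const_mul, ← integral_const_mul]
      have c1 : ∀ ω, t * (gavg F' (S ω) (σ * ψ ω) * y ω) =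
        gavg F' (S ω) (σ * ψ ω) * (t * y ω) := fun ω => by ring
      have c2 : ∀ ω, t ^ 2 / 2 * (gavg F'' (S ω) (σ * ψ ω) * (y ω ^ 2 - ψ ω ^ 2)) =
        gavg F'' (S ω) (σ * ψ ω) * (t ^ 2 / 2 * (y ω ^ 2 - ψ ω ^ 2)) := fun ω => by ring
      simp only [c1, c2]
      rfl
    rw [← e1]
    have e2 : ∫ ω, (η * t ^ 2 *
      ((y ω ^ 2 + ψ ω ^ 2) * (1 + gavg F'' (S ω) (σ * ψ ω))) +
        (if κ < |t * y ω| then K * |t * y ω| ^ e else 0) + D * |t| ^ 3) ∂ν =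
      η * t ^ 2 * (∫ ω, (y ω ^ 2 + ψ ω ^ 2) * (1 + gavg F'' (S ω) (σ * ψ ω)) ∂ν) +
        (∫ ω, (if κ < |t * y ω| then K * |t * y ω| ^ e else 0) ∂ν) + D * |t| ^ 3 * V := by
      rw [integral_add i6 (integrable_const _), integral_add i4 i5, integral_const_mul,
        integral_const, smul_eq_mul, mul_comm V]
    rw [← e2, ← Real.norm_eq_abs]
    exact norm_integral_le_of_norm_le i7 (Eventually.of_forall hpt)
  have hΨ0 : gaussMean ν F ψ S σ ≤ gaussMean ν F ψ S τ :=
    integral_mono b0.integrable b4.integrable fun ω => hF.gavg_mono _ (hτω ω)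
  have hΨn : 0 ≤ gaussMean ν F ψ S σ := integral_nonneg fun ω => hF.gavg_nonneg _ _
  have hQ : ∫ ω, (y ω ^ 2 + ψ ω ^ 2) * (1 + gavg F'' (S ω) (σ * ψ ω)) ∂ν ≤
      2 * M ^ 2 * C * (V + gaussMean ν F ψ S τ) + 2 * δ := by
    have c1 : ∫ ω, (y ω ^ 2 + ψ ω ^ 2) * (1 + gavg F'' (S ω) (σ * ψ ω)) ∂ν =
        (∫ ω, 2 * ψ ω ^ 2 * (1 + gavg F'' (S ω) (σ * ψ ω)) ∂ν) +
        ((∫ ω, (y ω ^ 2 - ψ ω ^ 2) ∂ν) +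
          ∫ ω, gavg F'' (S ω) (σ * ψ ω) * (y ω ^ 2 - ψ ω ^ 2) ∂ν) := by
      have j1 : Integrable (fun ω => 2 * ψ ω ^ 2 * (1 + gavg F'' (S ω) (σ * ψ ω))) ν :=
        (((BddMeas.const 2).mul (hψ.pow 2)).mul ((BddMeas.const 1).add b2)).integrable
      have j2 : Integrable (fun ω => gavg F'' (S ω) (σ * ψ ω) * (y ω ^ 2 - ψ ω ^ 2)) ν :=
        (b2.mul by2).integrable
      have j3 : Integrable (fun ω => (y ω ^ 2 - ψ ω ^ 2) +
        gavg F'' (S ω) (σ * ψ ω) * (y ω ^ 2 - ψ ω ^ 2)) ν := by2.integrable.add j2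
      rw [← integral_add by2.integrable j2, ← integral_add j1 j3]
      exact integral_congr_ae (Eventually.of_forall fun ω => by ring)
    have c2 : ∫ ω, 2 * ψ ω ^ 2 * (1 + gavg F'' (S ω) (σ * ψ ω)) ∂ν ≤
        ∫ ω, 2 * M ^ 2 * C * (1 + gavg F (S ω) (σ * ψ ω)) ∂ν := by
      refine integral_mono
        (((BddMeas.const 2).mul (hψ.pow 2)).mul ((BddMeas.const 1).add b2)).integrable
        ((BddMeas.const _).mul ((BddMeas.const 1).add b0)).integrable fun ω => ?_
      have d1 : ψ ω ^ 2 ≤ M ^ 2 := by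
        rw [← sq_abs]; exact pow_le_pow_left₀ (abs_nonneg _) (hM ω) 2
      have d2 := hdom (S ω) (σ * ψ ω)
      have d3 := hF.gavg_nonneg'' (S ω) (σ * ψ ω)
      calc 2 * ψ ω ^ 2 * (1 + gavg F'' (S ω) (σ * ψ ω))
          ≤ 2 * M ^ 2 * (C * (1 + gavg F (S ω) (σ * ψ ω))) := by gcongr
        _ = _ := by ring
    have c3 : ∫ ω, 2 * M ^ 2 * C * (1 + gavg F (S ω) (σ * ψ ω)) ∂ν =
        2 * M ^ 2 * C * (V + gaussMean ν F ψ S σ) := by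
      rw [integral_const_mul, integral_add (integrable_const _) b0.integrable, integral_const]
      simp [gaussMean, V]
    have c4 : 2 * M ^ 2 * C * (V + gaussMean ν F ψ S σ) ≤
        2 * M ^ 2 * C * (V + gaussMean ν F ψ S τ) := by gcongr
    have := (abs_le.1 h2).2
    have := (abs_le.1 h3).2
    linarith
  have hδ0 : 0 ≤ δ := (abs_nonneg _).trans h1
  have k1 : |t * ∫ ω, gavg F' (S ω) (σ * ψ ω) * y ω ∂ν| ≤ δ := by
    rw [abs_mul]
    calc _ ≤ 1 * δ := mul_le_mul ht1 h1 (abs_nonneg _) zero_le_one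
      _ = δ := one_mul δ
  have ht2 : t ^ 2 ≤ 1 := by rw [← sq_abs]; exact pow_le_one₀ (abs_nonneg _) ht1
  have k2 : |t ^ 2 / 2 * ∫ ω, gavg F'' (S ω) (σ * ψ ω) * (y ω ^ 2 - ψ ω ^ 2) ∂ν| ≤ δ := by
    rw [abs_mul, abs_of_nonneg (by positivity : 0 ≤ t ^ 2 / 2)]
    calc _ ≤ 1 * δ := mul_le_mul (by linarith) h2 (abs_nonneg _) zero_le_one
      _ = δ := one_mul δ
  have k3 : D * |t| ^ 3 * V ≤ η * t ^ 2 := by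
    have : D * |t| ^ 3 * V = (D * V * |t|) * t ^ 2 := by rw [← sq_abs t]; ring
    rw [this]
    gcongr
  have k4 := mul_le_mul_of_nonneg_left hQ (by positivity : 0 ≤ η * t ^ 2)
  have k5 : η * t ^ 2 * (2 * δ) ≤ 2 * δ := by
    have : η * t ^ 2 ≤ 1 := mul_le_one₀ hη1 (sq_nonneg t) ht2
    nlinarith
  have hΨτ : 0 ≤ gaussMean ν F ψ S τ := hΨn.trans hΨ0
  have k6 : η * t ^ 2 * (2 * M ^ 2 * C * (V + gaussMean ν F ψ S τ)) ≤
      η * (2 * M ^ 2 * C * (1 + V)) * t ^ 2 * (1 + gaussMean ν F ψ S τ) := by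
    have : V + gaussMean ν F ψ S τ ≤ (1 + V) * (1 + gaussMean ν F ψ S τ) := by nlinarith
    calc _ ≤ η * t ^ 2 * (2 * M ^ 2 * C * ((1 + V) * (1 + gaussMean ν F ψ S τ))) := by gcongr
      _ = _ := by ring
  have k7 : 0 ≤ η * t ^ 2 * gaussMean ν F ψ S τ := by positivity
  rw [abs_le] at hI k1 k2 ⊢
  constructor <;> linarith

end Stabilization

section Stabilization

open Filter Topology

variable {Ω ι : Type*} [MeasurableSpace Ω]

lemma eventually_forall_abs_sub_le {k : ℕ} {g : ℝ × ℝ → ℝ} (hg : Continuous g)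
    {y : Fin k → Ω → ℝ} (hy : ∀ j, BddMeas (y j)) {ψ : Ω → ℝ} (hψ : BddMeas ψ)
    (θ₀ : (Fin k → ℝ) × ℝ) {η : ℝ} (hη : 0 < η) :
    ∀ᶠ θ : (Fin k → ℝ) × ℝ in 𝓝 θ₀, ∀ ω,
      |g (∑ j, θ.1 j * y j ω, θ.2 * ψ ω) - g (∑ j, θ₀.1 j * y j ω, θ₀.2 * ψ ω)| ≤ η := by
  choose hm C hC using hy
  obtain ⟨-, M, hM⟩ := hψ
  have hK : IsCompact (Set.Icc ((fun j => -C j, -M) : (Fin k → ℝ) × ℝ) (C, M)) := isCompact_Icc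
  have hc : Continuous fun z : ((Fin k → ℝ) × ℝ) × ((Fin k → ℝ) × ℝ) =>
      |g (∑ j, z.1.1 j * z.2.1 j, z.1.2 * z.2.2) - g (∑ j, θ₀.1 j * z.2.1 j, θ₀.2 * z.2.2)| := by
    fun_prop
  have := hK.eventually_forall_of_forall_eventually (x₀ := θ₀) (P := fun θ p =>
    |g (∑ j, θ.1 j * p.1 j, θ.2 * p.2) - g (∑ j, θ₀.1 j * p.1 j, θ₀.2 * p.2)| ≤ η)
    fun p _ => hc.continuousAt.eventually (ge_mem_nhds (by simpa using hη))
  refine this.mono fun θ h ω => h (fun j => y j ω, ψ ω) ?_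
  exact ⟨⟨fun j => (abs_le.1 (hC j ω)).1, (abs_le.1 (hM ω)).1⟩,
    ⟨fun j => (abs_le.1 (hC j ω)).2, (abs_le.1 (hM ω)).2⟩⟩

variable {F F' F'' : ℝ → ℝ} {e : ℝ} {ν : Measure Ω} [IsFiniteMeasure ν]

/-- Weak convergence against Gaussian averages of linear combinations of fixed functions,
uniformly in the coefficients. -/
lemma eventually_forall_gavg_le {f : ℝ → ℝ} (hf : PolyGrowth f) {k : ℕ} {y : Fin k → Ω → ℝ}
    (hy : ∀ j, BddMeas (y j)) {ψ : Ω → ℝ} (hψ : BddMeas ψ) {w : ι → Ω → ℝ}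
    (hw : ∀ i, Integrable (w i) ν) {𝓕 : Filter ι} {C : ℝ} (hC : ∀ᶠ i in 𝓕, ∫ ω, |w i ω| ∂ν ≤ C)
    (hlim : ∀ g, BddMeas g → Tendsto (fun i => ∫ ω, g ω * w i ω ∂ν) 𝓕 (𝓝 0))
    {δ : ℝ} (hδ : 0 < δ) :
    ∀ᶠ i in 𝓕, ∀ b : Fin k → ℝ, (∀ j, |b j| ≤ 1) → ∀ σ, |σ| ≤ 1 →
      |∫ ω, gavg f (∑ j, b j * y j ω) (σ * ψ ω) * w i ω ∂ν| ≤ δ := by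
  have hK : IsCompact (Set.Icc ((fun _ => -1, -1) : (Fin k → ℝ) × ℝ) (fun _ => 1, 1)) :=
    isCompact_Icc
  have := eventually_forall_integral_le hK (ν := ν) (w := w)
    (G := fun θ ω => gavg f (∑ j, θ.1 j * y j ω) (θ.2 * ψ ω))
    (fun θ => hf.bddMeas_gavg (BddMeas.sum _ fun j => (BddMeas.const _).mul (hy j))
      ((BddMeas.const _).mul hψ))
    (fun θ₀ _ η hη => eventually_forall_abs_sub_le
      (g := fun z => gavg f z.1 z.2) hf.continuous_gavg hy hψ θ₀ hη) hw hC hlim hδ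
  refine this.mono fun i h b hb σ hσ => h (b, σ) ?_
  exact ⟨⟨fun j => (abs_le.1 (hb j)).1, (abs_le.1 hσ).1⟩,
    ⟨fun j => (abs_le.1 (hb j)).2, (abs_le.1 hσ).2⟩⟩

/-- A Lindeberg type central limit theorem for weakly null families: suitably chosen sequences in
the family behave in the mean like independent Gaussian multiples of `ψ`. -/
theorem TaylorData.lindeberg (hF : TaylorData F F' F'' e) {ψ : Ω → ℝ} (hψ : BddMeas ψ)
    {y : ι → Ω → ℝ} (hy : ∀ i, BddMeas (y i)) {𝓕 : Filter ι}
    (h1 : ∀ g, BddMeas g → Tendsto (fun i => ∫ ω, g ω * y i ω ∂ν) 𝓕 (𝓝 0))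
    (h2 : ∀ g, BddMeas g → Tendsto (fun i => ∫ ω, g ω * (y i ω ^ 2 - ψ ω ^ 2) ∂ν) 𝓕 (𝓝 0))
    (hLC : ∀ κ > 0, ∀ η > 0, ∃ τ > 0, ∀ᶠ i in 𝓕, ∀ t, |t| ≤ τ →
      (∫ ω, (if κ < |t * y i ω| then |t * y i ω| ^ e else 0) ∂ν) ≤ η * t ^ 2)
    {ε : ℝ} (hε : 0 < ε) :
    ∃ τ > 0, ∃ St : (k : ℕ) → (Fin k → ι) → ι → Prop, (∀ k f, ∀ᶠ i in 𝓕, St k f i) ∧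
      ∀ x : ℕ → ι, (∀ k, St k (fun j => x j) (x k)) → ∀ (N : ℕ) (a : ℕ → ℝ),
        ∑ k ∈ Finset.range N, a k ^ 2 = 1 → (∀ k, |a k| ≤ τ) →
        |(∫ ω, F (∑ k ∈ Finset.range N, a k * y (x k) ω) ∂ν) - gaussMean ν F ψ (fun _ => 0) 1|
          ≤ ε := by
  obtain ⟨A, hA, hstep⟩ := hF.lindeberg_step (ν := ν) hψ
  set Ψ₀ := gaussMean ν F ψ (fun _ => 0) 1 with hΨ₀
  have hΨ₀n : 0 ≤ Ψ₀ := integral_nonneg fun ω => hF.gavg_nonneg _ _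
  set ε₁ := min 1 ε / 4 with hε₁
  have hε₁0 : 0 < ε₁ := by positivity
  have hε₁1 : ε₁ ≤ 1 / 4 := by rw [hε₁]; linarith [min_le_left 1 ε]
  have hε₁ε : ε₁ ≤ ε / 4 := by rw [hε₁]; linarith [min_le_right 1 ε]
  have hden : 0 < A * (2 + Ψ₀) + 1 := by positivity
  have hη0 : 0 < min 1 (ε₁ / (A * (2 + Ψ₀) + 1)) := by positivity
  obtain ⟨κ, hκ, K, hK, t₀, ht₀, ht₀1, hstep⟩ := hstep _ hη0 (min_le_left _ _)
  set η := min 1 (ε₁ / (A * (2 + Ψ₀) + 1)) with hη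
  have hηA : η * A * (2 + Ψ₀) ≤ ε₁ := by
    have := min_le_right 1 (ε₁ / (A * (2 + Ψ₀) + 1))
    rw [← hη, le_div_iff₀ hden] at this
    linarith
  obtain ⟨τ', hτ', hLC⟩ := hLC κ hκ (η / (K + 1)) (by positivity)
  set δ : ℕ → ℝ := fun k => ε₁ / 8 * (1 / 2) ^ k
  have hδ0 : ∀ k, 0 < δ k := fun k => by positivity
  have hδ1 : ∀ k, δ k ≤ 1 := fun k => by
    have : ((1 : ℝ) / 2) ^ k ≤ 1 := pow_le_one₀ (by norm_num) (by norm_num)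
    calc δ k ≤ ε₁ / 8 * 1 := mul_le_mul_of_nonneg_left this (by positivity)
      _ ≤ 1 := by linarith
  have hδs : ∀ k, ∑ j ∈ Finset.range k, 4 * δ j ≤ ε₁ := fun k => by
    rw [← Finset.mul_sum, ← Finset.mul_sum]
    have := sum_geometric_two_le k
    nlinarith
  refine ⟨min t₀ τ', by positivity, fun k f i =>
    (∀ b : Fin k → ℝ, (∀ j, |b j| ≤ 1) → ∀ σ, |σ| ≤ 1 →
      |∫ ω, gavg F' (∑ j, b j * y (f j) ω) (σ * ψ ω) * y i ω ∂ν| ≤ δ k) ∧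
    (∀ b : Fin k → ℝ, (∀ j, |b j| ≤ 1) → ∀ σ, |σ| ≤ 1 →
      |∫ ω, gavg F'' (∑ j, b j * y (f j) ω) (σ * ψ ω) * (y i ω ^ 2 - ψ ω ^ 2) ∂ν| ≤ δ k) ∧
    |∫ ω, (y i ω ^ 2 - ψ ω ^ 2) ∂ν| ≤ δ k ∧
    ∀ t, |t| ≤ τ' →
      (∫ ω, (if κ < |t * y i ω| then |t * y i ω| ^ e else 0) ∂ν) ≤ η / (K + 1) * t ^ 2,
    fun k f => ?_, fun x hx N a ha hat => ?_⟩
  · have h3 : Tendsto (fun i => ∫ ω, (y i ω ^ 2 - ψ ω ^ 2) ∂ν) 𝓕 (𝓝 0) := by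
      simpa using h2 _ (BddMeas.const 1)
    have h4 : ∀ᶠ i in 𝓕, |∫ ω, (y i ω ^ 2 - ψ ω ^ 2) ∂ν| ≤ δ k :=
      h3.abs.eventually (ge_mem_nhds (by rw [abs_zero]; exact hδ0 k))
    have hy2 : ∀ i, BddMeas fun ω => y i ω ^ 2 := fun i => (hy i).pow 2
    have hψ2 : BddMeas fun ω => ψ ω ^ 2 := hψ.pow 2
    have h5 : ∀ᶠ i in 𝓕, ∫ ω, y i ω ^ 2 ∂ν ≤ 1 + ∫ ω, ψ ω ^ 2 ∂ν := h4.mono fun i hi => by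
      rw [integral_sub (hy2 i).integrable hψ2.integrable] at hi
      linarith [(abs_le.1 hi).2, hδ1 k]
    have h6 : ∀ᶠ i in 𝓕, ∫ ω, |y i ω| ∂ν ≤ ν.real Set.univ + (1 + ∫ ω, ψ ω ^ 2 ∂ν) :=
      h5.mono fun i hi => by
        have : ∫ ω, |y i ω| ∂ν ≤ ∫ ω, (1 + y i ω ^ 2) ∂ν :=
          integral_mono (hy i).integrable.abs ((BddMeas.const 1).add (hy2 i)).integrable
            fun ω => by
              simp only
              nlinarith [sq_abs (y i ω), sq_nonneg (|y i ω| - 1 / 2)]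
        rw [integral_add (integrable_const _) (hy2 i).integrable, integral_const] at this
        simp only [smul_eq_mul, mul_one] at this
        linarith
    have h7 : ∀ᶠ i in 𝓕, ∫ ω, |y i ω ^ 2 - ψ ω ^ 2| ∂ν ≤
        (1 + ∫ ω, ψ ω ^ 2 ∂ν) + ∫ ω, ψ ω ^ 2 ∂ν := h5.mono fun i hi => by
      have : ∫ ω, |y i ω ^ 2 - ψ ω ^ 2| ∂ν ≤ ∫ ω, (y i ω ^ 2 + ψ ω ^ 2) ∂ν :=
        integral_mono ((hy2 i).sub hψ2).integrable.abs ((hy2 i).add hψ2).integrable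
          fun ω => by
            simp only
            rw [abs_le]
            constructor <;> nlinarith [sq_nonneg (y i ω), sq_nonneg (ψ ω)]
      rw [integral_add (hy2 i).integrable hψ2.integrable] at this
      linarith
    refine (eventually_forall_gavg_le hF.growth' (fun j => hy (f j)) hψ
      (fun i => (hy i).integrable) h6 h1 (hδ0 k)).and ((eventually_forall_gavg_le hF.growth''
      (fun j => hy (f j)) hψ (fun i => ((hy2 i).sub hψ2).integrable) h7 h2 (hδ0 k)).and
      (h4.and hLC))
  · set s : ℕ → ℝ := fun k => ∑ j ∈ Finset.range k, a j ^ 2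
    set S : ℕ → Ω → ℝ := fun k ω => ∑ j ∈ Finset.range k, a j * y (x j) ω
    have ha1 : ∀ k, |a k| ≤ 1 := fun k => ((hat k).trans (min_le_left _ _)).trans ht₀1
    have hS : ∀ k, BddMeas (S k) := fun k => BddMeas.sum _ fun j => (BddMeas.const _).mul (hy _)
    have hs0 : ∀ k, 0 ≤ s k := fun k => Finset.sum_nonneg fun j _ => sq_nonneg _
    have hs1 : ∀ k ≤ N, s k ≤ 1 := fun k hk => by
      rw [← ha]
      exact Finset.sum_le_sum_of_subset_of_nonneg (Finset.range_mono hk)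
        fun j _ _ => sq_nonneg _
    have hsum : ∀ k ≤ N, ∑ j ∈ Finset.range k, (4 * δ j + ε₁ * a j ^ 2) ≤ 2 * ε₁ := by
      intro k hk
      rw [Finset.sum_add_distrib, ← Finset.mul_sum _ _ ε₁]
      have := hδs k
      have := mul_le_mul_of_nonneg_left (hs1 k hk) hε₁0.le
      simp only [s] at this
      linarith
    have main : ∀ k ≤ N, |gaussMean ν F ψ (S k) (√(1 - s k)) - Ψ₀| ≤
        ∑ j ∈ Finset.range k, (4 * δ j + ε₁ * a j ^ 2) := by
      intro k
      induction k with
      | zero =>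
        intro _
        simp [S, s, hΨ₀]
      | succ k ih =>
        intro hk
        have hk' : k ≤ N := by omega
        have ih := ih hk'
        rw [Finset.sum_range_succ]
        have hσ : ∀ k ≤ N, |√(1 - s k)| ≤ 1 := fun k hk => by
          rw [abs_of_nonneg (Real.sqrt_nonneg _)]
          exact Real.sqrt_le_one.2 (by linarith [hs0 k])
        obtain ⟨c1, c2, c3, c4⟩ := hx k
        have hSk : ∀ ω, ∑ j : Fin k, a j * y (x j) ω = S k ω := fun ω =>
          Fin.sum_univ_eq_sum_range (fun j => a j * y (x j) ω) k
        have c1 := c1 (fun j => a j) (fun j => ha1 _) _ (hσ (k + 1) hk)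
        have c2 := c2 (fun j => a j) (fun j => ha1 _) _ (hσ (k + 1) hk)
        simp only [hSk] at c1 c2
        have hsq : (√(1 - s k)) ^ 2 = (√(1 - s (k + 1))) ^ 2 + a k ^ 2 := by
          rw [Real.sq_sqrt (by linarith [hs1 k hk']), Real.sq_sqrt (by linarith [hs1 _ hk])]
          simp only [s, Finset.sum_range_succ]
          ring
        have c5 : (∫ ω, (if κ < |a k * y (x k) ω| then K * |a k * y (x k) ω| ^ e else 0) ∂ν) ≤
            η * a k ^ 2 := by
          have d := c4 (a k) ((hat k).trans (min_le_right _ _))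
          have : ∀ ω, (if κ < |a k * y (x k) ω| then K * |a k * y (x k) ω| ^ e else 0) =
              K * (if κ < |a k * y (x k) ω| then |a k * y (x k) ω| ^ e else 0) := fun ω => by
            split_ifs <;> simp
          simp only [this]
          rw [integral_const_mul]
          calc _ ≤ K * (η / (K + 1) * a k ^ 2) := mul_le_mul_of_nonneg_left d hK
            _ = K / (K + 1) * (η * a k ^ 2) := by ring
            _ ≤ 1 * (η * a k ^ 2) := by
                refine mul_le_mul_of_nonneg_right ?_ (by positivity)
                rw [div_le_one (by positivity)]
                linarith
            _ = _ := one_mul _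
        have hst := hstep (S k) (y (x k)) (hS k) (hy _) _ (a k) _ (δ k)
          ((hat k).trans (min_le_left _ _)) hsq (hδ1 k) c1 c2 c3 c5
        have hS' : (fun ω => S k ω + a k * y (x k) ω) = S (k + 1) := by
          ext ω; simp only [S, Finset.sum_range_succ]
        rw [hS'] at hst
        have hb : gaussMean ν F ψ (S k) (√(1 - s k)) ≤ Ψ₀ + 1 := by
          have := (abs_le.1 ih).2
          linarith [hsum k hk']
        have hb' : η * A * a k ^ 2 * (1 + gaussMean ν F ψ (S k) (√(1 - s k))) ≤ ε₁ * a k ^ 2 := by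
          calc _ ≤ η * A * a k ^ 2 * (2 + Ψ₀) :=
                mul_le_mul_of_nonneg_left (by linarith) (by positivity)
            _ = η * A * (2 + Ψ₀) * a k ^ 2 := by ring
            _ ≤ _ := by gcongr
        have := abs_sub_le (gaussMean ν F ψ (S (k + 1)) (√(1 - s (k + 1))))
          (gaussMean ν F ψ (S k) (√(1 - s k))) Ψ₀
        linarith
    have hN := main N le_rfl
    have hsN : s N = 1 := ha
    rw [hsN, sub_self, Real.sqrt_zero] at hN
    simp only [gaussMean, zero_mul, gavg_zero_right] at hN
    linarith [hsum N le_rfl]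

end Stabilization

section Stabilization

open Filter Topology

variable {Ω ι : Type*} [MeasurableSpace Ω]

/-- The `r`-th absolute moment of a standard Gaussian. -/
noncomputable def gaussMoment (r : ℝ) : ℝ := ∫ z, |z| ^ r ∂stdG

lemma gaussMoment_nonneg (r : ℝ) : 0 ≤ gaussMoment r := integral_nonneg fun z => by positivity

lemma polyGrowth_abs_rpow {r : ℝ} (hr : 0 ≤ r) : PolyGrowth fun x => |x| ^ r := by
  refine .of_rpow (continuous_abs.rpow_const fun _ => Or.inr hr) (C := 1) (s := r) zero_le_one
    fun x => ?_
  rw [abs_of_nonneg (by positivity), one_mul]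
  exact abs_rpow_le_one_add hr

lemma gavg_abs_rpow (r s : ℝ) : gavg (fun x => |x| ^ r) 0 s = |s| ^ r * gaussMoment r := by
  rw [gavg, gaussMoment, ← integral_const_mul]
  congr 1
  ext z
  rw [zero_add, abs_mul, Real.mul_rpow (abs_nonneg _) (abs_nonneg _)]

lemma abs_rpow_mul_sub_le {r : ℝ} (hr : 0 < r) (hr2 : r < 2) {θ : ℝ} (hθ : 0 < θ) (x : ℝ) :
    |θ ^ r * (1 + (θ⁻¹ * x) ^ 2) ^ (r / 2) - |x| ^ r| ≤ θ ^ r := by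
  have e1 : θ ^ r * (1 + (θ⁻¹ * x) ^ 2) ^ (r / 2) = (θ ^ 2 + x ^ 2) ^ (r / 2) := by
    have : θ ^ r = (θ ^ 2) ^ (r / 2) := by
      rw [← Real.rpow_natCast, ← Real.rpow_mul hθ.le]; congr 1; push_cast; ring
    rw [this, ← Real.mul_rpow (by positivity) (by positivity)]
    congr 1
    field_simp
  have e2 : |x| ^ r = (x ^ 2) ^ (r / 2) := by
    rw [← sq_abs, ← Real.rpow_natCast, ← Real.rpow_mul (abs_nonneg x)]
    congr 1; push_cast; ring
  have e3 : θ ^ r = (θ ^ 2) ^ (r / 2) := by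
    rw [← Real.rpow_natCast, ← Real.rpow_mul hθ.le]; congr 1; push_cast; ring
  rw [e1, e2, e3]
  have h1 := Real.rpow_add_le_add_rpow (sq_nonneg θ) (sq_nonneg x) (by linarith : 0 ≤ r / 2)
    (by linarith)
  have h2 : (x ^ 2) ^ (r / 2) ≤ (θ ^ 2 + x ^ 2) ^ (r / 2) :=
    Real.rpow_le_rpow (sq_nonneg x) (by linarith [sq_nonneg θ]) (by linarith)
  rw [abs_of_nonneg (by linarith)]
  linarith

variable {ν : Measure Ω} [IsFiniteMeasure ν]

/-- The central limit theorem for `r`-th moments, `2 < r`. -/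
lemma exists_clt_of_two_lt {r : ℝ} (hr : 2 < r) {ψ : Ω → ℝ} (hψ : BddMeas ψ)
    {y : ι → Ω → ℝ} (hy : ∀ i, BddMeas (y i)) {𝓕 : Filter ι}
    (h1 : ∀ g, BddMeas g → Tendsto (fun i => ∫ ω, g ω * y i ω ∂ν) 𝓕 (𝓝 0))
    (h2 : ∀ g, BddMeas g → Tendsto (fun i => ∫ ω, g ω * (y i ω ^ 2 - ψ ω ^ 2) ∂ν) 𝓕 (𝓝 0))
    {C : ℝ} (hC : ∀ᶠ i in 𝓕, ∫ ω, |y i ω| ^ r ∂ν ≤ C) {ε : ℝ} (hε : 0 < ε) :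
    ∃ τ > 0, ∃ St : (k : ℕ) → (Fin k → ι) → ι → Prop, (∀ k f, ∀ᶠ i in 𝓕, St k f i) ∧
      ∀ x : ℕ → ι, (∀ k, St k (fun j => x j) (x k)) → ∀ (N : ℕ) (a : ℕ → ℝ),
        ∑ k ∈ Finset.range N, a k ^ 2 = 1 → (∀ k, |a k| ≤ τ) →
        |(∫ ω, |∑ k ∈ Finset.range N, a k * y (x k) ω| ^ r ∂ν) -
          gaussMean ν (fun x => |x| ^ r) ψ (fun _ => 0) 1| ≤ ε := by
  refine (taylorData_abs_rpow hr).lindeberg hψ hy h1 h2 (fun κ hκ η hη => ?_) hε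
  have hs : 0 < r - 2 := by linarith
  obtain ⟨τ, hτ, hτ'⟩ : ∃ τ > 0, |C| * τ ^ (r - 2) ≤ η := by
    have hc : Tendsto (fun u : ℝ => |C| * u ^ (r - 2)) (𝓝[>] 0) (𝓝 0) := by
      have : Continuous fun u : ℝ => |C| * u ^ (r - 2) :=
        (continuous_id.rpow_const fun _ => Or.inr hs.le).const_mul _
      have := (this.tendsto 0).mono_left (nhdsWithin_le_nhds (s := Set.Ioi 0))
      simpa [Real.zero_rpow hs.ne'] using this
    have h1 := hc.eventually (ge_mem_nhds hη)
    obtain ⟨κ, h2, h3⟩ := (h1.and self_mem_nhdsWithin).exists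
    exact ⟨κ, h3, h2⟩
  refine ⟨τ, hτ, hC.mono fun i hi t ht => ?_⟩
  have hpow : BddMeas fun ω => |t * y i ω| ^ r :=
    (hy i).comp (g := fun x => |t * x| ^ r)
      ((continuous_const.mul continuous_id).abs.rpow_const fun _ => Or.inr (by linarith))
  have i1 := (hy i).integrable_ite (ν := ν) (by linarith : 0 ≤ r) κ 1 t
  simp only [one_mul] at i1
  calc (∫ ω, (if κ < |t * y i ω| then |t * y i ω| ^ r else 0) ∂ν)
      ≤ ∫ ω, |t * y i ω| ^ r ∂ν := by
        refine integral_mono i1 hpow.integrable fun ω => ?_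
        simp only
        split_ifs
        · exact le_rfl
        · positivity
    _ = |t| ^ r * ∫ ω, |y i ω| ^ r ∂ν := by
        rw [← integral_const_mul]
        congr 1; ext ω
        rw [abs_mul, Real.mul_rpow (abs_nonneg _) (abs_nonneg _)]
    _ ≤ |t| ^ r * |C| := by gcongr; exact hi.trans (le_abs_self C)
    _ = |C| * |t| ^ (r - 2) * t ^ 2 := by
        rcases eq_or_ne t 0 with rfl | h0
        · simp [Real.zero_rpow (by linarith : r ≠ 0)]
        · have : |t| ^ r = |t| ^ (r - 2) * t ^ 2 := by
            rw [← sq_abs t, ← Real.rpow_natCast, ← Real.rpow_add (abs_pos.2 h0)]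
            congr 1; push_cast; ring
          rw [this]; ring
    _ ≤ η * t ^ 2 := by
        refine mul_le_mul_of_nonneg_right (le_trans ?_ hτ') (sq_nonneg t)
        gcongr

/-- The central limit theorem for `r`-th moments, `1 < r < 2`. -/
lemma exists_clt_of_lt_two {r : ℝ} (hr1 : 1 < r) (hr : r < 2) {ψ : Ω → ℝ} (hψ : BddMeas ψ)
    {y : ι → Ω → ℝ} (hy : ∀ i, BddMeas (y i)) {𝓕 : Filter ι}
    (h1 : ∀ g, BddMeas g → Tendsto (fun i => ∫ ω, g ω * y i ω ∂ν) 𝓕 (𝓝 0))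
    (h2 : ∀ g, BddMeas g → Tendsto (fun i => ∫ ω, g ω * (y i ω ^ 2 - ψ ω ^ 2) ∂ν) 𝓕 (𝓝 0))
    (hUI : ∀ η > 0, ∃ L, ∀ᶠ i in 𝓕, (∫ ω, (if L < |y i ω| then y i ω ^ 2 else 0) ∂ν) ≤ η)
    {ε : ℝ} (hε : 0 < ε) :
    ∃ τ > 0, ∃ St : (k : ℕ) → (Fin k → ι) → ι → Prop, (∀ k f, ∀ᶠ i in 𝓕, St k f i) ∧
      ∀ x : ℕ → ι, (∀ k, St k (fun j => x j) (x k)) → ∀ (N : ℕ) (a : ℕ → ℝ),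
        ∑ k ∈ Finset.range N, a k ^ 2 = 1 → (∀ k, |a k| ≤ τ) →
        |(∫ ω, |∑ k ∈ Finset.range N, a k * y (x k) ω| ^ r ∂ν) -
          gaussMean ν (fun x => |x| ^ r) ψ (fun _ => 0) 1| ≤ ε := by
  have hr0 : 0 < r := by linarith
  set V := ν.real Set.univ
  have hV : 0 ≤ V := measureReal_nonneg
  obtain ⟨θ, hθ, hθ'⟩ : ∃ θ > 0, V * θ ^ r ≤ ε / 3 := by
    have hc : Tendsto (fun u : ℝ => V * u ^ r) (𝓝[>] 0) (𝓝 0) := by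
      have : Continuous fun u : ℝ => V * u ^ r :=
        (continuous_id.rpow_const fun _ => Or.inr hr0.le).const_mul _
      have := (this.tendsto 0).mono_left (nhdsWithin_le_nhds (s := Set.Ioi 0))
      simpa [Real.zero_rpow hr0.ne'] using this
    have h1 := hc.eventually (ge_mem_nhds (by linarith : 0 < ε / 3))
    obtain ⟨κ, h2, h3⟩ := (h1.and self_mem_nhdsWithin).exists
    exact ⟨κ, h3, h2⟩
  have hθr : 0 < θ ^ r := by positivity
  have hF := taylorData_one_add_sq_rpow hr1 hr
  have by' : ∀ i, BddMeas fun ω => θ⁻¹ * y i ω := fun i => (BddMeas.const _).mul (hy i)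
  have bψ' : BddMeas fun ω => θ⁻¹ * ψ ω := (BddMeas.const _).mul hψ
  obtain ⟨τ, hτ, St, hSt, hmain⟩ := hF.lindeberg (ν := ν) (𝓕 := 𝓕) bψ' by'
    (fun g hg => by
      have := (h1 g hg).const_mul θ⁻¹
      rw [mul_zero] at this
      refine this.congr fun i => ?_
      rw [← integral_const_mul]
      congr 1; ext ω; ring)
    (fun g hg => by
      have := (h2 g hg).const_mul (θ⁻¹ ^ 2)
      rw [mul_zero] at this
      refine this.congr fun i => ?_
      rw [← integral_const_mul]
      congr 1; ext ω; ring)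
    (fun κ hκ η hη => by
      obtain ⟨L, hL⟩ := hUI (η * θ ^ 2) (by positivity)
      refine ⟨κ * θ / (|L| + 1), by positivity, hL.mono fun i hi t ht => ?_⟩
      have i1 := (by' i).integrable_ite (ν := ν) (by norm_num : (0 : ℝ) ≤ 2) κ 1 t
      simp only [one_mul] at i1
      have i2 : Integrable (fun ω => if L < |y i ω| then y i ω ^ 2 else 0) ν :=
        ((hy i).pow 2).integrable.indicator (measurableSet_lt measurable_const (hy i).1.abs)
      calc _ ≤ ∫ ω, (t ^ 2 * (θ⁻¹) ^ 2) * (if L < |y i ω| then y i ω ^ 2 else 0) ∂ν := by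
            refine integral_mono i1 (i2.const_mul _) fun ω => ?_
            simp only
            by_cases c : κ < |t * (θ⁻¹ * y i ω)|
            · have hlt : L < |y i ω| := by
                rw [le_div_iff₀ (by positivity)] at ht
                rw [abs_mul, abs_mul, abs_of_pos (inv_pos.2 hθ)] at c
                have c' : κ * θ < |t| * |y i ω| := by
                  have := mul_lt_mul_of_pos_right c hθ
                  calc κ * θ < |t| * (θ⁻¹ * |y i ω|) * θ := this
                    _ = _ := by field_simp
                have h3 : |t| * (|L| + 1) < |t| * |y i ω| := ht.trans_lt c'
                have := lt_of_mul_lt_mul_left h3 (abs_nonneg t)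
                linarith [le_abs_self L]
              rw [if_pos c, if_pos hlt, Real.rpow_two, sq_abs]
              exact le_of_eq (by ring)
            · rw [if_neg c]
              split_ifs <;> positivity
        _ = (t ^ 2 * (θ⁻¹) ^ 2) * ∫ ω, (if L < |y i ω| then y i ω ^ 2 else 0) ∂ν :=
            integral_const_mul _ _
        _ ≤ (t ^ 2 * (θ⁻¹) ^ 2) * (η * θ ^ 2) := by gcongr
        _ = η * t ^ 2 := by field_simp)
    (by positivity : 0 < ε / 3 / θ ^ r)
  refine ⟨τ, hτ, St, hSt, fun x hx N a ha hat => ?_⟩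
  have key := hmain x hx N a ha hat
  have bS : BddMeas fun ω => ∑ k ∈ Finset.range N, a k * y (x k) ω :=
    BddMeas.sum _ fun j => (BddMeas.const _).mul (hy _)
  have g1 := hF.growth
  have g2 := polyGrowth_abs_rpow hr0.le
  have hgen : ∀ f₁ f₂ : Ω → ℝ, BddMeas f₁ → BddMeas f₂ → (∀ ω, |θ ^ r * f₁ ω - f₂ ω| ≤ θ ^ r) →
      |θ ^ r * (∫ ω, f₁ ω ∂ν) - ∫ ω, f₂ ω ∂ν| ≤ ε / 3 := by
    intro f₁ f₂ b1 b2 hb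
    rw [← integral_const_mul, ← integral_sub (b1.integrable.const_mul _) b2.integrable,
      ← Real.norm_eq_abs]
    refine (norm_integral_le_of_norm_le (integrable_const (θ ^ r))
      (Eventually.of_forall hb)).trans ?_
    rw [integral_const, smul_eq_mul]
    exact hθ'
  have hA := hgen (fun ω => (1 + (∑ k ∈ Finset.range N, a k * (θ⁻¹ * y (x k) ω)) ^ 2) ^ (r / 2))
    (fun ω => |∑ k ∈ Finset.range N, a k * y (x k) ω| ^ r)
    ((BddMeas.sum _ fun j => (BddMeas.const _).mul (by' _)).comp g1.1) (bS.comp g2.1)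
    fun ω => by
      have : ∑ k ∈ Finset.range N, a k * (θ⁻¹ * y (x k) ω) =
          θ⁻¹ * ∑ k ∈ Finset.range N, a k * y (x k) ω := by
        rw [Finset.mul_sum]; exact Finset.sum_congr rfl fun k _ => by ring
      rw [this]
      exact abs_rpow_mul_sub_le hr0 hr hθ _
  have hB := hgen (fun ω => gavg (fun x => (1 + x ^ 2) ^ (r / 2)) 0 (1 * (θ⁻¹ * ψ ω)))
    (fun ω => gavg (fun x => |x| ^ r) 0 (1 * ψ ω))
    (g1.bddMeas_gavg (BddMeas.const 0) ((BddMeas.const 1).mul bψ'))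
    (g2.bddMeas_gavg (BddMeas.const 0) ((BddMeas.const 1).mul hψ)) fun ω => by
      have j1 := g1.integrable 0 (1 * (θ⁻¹ * ψ ω))
      have j2 := g2.integrable 0 (1 * ψ ω)
      simp only [gavg]
      rw [← integral_const_mul, ← integral_sub (j1.const_mul _) j2, ← Real.norm_eq_abs]
      refine (norm_integral_le_of_norm_le (integrable_const (θ ^ r))
        (Eventually.of_forall fun z => ?_)).trans ?_
      · have := abs_rpow_mul_sub_le hr0 hr hθ (ψ ω * z)
        rw [Real.norm_eq_abs]
        simpa [mul_assoc] using this
      · simp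
  have key' : |θ ^ r * (∫ ω, (1 + (∑ k ∈ Finset.range N, a k * (θ⁻¹ * y (x k) ω)) ^ 2) ^ (r / 2) ∂ν)
      - θ ^ r * gaussMean ν (fun x => (1 + x ^ 2) ^ (r / 2)) (fun ω => θ⁻¹ * ψ ω) (fun _ => 0) 1|
      ≤ ε / 3 := by
    rw [← mul_sub, abs_mul, abs_of_pos hθr]
    calc _ ≤ θ ^ r * (ε / 3 / θ ^ r) := mul_le_mul_of_nonneg_left key hθr.le
      _ = ε / 3 := by field_simp
  simp only [gaussMean] at key' ⊢
  rw [abs_le] at hA hB key' ⊢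
  constructor <;> linarith

end Stabilization

section Stabilization

open Filter Topology

variable {Ω ι : Type*} [MeasurableSpace Ω]

/-- A family of bounded functions which is weakly null along a filter, whose squares converge
weakly to `φ ^ 2`, and which is suitably `r`-integrable. -/
structure CLTFamily (μ : Measure Ω) (r : ℝ) (z : ι → Ω → ℝ) (φ : Ω → ℝ) (𝓕 : Filter ι) :
    Prop where
  bdd : ∀ i, BddMeas (z i)
  meas : Measurable φ
  nonneg : ∀ ω, 0 ≤ φ ω
  int : Integrable (fun ω => (1 + φ ω) ^ r) μ
  weak : ∀ g, BddMeas g →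
    Tendsto (fun i => ∫ ω, g ω * ((1 + φ ω) ^ (r - 1) * z i ω) ∂μ) 𝓕 (𝓝 0)
  weakSq : ∀ g, BddMeas g →
    Tendsto (fun i => ∫ ω, g ω * ((1 + φ ω) ^ (r - 2) * (z i ω ^ 2 - φ ω ^ 2)) ∂μ) 𝓕 (𝓝 0)
  bound : 2 < r → ∃ C, ∀ᶠ i in 𝓕, ∫ ω, |z i ω| ^ r ∂μ ≤ C
  tail : r < 2 → ∀ η > 0, ∃ L, ∀ᶠ i in 𝓕,
    (∫ ω, (if L < |z i ω| then (1 + φ ω) ^ (r - 2) * z i ω ^ 2 else 0) ∂μ) ≤ η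

/-- Sequences chosen step by step from the family have flat combinations with `r`-th moments close
to `c`. -/
def FlatMoments (μ : Measure Ω) (r : ℝ) (z : ι → Ω → ℝ) (𝓕 : Filter ι) (c : ℝ) : Prop :=
  ∀ ε > 0, ∃ τ > 0, ∃ St : (k : ℕ) → (Fin k → ι) → ι → Prop, (∀ k f, ∀ᶠ i in 𝓕, St k f i) ∧
    ∀ x : ℕ → ι, (∀ k, St k (fun j => x j) (x k)) → ∀ (N : ℕ) (a : ℕ → ℝ),
      ∑ k ∈ Finset.range N, a k ^ 2 = 1 → (∀ k, |a k| ≤ τ) →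
      |(∫ ω, |∑ k ∈ Finset.range N, a k * z (x k) ω| ^ r ∂μ) - c| ≤ ε

theorem CLTFamily.flatMoments {μ : Measure Ω} {r : ℝ} {z : ι → Ω → ℝ}
    {φ : Ω → ℝ} {𝓕 : Filter ι} (h : CLTFamily μ r z φ 𝓕) (hr1 : 1 < r) (hr2 : r ≠ 2) :
    FlatMoments μ r z 𝓕 (gaussMoment r * ∫ ω, φ ω ^ r ∂μ) := by
  intro ε hε
  have hρ : ∀ ω, 0 < 1 + φ ω := fun ω => by linarith [h.nonneg ω]
  have hρ1 : ∀ ω, 1 ≤ 1 + φ ω := fun ω => by linarith [h.nonneg ω]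
  have hm : Measurable fun ω => ENNReal.ofReal ((1 + φ ω) ^ r) :=
    ((h.meas.const_add 1).pow_const r).ennreal_ofReal
  set ν := μ.withDensity fun ω => ENNReal.ofReal ((1 + φ ω) ^ r) with hν
  have hfin : IsFiniteMeasure ν := isFiniteMeasure_withDensity_ofReal h.int.2
  have h_int : ∀ f : Ω → ℝ, ∫ ω, f ω ∂ν = ∫ ω, (1 + φ ω) ^ r * f ω ∂μ := fun f => by
    rw [hν, integral_withDensity_eq_integral_toReal_smul hm
      (Eventually.of_forall fun ω => ENNReal.ofReal_lt_top)]
    congr 1; ext ω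
    rw [ENNReal.toReal_ofReal (by have := hρ ω; positivity), smul_eq_mul]
  have hinv : BddMeas fun ω => (1 + φ ω)⁻¹ := by
    refine ⟨(h.meas.const_add 1).inv, 1, fun ω => ?_⟩
    rw [abs_of_pos (inv_pos.2 (hρ ω))]
    exact inv_le_one_of_one_le₀ (hρ1 ω)
  have hψ : BddMeas fun ω => (1 + φ ω)⁻¹ * φ ω := by
    refine ⟨hinv.1.mul h.meas, 1, fun ω => ?_⟩
    rw [abs_of_nonneg (mul_nonneg (inv_pos.2 (hρ ω)).le (h.nonneg ω)), inv_mul_le_one₀ (hρ ω)]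
    linarith
  have hy : ∀ i, BddMeas fun ω => (1 + φ ω)⁻¹ * z i ω := fun i => hinv.mul (h.bdd i)
  have hpow1 : ∀ ω, (1 + φ ω) ^ r = (1 + φ ω) ^ (r - 1) * (1 + φ ω) := fun ω => by
    rw [← Real.rpow_add_one (hρ ω).ne']; congr 1; ring
  have hpow2 : ∀ ω, (1 + φ ω) ^ r = (1 + φ ω) ^ (r - 2) * (1 + φ ω) ^ 2 := fun ω => by
    rw [← Real.rpow_natCast, ← Real.rpow_add (hρ ω)]; congr 1; push_cast; ring
  have hmul : ∀ (ω : Ω) (x : ℝ), (1 + φ ω) ^ r * |(1 + φ ω)⁻¹ * x| ^ r = |x| ^ r := fun ω x => by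
    rw [abs_mul, abs_of_pos (inv_pos.2 (hρ ω)), Real.mul_rpow (inv_pos.2 (hρ ω)).le (abs_nonneg _),
      Real.inv_rpow (hρ ω).le, mul_inv_cancel_left₀ (Real.rpow_pos_of_pos (hρ ω) r).ne']
  have h1 : ∀ g, BddMeas g →
      Tendsto (fun i => ∫ ω, g ω * ((1 + φ ω)⁻¹ * z i ω) ∂ν) 𝓕 (𝓝 0) := fun g hg => by
    refine (h.weak g hg).congr fun i => ?_
    rw [h_int]
    congr 1; ext ω
    rw [hpow1]
    have := (hρ ω).ne'
    field_simp
  have h2 : ∀ g, BddMeas g → Tendsto (fun i => ∫ ω, g ω * (((1 + φ ω)⁻¹ * z i ω) ^ 2 -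
      ((1 + φ ω)⁻¹ * φ ω) ^ 2) ∂ν) 𝓕 (𝓝 0) := fun g hg => by
    refine (h.weakSq g hg).congr fun i => ?_
    rw [h_int]
    congr 1; ext ω
    rw [hpow2]
    have := (hρ ω).ne'
    field_simp
  have hend : gaussMean ν (fun x => |x| ^ r) (fun ω => (1 + φ ω)⁻¹ * φ ω) (fun _ => 0) 1 =
      gaussMoment r * ∫ ω, φ ω ^ r ∂μ := by
    simp only [gaussMean, one_mul, gavg_abs_rpow]
    rw [h_int, ← integral_const_mul]
    congr 1; ext ω
    rw [← mul_assoc, hmul, abs_of_nonneg (h.nonneg ω), mul_comm]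
  have hconv : ∀ (x : ℕ → ι) (N : ℕ) (a : ℕ → ℝ),
      ∫ ω, |∑ k ∈ Finset.range N, a k * ((1 + φ ω)⁻¹ * z (x k) ω)| ^ r ∂ν =
      ∫ ω, |∑ k ∈ Finset.range N, a k * z (x k) ω| ^ r ∂μ := fun x N a => by
    rw [h_int]
    congr 1; ext ω
    have : ∑ k ∈ Finset.range N, a k * ((1 + φ ω)⁻¹ * z (x k) ω) =
        (1 + φ ω)⁻¹ * ∑ k ∈ Finset.range N, a k * z (x k) ω := by
      rw [Finset.mul_sum]
      exact Finset.sum_congr rfl fun k _ => by ring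
    rw [this, hmul]
  rcases lt_or_gt_of_ne hr2 with hlt | hgt
  · have hUI : ∀ η > 0, ∃ L, ∀ᶠ i in 𝓕, (∫ ω, (if L < |(1 + φ ω)⁻¹ * z i ω| then
        ((1 + φ ω)⁻¹ * z i ω) ^ 2 else 0) ∂ν) ≤ η := fun η hη => by
      obtain ⟨L, hL⟩ := h.tail hlt η hη
      refine ⟨|L|, hL.mono fun i hi => le_trans ?_ hi⟩
      rw [h_int]
      have hz2 : BddMeas fun ω => (1 + φ ω) ^ (r - 2) * z i ω ^ 2 := by
        refine BddMeas.mul ⟨(h.meas.const_add 1).pow_const _, 1, fun ω => ?_⟩ ((h.bdd i).pow 2)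
        rw [abs_of_nonneg (by have := hρ ω; positivity)]
        exact Real.rpow_le_one_of_one_le_of_nonpos (hρ1 ω) (by linarith)
      have hmu : IsFiniteMeasure μ := by
        have : Integrable (fun _ : Ω => (1 : ℝ)) μ :=
          h.int.mono' aestronglyMeasurable_const (Eventually.of_forall fun ω => by
            rw [norm_one]; exact Real.one_le_rpow (hρ1 ω) (by linarith))
        exact (integrable_const_iff_isFiniteMeasure one_ne_zero).1 this
      refine integral_mono_of_nonneg (Eventually.of_forall fun ω => ?_)
        (hz2.integrable.indicator (measurableSet_lt measurable_const (h.bdd i).1.abs))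
        (Eventually.of_forall fun ω => ?_)
      · have := hρ ω
        simp only [Pi.zero_apply]
        split_ifs <;> positivity
      · beta_reduce
        have hp := hρ ω
        by_cases c : |L| < |(1 + φ ω)⁻¹ * z i ω|
        · have : L < |z i ω| := by
            rw [abs_mul, abs_of_pos (inv_pos.2 hp)] at c
            have : (1 + φ ω)⁻¹ * |z i ω| ≤ 1 * |z i ω| := by
              gcongr
              exact inv_le_one_of_one_le₀ (hρ1 ω)
            linarith [le_abs_self L]
          rw [if_pos c, if_pos this, hpow2]
          have := hp.ne'
          exact le_of_eq (by field_simp)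
        · rw [if_neg c, mul_zero]
          split_ifs <;> positivity
    obtain ⟨τ, hτ, St, hSt, hmain⟩ := exists_clt_of_lt_two hr1 hlt hψ hy h1 h2 hUI hε
    refine ⟨τ, hτ, St, hSt, fun x hx N a ha hat => ?_⟩
    have := hmain x hx N a ha hat
    rwa [hconv, hend] at this
  · obtain ⟨C, hC⟩ := h.bound hgt
    have hC' : ∀ᶠ i in 𝓕, ∫ ω, |(1 + φ ω)⁻¹ * z i ω| ^ r ∂ν ≤ C := hC.mono fun i hi => by
      rw [h_int]
      simpa only [hmul] using hi
    obtain ⟨τ, hτ, St, hSt, hmain⟩ := exists_clt_of_two_lt hgt hψ hy h1 h2 hC' hε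
    refine ⟨τ, hτ, St, hSt, fun x hx N a ha hat => ?_⟩
    have := hmain x hx N a ha hat
    rwa [hconv, hend] at this

/-- Step by step choice. -/
lemma exists_seq_of_forall_exists {P : (k : ℕ) → (Fin k → ι) → ι → Prop}
    (h : ∀ k f, ∃ i, P k f i) : ∃ x : ℕ → ι, ∀ k, P k (fun j => x j) (x k) := by
  choose c hc using h
  let x : ℕ → ι := fun n => Nat.strongRec (motive := fun _ => ι)
    (fun k ih => c k fun j => ih j j.2) n
  refine ⟨x, fun k => ?_⟩
  have : x k = c k fun j => x j := by
    simp only [x]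
    rw [Nat.strongRec_eq]
  rw [this]
  exact hc k _

end Stabilization

section Stabilization

open Filter Topology

variable {Ω : Type*} [MeasurableSpace Ω]

/-- Bounded sequences in a Hilbert space have weak limits along ultrafilters. -/
lemma exists_inner_limit {H : Type*} [NormedAddCommGroup H] [InnerProductSpace ℝ H]
    [CompleteSpace H] {ι : Type*} (U : Ultrafilter ι) {u : ι → H} {R : ℝ} (hu : ∀ n, ‖u n‖ ≤ R) :
    ∃ w : H, ∀ g, Tendsto (fun n => inner ℝ (u n) g) U (𝓝 (inner ℝ w g)) := by
  have hc := WeakDual.isCompact_closedBall (𝕜 := ℝ) (E := H) 0 R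
  let d : ι → WeakDual ℝ H := fun n => StrongDual.toWeakDual (InnerProductSpace.toDual ℝ H (u n))
  obtain ⟨L, -, hL⟩ := hc.ultrafilter_le_nhds (U.map d) (by
    rw [le_principal_iff]
    refine eventually_map.2 (Eventually.of_forall fun n => ?_)
    simpa [d] using hu n)
  refine ⟨(InnerProductSpace.toDual ℝ H).symm (WeakDual.toStrongDual L), fun g => ?_⟩
  rw [InnerProductSpace.toDual_symm_apply]
  have h1 : Tendsto d U (𝓝 L) := hL
  have h2 := ((WeakDual.eval_continuous (𝕜 := ℝ) g).tendsto L).comp h1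
  simpa [d, Function.comp_def] using h2

lemma Integrable.exists_bddMeas_sub_le {μ : Measure Ω} {G : Ω → ℝ} (hG : Integrable G μ) {ε : ℝ}
    (hε : 0 < ε) : ∃ g, BddMeas g ∧ Integrable g μ ∧ ∫ ω, |G ω - g ω| ∂μ ≤ ε := by
  obtain ⟨g, hg, hgm⟩ := (memLp_one_iff_integrable.2 hG).exists_simpleFunc_eLpNorm_sub_lt
    ENNReal.one_ne_top (ENNReal.ofReal_pos.2 hε).ne'
  obtain ⟨C, hC⟩ := g.exists_forall_norm_le
  have hgi := memLp_one_iff_integrable.1 hgm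
  refine ⟨g, ⟨g.measurable, C, hC⟩, hgi, ?_⟩
  rw [eLpNorm_one_eq_lintegral_enorm] at hg
  have h1 := ofReal_integral_norm_eq_lintegral_enorm (hG.sub hgi)
  rw [← h1] at hg
  exact ((ENNReal.ofReal_lt_ofReal_iff hε).1 hg).le

/-- Uniformly bounded sequences of functions have weak limits along ultrafilters. -/
lemma exists_weak_limit (μ : Measure Ω) [IsFiniteMeasure μ] {ι : Type*} (U : Ultrafilter ι)
    {u : ι → Ω → ℝ} (hm : ∀ n, Measurable (u n)) {C : ℝ} (hC : 0 ≤ C)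
    (hb : ∀ n ω, |u n ω| ≤ C) :
    ∃ w : Ω → ℝ, Measurable w ∧ (∀ ω, |w ω| ≤ C) ∧ ∀ G, Integrable G μ →
      Tendsto (fun n => ∫ ω, G ω * u n ω ∂μ) U (𝓝 (∫ ω, G ω * w ω ∂μ)) := by
  have hbm : ∀ n, BddMeas (u n) := fun n => ⟨hm n, C, hb n⟩
  have hmem : ∀ n, MemLp (u n) 2 μ := fun n =>
    MemLp.of_bound (hm n).aestronglyMeasurable C (Eventually.of_forall (hb n))
  obtain ⟨w, hw⟩ := exists_inner_limit U (u := fun n => (hmem n).toLp (u n))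
    (R := (μ Set.univ).toReal ^ (2 : ℝ≥0∞).toReal⁻¹ * C) (fun n => by
      refine Lp.norm_le_of_ae_bound hC ?_
      filter_upwards [(hmem n).coeFn_toLp] with ω hω
      rw [hω]
      exact hb n ω)
  have hlim : ∀ G, MemLp G 2 μ →
      Tendsto (fun n => ∫ ω, G ω * u n ω ∂μ) U (𝓝 (∫ ω, G ω * w ω ∂μ)) := fun G hG => by
    have := hw (hG.toLp G)
    simp only [L2.inner_def] at this
    refine (this.congr fun n => integral_congr_ae ?_).trans_eq ?_
    · filter_upwards [(hmem n).coeFn_toLp, hG.coeFn_toLp] with ω h1 h2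
      rw [h1, h2]; simp
    · congr 1
      refine integral_congr_ae ?_
      filter_upwards [hG.coeFn_toLp] with ω h2
      rw [h2]; simp
  have hwi : Integrable w μ := (Lp.memLp w).integrable (by norm_num)
  have hind : ∀ s : Set Ω, MeasurableSet s → ∀ f : Ω → ℝ,
      ∫ ω, s.indicator (fun _ => (1 : ℝ)) ω * f ω ∂μ = ∫ ω in s, f ω ∂μ := fun s hs f => by
    rw [← integral_indicator hs]
    congr 1; ext ω
    by_cases h : ω ∈ s <;> simp [h]
  have hset : ∀ s : Set Ω, MeasurableSet s →
      Tendsto (fun n => ∫ ω in s, u n ω ∂μ) U (𝓝 (∫ ω in s, w ω ∂μ)) := fun s hs => by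
    have := hlim (s.indicator fun _ => 1) ((memLp_const 1).indicator hs)
    simpa only [hind s hs] using this
  have hup : ∀ᵐ ω ∂μ, w ω ≤ C := by
    refine ae_le_of_forall_setIntegral_le hwi (integrable_const C) fun s hs _ => ?_
    refine le_of_tendsto (hset s hs) (Eventually.of_forall fun n => ?_)
    exact integral_mono (hbm n).integrable (integrable_const C) fun ω => (abs_le.1 (hb n ω)).2
  have hlo : ∀ᵐ ω ∂μ, -C ≤ w ω := by
    refine ae_le_of_forall_setIntegral_le (integrable_const (-C)) hwi fun s hs _ => ?_
    refine ge_of_tendsto (hset s hs) (Eventually.of_forall fun n => ?_)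
    exact integral_mono (integrable_const (-C)) (hbm n).integrable fun ω => (abs_le.1 (hb n ω)).1
  set w' : Ω → ℝ := fun ω => max (-C) (min C (w ω)) with hw'
  have hww : w' =ᵐ[μ] w := by
    filter_upwards [hup, hlo] with ω h1 h2
    simp only [hw']
    rw [min_eq_right h1, max_eq_right h2]
  have hw'm : Measurable w' :=
    measurable_const.max (measurable_const.min (Lp.stronglyMeasurable w).measurable)
  have hw'b : ∀ ω, |w' ω| ≤ C := fun ω =>
    abs_le.2 ⟨le_max_left _ _, max_le (by linarith) (min_le_left _ _)⟩
  refine ⟨w', hw'm, hw'b, fun G hG => ?_⟩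
  have hbw : BddMeas w' := ⟨hw'm, C, hw'b⟩
  rw [Metric.tendsto_nhds]
  intro ε hε
  have hδ : 0 < ε / (4 * (C + 1)) := by positivity
  obtain ⟨g, hg, hgi, hGg⟩ := Integrable.exists_bddMeas_sub_le hG hδ
  have hg2 : MemLp g 2 μ := by
    obtain ⟨hgm, D, hD⟩ := hg
    exact MemLp.of_bound hgm.aestronglyMeasurable D (Eventually.of_forall hD)
  have key : ∀ f, BddMeas f → (∀ ω, |f ω| ≤ C) →
      |(∫ ω, G ω * f ω ∂μ) - ∫ ω, g ω * f ω ∂μ| ≤ ε / 4 := fun f hf hfC => by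
    have i1 : Integrable (fun ω => G ω * f ω) μ := by
      simpa only [mul_comm] using hf.integrable_mul hG
    have i2 : Integrable (fun ω => g ω * f ω) μ := (hg.mul hf).integrable
    rw [← integral_sub i1 i2, ← Real.norm_eq_abs]
    calc ‖∫ ω, (G ω * f ω - g ω * f ω) ∂μ‖ ≤ ∫ ω, C * |G ω - g ω| ∂μ := by
          refine norm_integral_le_of_norm_le ((hG.sub hgi).abs.const_mul C)
            (Eventually.of_forall fun ω => ?_)
          rw [Real.norm_eq_abs, ← sub_mul, abs_mul, mul_comm]
          exact mul_le_mul_of_nonneg_right (hfC ω) (abs_nonneg _)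
      _ = C * ∫ ω, |G ω - g ω| ∂μ := integral_const_mul _ _
      _ ≤ (C + 1) * (ε / (4 * (C + 1))) :=
          mul_le_mul (by linarith) hGg (integral_nonneg fun ω => abs_nonneg _) (by linarith)
      _ = ε / 4 := by field_simp
  have h1 := hlim g hg2
  have h2 : ∫ ω, g ω * w ω ∂μ = ∫ ω, g ω * w' ω ∂μ := integral_congr_ae (by
    filter_upwards [hww] with ω h
    rw [h])
  rw [h2, Metric.tendsto_nhds] at h1
  filter_upwards [h1 (ε / 4) (by positivity)] with n hn
  rw [Real.dist_eq] at hn ⊢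
  have e1 := abs_le.1 (key (u n) (hbm n) (hb n))
  have e2 := abs_le.1 (key w' hbw hw'b)
  have e3 := abs_lt.1 hn
  exact abs_lt.2 ⟨by linarith, by linarith⟩

end Stabilization

section Stabilization

open Filter Topology

variable {Ω : Type*} [MeasurableSpace Ω]

/-- Truncation of the `n`-th function at height `M`. -/
noncomputable def truncAt (v : ℕ → Ω → ℝ) (n M : ℕ) (ω : Ω) : ℝ :=
  if |v n ω| ≤ M then v n ω else 0

lemma abs_truncAt_le (v : ℕ → Ω → ℝ) (n M : ℕ) (ω : Ω) : |truncAt v n M ω| ≤ M := by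
  unfold truncAt
  split_ifs with h
  · exact h
  · simp

lemma abs_truncAt_le_abs (v : ℕ → Ω → ℝ) (n M : ℕ) (ω : Ω) : |truncAt v n M ω| ≤ |v n ω| := by
  unfold truncAt
  split_ifs with h
  · exact le_rfl
  · simp

lemma measurable_truncAt {v : ℕ → Ω → ℝ} (hv : ∀ n, Measurable (v n)) (n M : ℕ) :
    Measurable (truncAt v n M) :=
  Measurable.ite (measurableSet_le (hv n).abs measurable_const) (hv n) measurable_const

lemma bddMeas_truncAt {v : ℕ → Ω → ℝ} (hv : ∀ n, Measurable (v n)) (n M : ℕ) :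
    BddMeas (truncAt v n M) := ⟨measurable_truncAt hv n M, M, abs_truncAt_le v n M⟩

lemma truncAt_sq_mono (v : ℕ → Ω → ℝ) (n : ℕ) {L M : ℕ} (h : L ≤ M) (ω : Ω) :
    truncAt v n L ω ^ 2 ≤ truncAt v n M ω ^ 2 := by
  unfold truncAt
  have : (L : ℝ) ≤ M := by exact_mod_cast h
  split_ifs with h1 h2
  · exact le_rfl
  · exact absurd (h1.trans this) h2
  · simp; positivity
  · exact le_rfl

/-- `f M` is the weak limit of the squares of the truncations at height `M`. -/
structure WeakSquares (μ : Measure Ω) (U : Ultrafilter ℕ) (v : ℕ → Ω → ℝ) (f : ℕ → Ω → ℝ) :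
    Prop where
  meas : ∀ M, Measurable (f M)
  nonneg : ∀ M ω, 0 ≤ f M ω
  le : ∀ M ω, f M ω ≤ (M : ℝ) ^ 2
  mono : ∀ ω, Monotone fun M => f M ω
  lim : ∀ M G, Integrable G μ →
    Tendsto (fun n => ∫ ω, G ω * truncAt v n M ω ^ 2 ∂μ) U (𝓝 (∫ ω, G ω * f M ω ∂μ))

lemma integral_indicator_one_mul {μ : Measure Ω} {s : Set Ω} (hs : MeasurableSet s) (f : Ω → ℝ) :
    ∫ ω, s.indicator (fun _ => (1 : ℝ)) ω * f ω ∂μ = ∫ ω in s, f ω ∂μ := by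
  rw [← integral_indicator hs]
  congr 1; ext ω
  by_cases h : ω ∈ s <;> simp [h]

lemma exists_weakSquares (μ : Measure Ω) [IsFiniteMeasure μ] (U : Ultrafilter ℕ)
    {v : ℕ → Ω → ℝ} (hv : ∀ n, Measurable (v n)) : ∃ f, WeakSquares μ U v f := by
  have hsq : ∀ n M ω, |truncAt v n M ω ^ 2| ≤ (M : ℝ) ^ 2 := fun n M ω => by
    rw [abs_pow]
    exact pow_le_pow_left₀ (abs_nonneg _) (abs_truncAt_le v n M ω) 2
  have hex := fun M : ℕ => exists_weak_limit μ U
    (u := fun n ω => truncAt v n M ω ^ 2) (fun n => (measurable_truncAt hv n M).pow_const 2)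
    (C := (M : ℝ) ^ 2) (by positivity) (fun n ω => hsq n M ω)
  choose f hfm hfb hfl using hex
  have hfi : ∀ M, Integrable (f M) μ := fun M =>
    BddMeas.integrable ⟨hfm M, (M : ℝ) ^ 2, hfb M⟩
  have hti : ∀ n M, Integrable (fun ω => truncAt v n M ω ^ 2) μ := fun n M =>
    ((bddMeas_truncAt hv n M).pow 2).integrable
  have hset : ∀ M (s : Set Ω), MeasurableSet s →
      Tendsto (fun n => ∫ ω in s, truncAt v n M ω ^ 2 ∂μ) U (𝓝 (∫ ω in s, f M ω ∂μ)) :=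
    fun M s hs => by
      have := hfl M (s.indicator fun _ => 1) ((integrable_const 1).indicator hs)
      simpa only [integral_indicator_one_mul hs] using this
  have h0 : ∀ M, ∀ᵐ ω ∂μ, 0 ≤ f M ω := fun M => by
    refine ae_le_of_forall_setIntegral_le (integrable_zero _ _ _) (hfi M) fun s hs _ => ?_
    refine ge_of_tendsto (hset M s hs) (Eventually.of_forall fun n => ?_)
    exact integral_mono (integrable_zero _ _ _) (hti n M).integrableOn fun ω => sq_nonneg _
  have h1 : ∀ M, ∀ᵐ ω ∂μ, f M ω ≤ f (M + 1) ω := fun M => by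
    refine ae_le_of_forall_setIntegral_le (hfi M) (hfi (M + 1)) fun s hs _ => ?_
    refine le_of_tendsto_of_tendsto' (hset M s hs) (hset (M + 1) s hs) fun n => ?_
    exact integral_mono (hti n M).integrableOn (hti n (M + 1)).integrableOn fun ω =>
      truncAt_sq_mono v n M.le_succ ω
  let g : ℕ → Ω → ℝ := fun M ω => partialSups (fun L => max (f L ω) 0) M
  have hgf : ∀ M, g M =ᵐ[μ] f M := fun M => by
    filter_upwards [ae_all_iff.2 h0, ae_all_iff.2 h1] with ω a0 a1
    have e : (fun L => max (f L ω) 0) = fun L => f L ω := by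
      ext L; exact max_eq_left (a0 L)
    simp only [g, e]
    rw [(monotone_nat_of_le_succ a1).partialSups_eq]
  refine ⟨g, fun M => ?_, fun M ω => ?_, fun M ω => ?_, fun ω => (partialSups _).monotone,
    fun M G hG => ?_⟩
  · induction M with
    | zero => simpa [g] using (hfm 0).max measurable_const
    | succ M ih =>
      have : g (M + 1) = fun ω => g M ω ⊔ max (f (M + 1) ω) 0 := by
        ext ω; simp [g]
      rw [this]
      exact ih.max ((hfm _).max measurable_const)
  · exact (le_max_right _ _).trans (le_partialSups (fun L => max (f L ω) 0) M)
  · refine partialSups_le _ _ _ fun L hL => max_le ?_ (by positivity)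
    refine ((abs_le.1 (hfb L ω)).2).trans ?_
    have : (L : ℝ) ≤ M := by exact_mod_cast hL
    gcongr
  · have : ∫ ω, G ω * g M ω ∂μ = ∫ ω, G ω * f M ω ∂μ := integral_congr_ae (by
      filter_upwards [hgf M] with ω h
      rw [h])
    rw [this]
    exact hfl M G hG

/-- The square root of the limit of an increasing sequence bounded in `L_{p/2}`. -/
lemma exists_sqrt_limit {μ : Measure Ω} {f : ℕ → Ω → ℝ} (hm : ∀ M, Measurable (f M))
    (h0 : ∀ M ω, 0 ≤ f M ω) (hmono : ∀ ω, Monotone fun M => f M ω) {p D : ℝ} (hp : 0 < p)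
    (hD : ∀ M, ∫⁻ ω, ENNReal.ofReal (f M ω ^ (p / 2)) ∂μ ≤ ENNReal.ofReal D) :
    ∃ φ : Ω → ℝ, Measurable φ ∧ (∀ ω, 0 ≤ φ ω) ∧ Integrable (fun ω => φ ω ^ p) μ ∧
      (∀ᵐ ω ∂μ, Tendsto (fun M => f M ω) atTop (𝓝 (φ ω ^ 2))) ∧
      ∀ᵐ ω ∂μ, ∀ M, f M ω ≤ φ ω ^ 2 := by
  let h : ℕ → Ω → ℝ≥0∞ := fun M ω => ENNReal.ofReal (f M ω ^ (p / 2))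
  have hhm : ∀ M, Measurable (h M) := fun M => ((hm M).pow_const _).ennreal_ofReal
  have hhmono : ∀ ω, Monotone fun M => h M ω := fun ω L M hLM =>
    ENNReal.ofReal_le_ofReal (Real.rpow_le_rpow (h0 _ _) (hmono ω hLM) (by positivity))
  have hsup : ∫⁻ ω, ⨆ M, h M ω ∂μ ≤ ENNReal.ofReal D := by
    rw [lintegral_iSup hhm fun L M hLM ω => hhmono ω hLM]
    exact iSup_le hD
  have hgm : Measurable fun ω => ⨆ M, h M ω := Measurable.iSup hhm
  have hfin : ∀ᵐ ω ∂μ, ⨆ M, h M ω < ⊤ :=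
    ae_lt_top hgm (hsup.trans_lt ENNReal.ofReal_lt_top).ne
  have hpow : ∀ ω, (((⨆ M, h M ω).toReal) ^ (1 / p)) ^ p = (⨆ M, h M ω).toReal := fun ω => by
    rw [← Real.rpow_mul ENNReal.toReal_nonneg, one_div_mul_cancel hp.ne', Real.rpow_one]
  have hlim : ∀ᵐ ω ∂μ, Tendsto (fun M => f M ω) atTop
      (𝓝 (((⨆ M, h M ω).toReal ^ (1 / p)) ^ 2)) := by
    filter_upwards [hfin] with ω hω
    have t1 := (ENNReal.tendsto_toReal hω.ne).comp (tendsto_atTop_iSup (hhmono ω))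
    have t2 := t1.rpow_const (p := 2 / p) (Or.inr (by positivity))
    refine (t2.congr fun M => ?_).trans_eq ?_
    · simp only [Function.comp, h]
      rw [ENNReal.toReal_ofReal (Real.rpow_nonneg (h0 _ _) _), ← Real.rpow_mul (h0 _ _)]
      rw [show p / 2 * (2 / p) = 1 by field_simp, Real.rpow_one]
    · rw [← Real.rpow_natCast, ← Real.rpow_mul ENNReal.toReal_nonneg]
      congr 2
      push_cast
      ring
  refine ⟨fun ω => (⨆ M, h M ω).toReal ^ (1 / p), hgm.ennreal_toReal.pow_const _,
    fun ω => Real.rpow_nonneg ENNReal.toReal_nonneg _, ?_, hlim, ?_⟩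
  · simp only [hpow]
    exact integrable_toReal_of_lintegral_ne_top hgm.aemeasurable
      (hsup.trans_lt ENNReal.ofReal_lt_top).ne
  · filter_upwards [hlim] with ω hω M
    exact (hmono ω).ge_of_tendsto hω M

end Stabilization

section Stabilization

open Filter Topology

variable {Ω : Type*} [MeasurableSpace Ω]

/-- A weakly null bounded sequence in `L_p` together with the weak limits `f M` of the squares of
its truncations, increasing to `φ ^ 2`. -/
structure WeakSeq (μ : Measure Ω) (U : Ultrafilter ℕ) (p D : ℝ) (v f : ℕ → Ω → ℝ) (φ : Ω → ℝ) :
    Prop where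
  sq : WeakSquares μ U v f
  vmeas : ∀ n, Measurable (v n)
  int : ∀ n, Integrable (fun ω => |v n ω| ^ p) μ
  bound : ∀ n, ∫ ω, |v n ω| ^ p ∂μ ≤ D
  weak : ∀ G : Ω → ℝ, Measurable G → Integrable (fun ω => |G ω| ^ (p / (p - 1))) μ →
    Tendsto (fun n => ∫ ω, G ω * v n ω ∂μ) U (𝓝 0)
  meas : Measurable φ
  nonneg : ∀ ω, 0 ≤ φ ω
  φint : Integrable (fun ω => φ ω ^ p) μ
  lim : ∀ᵐ ω ∂μ, Tendsto (fun M => f M ω) atTop (𝓝 (φ ω ^ 2))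
  le : ∀ᵐ ω ∂μ, ∀ M, f M ω ≤ φ ω ^ 2

variable {μ : Measure Ω} [IsFiniteMeasure μ] {U : Ultrafilter ℕ} {p D : ℝ} {v f : ℕ → Ω → ℝ}
  {φ : Ω → ℝ}

lemma memLp_of_integrable_abs_rpow {μ : Measure Ω} {g : Ω → ℝ} (hg : Measurable g) {p : ℝ}
    (hp : 0 < p) (h : Integrable (fun ω => |g ω| ^ p) μ) : MemLp g (ENNReal.ofReal p) μ := by
  rw [← integrable_norm_rpow_iff hg.aestronglyMeasurable (ENNReal.ofReal_pos.2 hp).ne'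
    ENNReal.ofReal_ne_top, ENNReal.toReal_ofReal hp.le]
  exact h

lemma integrable_abs_rpow_of_memLp {μ : Measure Ω} {g : Ω → ℝ} {p : ℝ}
    (hp : 0 < p) (h : MemLp g (ENNReal.ofReal p) μ) : Integrable (fun ω => |g ω| ^ p) μ := by
  have := (integrable_norm_rpow_iff h.1 (ENNReal.ofReal_pos.2 hp).ne' ENNReal.ofReal_ne_top).2 h
  rw [ENNReal.toReal_ofReal hp.le] at this
  exact this

namespace WeakSeq

lemma integrable_one_add_rpow (h : WeakSeq μ U p D v f φ) (hp : 1 < p) :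
    Integrable (fun ω => (1 + φ ω) ^ p) μ := by
  have hm : MemLp φ (ENNReal.ofReal p) μ := by
    refine memLp_of_integrable_abs_rpow h.meas (by linarith) ?_
    simpa only [abs_of_nonneg (h.nonneg _)] using h.φint
  have := integrable_abs_rpow_of_memLp (by linarith) ((memLp_const (1 : ℝ)).add hm)
  refine this.congr (Eventually.of_forall fun ω => ?_)
  have := h.nonneg ω
  simp only [Pi.add_apply]
  rw [abs_of_nonneg (by linarith)]

lemma integrable_weight (h : WeakSeq μ U p D v f φ) (hp : 1 < p) {G : Ω → ℝ} (hG : BddMeas G) :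
    Integrable (fun ω => G ω * (1 + φ ω) ^ (p - 2)) μ := by
  refine hG.integrable_mul ((h.integrable_one_add_rpow hp).mono'
    ((h.meas.const_add 1).pow_const _).aestronglyMeasurable (Eventually.of_forall fun ω => ?_))
  have := h.nonneg ω
  rw [Real.norm_eq_abs, abs_of_nonneg (by positivity)]
  exact Real.rpow_le_rpow_of_exponent_le (by linarith) (by linarith)

lemma weight_mul_sq_le (h : WeakSeq μ U p D v f φ) (ω : Ω) :
    (1 + φ ω) ^ (p - 2) * φ ω ^ 2 ≤ (1 + φ ω) ^ p := by
  have h0 := h.nonneg ω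
  have : (1 + φ ω) ^ p = (1 + φ ω) ^ (p - 2) * (1 + φ ω) ^ 2 := by
    rw [← Real.rpow_natCast, ← Real.rpow_add (by linarith)]; congr 1; push_cast; ring
  rw [this]
  gcongr
  linarith

lemma integrable_weight_mul_sq (h : WeakSeq μ U p D v f φ) (hp : 1 < p) {G : Ω → ℝ}
    (hG : BddMeas G) : Integrable (fun ω => G ω * ((1 + φ ω) ^ (p - 2) * φ ω ^ 2)) μ := by
  refine hG.integrable_mul ((h.integrable_one_add_rpow hp).mono'
    (((h.meas.const_add 1).pow_const _).mul (h.meas.pow_const 2)).aestronglyMeasurable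
    (Eventually.of_forall fun ω => ?_))
  have := h.nonneg ω
  rw [Real.norm_eq_abs, abs_of_nonneg (by positivity)]
  exact h.weight_mul_sq_le ω

lemma integrable_weight_mul_bdd (h : WeakSeq μ U p D v f φ) (hp : 1 < p) {G g : Ω → ℝ}
    (hG : BddMeas G) (hg : BddMeas g) :
    Integrable (fun ω => G ω * ((1 + φ ω) ^ (p - 2) * g ω)) μ := by
  refine (hg.integrable_mul (h.integrable_weight hp hG)).congr (Eventually.of_forall fun ω => ?_)
  simp only
  ring

lemma bddMeas_f (h : WeakSeq μ U p D v f φ) (M : ℕ) : BddMeas (f M) :=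
  ⟨h.sq.meas M, (M : ℝ) ^ 2, fun ω => by
    rw [abs_of_nonneg (h.sq.nonneg M ω)]
    exact h.sq.le M ω⟩

lemma tendsto_weight_f (h : WeakSeq μ U p D v f φ) (hp : 1 < p) {G : Ω → ℝ} (hG : BddMeas G) :
    Tendsto (fun M => ∫ ω, G ω * ((1 + φ ω) ^ (p - 2) * f M ω) ∂μ) atTop
      (𝓝 (∫ ω, G ω * ((1 + φ ω) ^ (p - 2) * φ ω ^ 2) ∂μ)) := by
  obtain ⟨C, hC⟩ := hG.2
  refine tendsto_integral_of_dominated_convergence (fun ω => C * (1 + φ ω) ^ p)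
    (fun M => (h.integrable_weight_mul_bdd hp hG (h.bddMeas_f M)).1)
    ((h.integrable_one_add_rpow hp).const_mul C) (fun M => ?_) ?_
  · filter_upwards [h.le] with ω hω
    have h0 := h.nonneg ω
    have h1 := h.sq.nonneg M ω
    rw [Real.norm_eq_abs, abs_mul, abs_of_nonneg (a := _ * _) (by positivity)]
    refine mul_le_mul (hC ω) (le_trans ?_ (h.weight_mul_sq_le ω)) (by positivity)
      ((abs_nonneg _).trans (hC ω))
    exact mul_le_mul_of_nonneg_left (hω M) (by positivity)
  · filter_upwards [h.lim] with ω hω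
    exact (hω.const_mul _).const_mul _

lemma tendsto_weight_truncAt (h : WeakSeq μ U p D v f φ) (hp : 1 < p) {G : Ω → ℝ}
    (hG : BddMeas G) (M : ℕ) :
    Tendsto (fun n => ∫ ω, G ω * ((1 + φ ω) ^ (p - 2) * truncAt v n M ω ^ 2) ∂μ) U
      (𝓝 (∫ ω, G ω * ((1 + φ ω) ^ (p - 2) * f M ω) ∂μ)) := by
  simpa only [mul_assoc] using h.sq.lim M _ (h.integrable_weight hp hG)

lemma integrable_abs_truncAt_rpow (h : WeakSeq μ U p D v f φ) (hp : 1 < p) (n M : ℕ) :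
    Integrable (fun ω => |truncAt v n M ω| ^ p) μ :=
  ((bddMeas_truncAt h.vmeas n M).comp (g := fun x => |x| ^ p)
    (continuous_abs.rpow_const fun _ => Or.inr (by linarith))).integrable

lemma abs_sub_truncAt_rpow (hp : 1 < p) (n M : ℕ) (ω : Ω) : |v n ω - truncAt v n M ω| ^ p =
    if (M : ℝ) < |v n ω| then |v n ω| ^ p else 0 := by
  unfold truncAt
  split_ifs with h1 h2 h2
  · linarith
  · rw [sub_self, abs_zero, Real.zero_rpow (by linarith)]
  · rw [sub_zero]
  · linarith

lemma integrable_tail (h : WeakSeq μ U p D v f φ) (n : ℕ) (M : ℝ) :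
    Integrable (fun ω => if M < |v n ω| then |v n ω| ^ p else 0) μ :=
  (h.int n).indicator (measurableSet_lt measurable_const (h.vmeas n).abs)

lemma weak_truncAt (h : WeakSeq μ U p D v f φ) (hp : 1 < p) {𝓕 : Filter (ℕ × ℕ)}
    (h𝓕 : Tendsto Prod.fst 𝓕 U)
    (happ : ∀ δ > 0, ∀ᶠ i in 𝓕, ∫ ω, |v i.1 ω - truncAt v i.1 i.2 ω| ^ p ∂μ ≤ δ)
    {g : Ω → ℝ} (hg : BddMeas g) : Tendsto
      (fun i : ℕ × ℕ => ∫ ω, g ω * ((1 + φ ω) ^ (p - 1) * truncAt v i.1 i.2 ω) ∂μ) 𝓕 (𝓝 0) := by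
  have hpq : (p / (p - 1)).HolderConjugate p := by
    have := Real.HolderConjugate.conjExponent hp
    exact this.symm
  set q := p / (p - 1) with hq
  have hq0 : 0 < q := hpq.pos
  obtain ⟨hgm, C, hC⟩ := hg
  set G : Ω → ℝ := fun ω => g ω * (1 + φ ω) ^ (p - 1) with hGd
  have hGm : Measurable G := hgm.mul ((h.meas.const_add 1).pow_const _)
  have hGi : Integrable (fun ω => |G ω| ^ q) μ := by
    refine ((h.integrable_one_add_rpow hp).const_mul (C ^ q)).mono'
      (hGm.abs.pow_const q).aestronglyMeasurable (Eventually.of_forall fun ω => ?_)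
    have h0 := h.nonneg ω
    rw [Real.norm_eq_abs, abs_of_nonneg (by positivity)]
    simp only [hGd]
    rw [abs_mul, abs_of_nonneg (a := _ ^ _) (by positivity), Real.mul_rpow (by positivity)
      (by positivity), ← Real.rpow_mul (by positivity)]
    have : (p - 1) * q = p := by
      rw [hq]; have : p - 1 ≠ 0 := by linarith
      field_simp
    rw [this]
    have := hC ω
    gcongr
  have hGL := memLp_of_integrable_abs_rpow hGm hq0 hGi
  have h1 := (h.weak G hGm hGi).comp h𝓕
  have h2 : Tendsto (fun i : ℕ × ℕ => ∫ ω, G ω * (v i.1 ω - truncAt v i.1 i.2 ω) ∂μ) 𝓕 (𝓝 0) := by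
    have h3 : Tendsto (fun i : ℕ × ℕ => ∫ ω, |v i.1 ω - truncAt v i.1 i.2 ω| ^ p ∂μ) 𝓕 (𝓝 0) := by
      rw [Metric.tendsto_nhds]
      intro ε hε
      filter_upwards [happ (ε / 2) (by positivity)] with i hi
      rw [Real.dist_eq, sub_zero, abs_of_nonneg (integral_nonneg fun ω => by positivity)]
      linarith
    have h4 := (h3.rpow_const (p := 1 / p) (Or.inr (by positivity))).const_mul
      ((∫ ω, |G ω| ^ q ∂μ) ^ (1 / q))
    rw [Real.zero_rpow (by positivity), mul_zero] at h4
    refine squeeze_zero_norm (fun i => ?_) h4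
    have hd : Integrable (fun ω => |v i.1 ω - truncAt v i.1 i.2 ω| ^ p) μ := by
      simp only [abs_sub_truncAt_rpow hp]
      exact h.integrable_tail _ _
    have hdL := memLp_of_integrable_abs_rpow
      ((h.vmeas i.1).sub (measurable_truncAt h.vmeas i.1 i.2)) (by linarith) hd
    refine (norm_integral_le_integral_norm _).trans ?_
    simp only [norm_mul]
    have := integral_mul_norm_le_Lp_mul_Lq hpq hGL hdL
    simpa only [Real.norm_eq_abs, Pi.sub_apply] using this
  have h5 := h1.sub h2
  rw [sub_zero] at h5
  refine h5.congr fun i => ?_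
  have hvL := memLp_of_integrable_abs_rpow (h.vmeas i.1) (by linarith) (h.int i.1)
  have htL := memLp_of_integrable_abs_rpow (measurable_truncAt h.vmeas i.1 i.2) (by linarith)
    (h.integrable_abs_truncAt_rpow hp i.1 i.2)
  have : ENNReal.HolderTriple (ENNReal.ofReal q) (ENNReal.ofReal p) 1 :=
    hpq.ennrealOfReal
  have i1 : Integrable (fun ω => G ω * v i.1 ω) μ := hGL.integrable_mul hvL
  have i2 : Integrable (fun ω => G ω * (v i.1 ω - truncAt v i.1 i.2 ω)) μ :=
    hGL.integrable_mul (hvL.sub htL)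
  simp only [Function.comp]
  rw [← integral_sub i1 i2]
  congr 1; ext ω
  simp only [hGd]
  ring

end WeakSeq

end Stabilization

section Stabilization

open Filter Topology

variable {Ω : Type*} [MeasurableSpace Ω]

/-- The truncations along `𝓕` satisfy the central limit theorem and approximate the sequence. -/
structure GoodTruncation (μ : Measure Ω) (U : Ultrafilter ℕ) (p : ℝ) (v : ℕ → Ω → ℝ) (φ : Ω → ℝ)
    (𝓕 : Filter (ℕ × ℕ)) : Prop where
  neBot : 𝓕.NeBot
  fst : Tendsto Prod.fst 𝓕 U
  approx : ∀ δ > 0, ∀ᶠ i in 𝓕, ∫ ω, |v i.1 ω - truncAt v i.1 i.2 ω| ^ p ∂μ ≤ δ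
  clt : CLTFamily μ p (fun i => truncAt v i.1 i.2) φ 𝓕

/-- Small sets carry little mass of an integrable function, uniformly. -/
lemma exists_forall_tail_le {μ : Measure Ω} [IsFiniteMeasure μ] {p D : ℝ} (hp : 0 < p)
    {v : ℕ → Ω → ℝ} (hv : ∀ n, Measurable (v n)) (hi : ∀ n, Integrable (fun ω => |v n ω| ^ p) μ)
    (hD : ∀ n, ∫ ω, |v n ω| ^ p ∂μ ≤ D) {g : Ω → ℝ} (hg : Integrable g μ) (hg0 : ∀ ω, 0 ≤ g ω)
    {η : ℝ} (hη : 0 < η) :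
    ∃ L : ℕ, ∀ M ≥ L, ∀ n, (∫ ω, (if (M : ℝ) < |v n ω| then g ω else 0) ∂μ) ≤ η := by
  have hD0 : 0 ≤ D := (integral_nonneg fun ω => by positivity).trans (hD 0)
  have hfin : ∫⁻ ω, ENNReal.ofReal (g ω) ∂μ ≠ ⊤ := by
    rw [← ofReal_integral_eq_lintegral_ofReal hg (Eventually.of_forall hg0)]
    exact ENNReal.ofReal_ne_top
  obtain ⟨δ, hδ, hs⟩ := exists_pos_setLIntegral_lt_of_measure_lt hfin
    (ENNReal.ofReal_pos.2 hη).ne'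
  have hlim : Tendsto (fun M : ℕ => ENNReal.ofReal (D * ((M : ℝ) ^ p)⁻¹)) atTop (𝓝 0) := by
    have : Tendsto (fun M : ℕ => D * ((M : ℝ) ^ p)⁻¹) atTop (𝓝 (D * 0)) :=
      (tendsto_inv_atTop_zero.comp
        ((tendsto_rpow_atTop hp).comp tendsto_natCast_atTop_atTop)).const_mul D
    rw [mul_zero] at this
    simpa using ENNReal.tendsto_ofReal this
  obtain ⟨L, hL⟩ := ((hlim.eventually_lt_const hδ).and (eventually_gt_atTop 0)).exists_forall_of_atTop
  refine ⟨L, fun M hM n => ?_⟩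
  obtain ⟨hM1, hM2⟩ := hL M hM
  have hM0 : (0 : ℝ) < M := by exact_mod_cast hM2
  have hms : MeasurableSet {ω | (M : ℝ) < |v n ω|} := measurableSet_lt measurable_const (hv n).abs
  have hmeas : μ {ω | (M : ℝ) < |v n ω|} < δ := by
    refine lt_of_le_of_lt ?_ hM1
    have h1 := mul_meas_ge_le_integral_of_nonneg
      (Eventually.of_forall fun ω => (by positivity : 0 ≤ |v n ω| ^ p)) (hi n) ((M : ℝ) ^ p)
    have hpos : 0 < (M : ℝ) ^ p := by positivity
    have h2 : μ.real {ω | (M : ℝ) ^ p ≤ |v n ω| ^ p} ≤ D * ((M : ℝ) ^ p)⁻¹ := by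
      rw [← div_eq_mul_inv, le_div_iff₀ hpos, mul_comm]
      exact h1.trans (hD n)
    calc μ {ω | (M : ℝ) < |v n ω|} ≤ μ {ω | (M : ℝ) ^ p ≤ |v n ω| ^ p} := by
          refine measure_mono fun ω hω => ?_
          exact Real.rpow_le_rpow hM0.le (le_of_lt hω) hp.le
      _ = ENNReal.ofReal (μ.real {ω | (M : ℝ) ^ p ≤ |v n ω| ^ p}) := by
          rw [ofReal_measureReal]
      _ ≤ _ := ENNReal.ofReal_le_ofReal h2
  have h3 := hs _ hmeas
  have e : ∫ ω, (if (M : ℝ) < |v n ω| then g ω else 0) ∂μ =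
      ∫ ω in {ω | (M : ℝ) < |v n ω|}, g ω ∂μ := by
    rw [← integral_indicator hms]
    rfl
  rw [e, ← ENNReal.ofReal_le_ofReal_iff hη.le,
    ofReal_integral_eq_lintegral_ofReal hg.integrableOn (Eventually.of_forall hg0)]
  exact h3.le

variable {μ : Measure Ω} [IsFiniteMeasure μ] {U : Ultrafilter ℕ} {p D : ℝ} {v f : ℕ → Ω → ℝ}
  {φ : Ω → ℝ}

namespace WeakSeq

lemma weakSq_sub (h : WeakSeq μ U p D v f φ) (hp : 1 < p) {g : Ω → ℝ} (hg : BddMeas g) (n M : ℕ) :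
    ∫ ω, g ω * ((1 + φ ω) ^ (p - 2) * (truncAt v n M ω ^ 2 - φ ω ^ 2)) ∂μ =
    (∫ ω, g ω * ((1 + φ ω) ^ (p - 2) * truncAt v n M ω ^ 2) ∂μ) -
      ∫ ω, g ω * ((1 + φ ω) ^ (p - 2) * φ ω ^ 2) ∂μ := by
  rw [← integral_sub (h.integrable_weight_mul_bdd hp hg ((bddMeas_truncAt h.vmeas n M).pow 2))
    (h.integrable_weight_mul_sq hp hg)]
  congr 1; ext ω; ring

/-- The case `p < 2`. -/
lemma goodTruncation_of_lt_two (h : WeakSeq μ U p D v f φ) (hp : 1 < p) (hp2 : p < 2)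
    (htail : ∀ η > 0, ∃ M : ℕ, ∀ᶠ n in U,
      (∫ ω, (if (M : ℝ) < |v n ω| then |v n ω| ^ p else 0) ∂μ) ≤ η) :
    GoodTruncation μ U p v φ (map Prod.swap ((atTop : Filter ℕ).curry (U : Filter ℕ))) := by
  have hev : ∀ P : ℕ × ℕ → Prop, (∀ᶠ M in (atTop : Filter ℕ), ∀ᶠ n in (U : Filter ℕ), P (n, M)) →
      ∀ᶠ i in map Prod.swap ((atTop : Filter ℕ).curry (U : Filter ℕ)), P i := fun P hP => by
    rw [eventually_map, eventually_curry_iff]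
    exact hP
  have hfst : Tendsto Prod.fst (map Prod.swap ((atTop : Filter ℕ).curry (U : Filter ℕ))) U :=
    fun s hs => hev (fun i => i.1 ∈ s) (Eventually.of_forall fun M => hs)
  have happ : ∀ δ > 0, ∀ᶠ i in map Prod.swap ((atTop : Filter ℕ).curry (U : Filter ℕ)),
      ∫ ω, |v i.1 ω - truncAt v i.1 i.2 ω| ^ p ∂μ ≤ δ := fun δ hδ => by
    refine hev _ ?_
    obtain ⟨L, hL⟩ := htail δ hδ
    filter_upwards [eventually_ge_atTop L] with M hM
    filter_upwards [hL] with n hn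
    simp only [abs_sub_truncAt_rpow hp]
    refine le_trans (integral_mono (h.integrable_tail n M) (h.integrable_tail n L) fun ω => ?_) hn
    have : (L : ℝ) ≤ M := by exact_mod_cast hM
    beta_reduce
    split_ifs with h1 h2
    · exact le_rfl
    · exact absurd (this.trans_lt h1) h2
    · positivity
    · exact le_rfl
  have hne : (map Prod.swap ((atTop : Filter ℕ).curry (U : Filter ℕ))).NeBot := ⟨fun hbot => by
    rw [← eventually_false_iff_eq_bot, eventually_map, eventually_curry_iff] at hbot
    simp only [eventually_false_iff_eq_bot, eventually_atTop] at hbot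
    obtain ⟨a, ha⟩ := hbot
    exact U.neBot.ne (ha a le_rfl)⟩
  refine ⟨hne, hfst, happ, fun i => bddMeas_truncAt h.vmeas _ _, h.meas, h.nonneg,
    h.integrable_one_add_rpow hp, fun g hg => h.weak_truncAt hp hfst happ hg, fun g hg => ?_,
    fun h2 => absurd h2 (by linarith), fun _ η hη => ?_⟩
  · rw [Metric.tendsto_nhds]
    intro ε hε
    refine hev _ ?_
    filter_upwards [Metric.tendsto_nhds.1 (h.tendsto_weight_f hp hg) (ε / 2) (by positivity)]
      with M hM
    filter_upwards [Metric.tendsto_nhds.1 (h.tendsto_weight_truncAt hp hg M) (ε / 2)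
      (by positivity)] with n hn
    rw [h.weakSq_sub hp hg, dist_zero_right, ← dist_eq_norm]
    linarith [dist_triangle (∫ ω, g ω * ((1 + φ ω) ^ (p - 2) * truncAt v n M ω ^ 2) ∂μ)
      (∫ ω, g ω * ((1 + φ ω) ^ (p - 2) * f M ω) ∂μ)
      (∫ ω, g ω * ((1 + φ ω) ^ (p - 2) * φ ω ^ 2) ∂μ)]
  · have h1 := BddMeas.const (Ω := Ω) 1
    obtain ⟨L, hL⟩ := (Metric.tendsto_nhds.1 (h.tendsto_weight_f hp h1) (η / 4)
      (by positivity)).exists_forall_of_atTop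
    refine ⟨L, hev _ ?_⟩
    filter_upwards [eventually_ge_atTop L] with M hM
    filter_upwards [Metric.tendsto_nhds.1 (h.tendsto_weight_truncAt hp h1 M) (η / 4)
      (by positivity), Metric.tendsto_nhds.1 (h.tendsto_weight_truncAt hp h1 L) (η / 4)
      (by positivity)] with n hn1 hn2
    have i1 : ∀ K, Integrable (fun ω => 1 * ((1 + φ ω) ^ (p - 2) * truncAt v n K ω ^ 2)) μ :=
      fun K => h.integrable_weight_mul_bdd hp h1 ((bddMeas_truncAt h.vmeas n K).pow 2)
    have e : ∀ ω, (if (L : ℝ) < |truncAt v n M ω| then (1 + φ ω) ^ (p - 2) * truncAt v n M ω ^ 2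
        else 0) ≤ 1 * ((1 + φ ω) ^ (p - 2) * truncAt v n M ω ^ 2) -
          1 * ((1 + φ ω) ^ (p - 2) * truncAt v n L ω ^ 2) := fun ω => by
      have h0 := h.nonneg ω
      have hw : 0 ≤ (1 + φ ω) ^ (p - 2) := by positivity
      split_ifs with c
      · have : truncAt v n L ω = 0 := by
          unfold truncAt
          rw [if_neg]
          exact not_le.2 (c.trans_le (abs_truncAt_le_abs v n M ω))
        rw [this]; simp
      · have := mul_le_mul_of_nonneg_left (truncAt_sq_mono v n hM ω) hw
        linarith
    have e2 := integral_mono_of_nonneg (μ := μ) (Eventually.of_forall fun ω => ?_)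
      ((i1 M).sub (i1 L)) (Eventually.of_forall e)
    · refine e2.trans ?_
      simp only [Pi.sub_apply]
      rw [integral_sub (i1 M) (i1 L)]
      have a1 := hL L le_rfl
      have a2 := hL M hM
      rw [Real.dist_eq] at hn1 hn2 a1 a2
      linarith [(abs_lt.1 hn1).2, (abs_lt.1 hn2).1, (abs_lt.1 a1).1, (abs_lt.1 a2).2]
    · have h0 := h.nonneg ω
      simp only [Pi.zero_apply]
      split_ifs <;> positivity

/-- The case `2 < p`. -/
lemma goodTruncation_of_two_lt (h : WeakSeq μ U p D v f φ) (hp2 : 2 < p) :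
    GoodTruncation μ U p v φ ((U : Filter ℕ).curry (atTop : Filter ℕ)) := by
  have hp : 1 < p := by linarith
  have hev : ∀ P : ℕ × ℕ → Prop, (∀ᶠ n in (U : Filter ℕ), ∀ᶠ M in (atTop : Filter ℕ), P (n, M)) →
      ∀ᶠ i in (U : Filter ℕ).curry (atTop : Filter ℕ), P i := fun P hP => by
    rw [eventually_curry_iff]
    exact hP
  have hfst : Tendsto Prod.fst ((U : Filter ℕ).curry (atTop : Filter ℕ)) U := fun s hs =>
    hev (fun i => i.1 ∈ s)
      (Eventually.mono (p := fun n => n ∈ s) hs fun n hn => Eventually.of_forall fun _ => hn)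
  have happ : ∀ δ > 0, ∀ᶠ i in (U : Filter ℕ).curry (atTop : Filter ℕ),
      ∫ ω, |v i.1 ω - truncAt v i.1 i.2 ω| ^ p ∂μ ≤ δ := fun δ hδ => by
    refine hev _ (Eventually.of_forall fun n => ?_)
    obtain ⟨L, hL⟩ := exists_forall_tail_le (v := fun _ => v n) (by linarith) (fun _ => h.vmeas n)
      (fun _ => h.int n) (fun _ => h.bound n) (h.int n) (fun ω => by positivity) hδ
    filter_upwards [eventually_ge_atTop L] with M hM
    simp only [abs_sub_truncAt_rpow hp]
    exact hL M hM 0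
  have hne : ((U : Filter ℕ).curry (atTop : Filter ℕ)).NeBot := ⟨fun hbot => by
    rw [← eventually_false_iff_eq_bot, eventually_curry_iff] at hbot
    obtain ⟨n, hn⟩ := hbot.exists
    obtain ⟨M, hM⟩ := hn.exists
    exact hM⟩
  refine ⟨hne, hfst, happ, fun i => bddMeas_truncAt h.vmeas _ _, h.meas, h.nonneg,
    h.integrable_one_add_rpow hp, fun g hg => h.weak_truncAt hp hfst happ hg, fun g hg => ?_,
    fun _ => ⟨D, hev _ (Eventually.of_forall fun n => Eventually.of_forall fun M => ?_)⟩,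
    fun h2 => absurd h2 (by linarith)⟩
  · obtain ⟨C, hC⟩ := hg.2
    rw [Metric.tendsto_nhds]
    intro ε hε
    have hC1 : 0 < |C| + 1 := by positivity
    have hD0 : 0 ≤ D := (integral_nonneg fun ω => by positivity).trans (h.bound 0)
    obtain ⟨t, ht, htD⟩ : ∃ t : ℝ, 0 < t ∧ t ^ (2 - p) * D ≤ ε / (8 * (|C| + 1)) := by
      have : Tendsto (fun t : ℝ => t ^ (2 - p) * D) atTop (𝓝 (0 * D)) := by
        have := (tendsto_rpow_neg_atTop (y := p - 2) (by linarith)).mul_const D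
        simpa only [neg_sub] using this
      rw [zero_mul] at this
      obtain ⟨t, ht⟩ := ((this.eventually (ge_mem_nhds
        (by positivity : 0 < ε / (8 * (|C| + 1))))).and (eventually_gt_atTop 0)).exists
      exact ⟨t, ht.2, ht.1⟩
    obtain ⟨L, hL⟩ := exists_forall_tail_le (μ := μ) (by linarith) h.vmeas h.int h.bound
      (h.integrable_one_add_rpow hp) (fun ω => by have := h.nonneg ω; positivity)
      (by positivity : 0 < ε / (8 * (|C| + 1)) / t ^ 2)
    have hyoung : ∀ x y : ℝ, 0 < x → 0 ≤ y → x ^ (p - 2) * y ^ 2 ≤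
        t ^ 2 * x ^ p + t ^ (2 - p) * y ^ p := fun x y hx hy => by
      have exy : ∀ s : ℝ, 0 < s → s ^ p = s ^ (p - 2) * s ^ 2 := fun s hs => by
        rw [← Real.rpow_natCast, ← Real.rpow_add hs]; congr 1; push_cast; ring
      rcases le_total y (t * x) with hle | hle
      · have h1 : y ^ 2 ≤ (t * x) ^ 2 := pow_le_pow_left₀ hy hle 2
        have h2 : x ^ (p - 2) * y ^ 2 ≤ x ^ (p - 2) * (t * x) ^ 2 := by gcongr
        rw [exy x hx]
        have : 0 ≤ t ^ (2 - p) * y ^ p := by positivity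
        nlinarith
      · have hy0 : 0 < y := lt_of_lt_of_le (by positivity) hle
        have h1 : x ≤ y / t := by rw [le_div_iff₀ ht]; linarith
        have h2 : x ^ (p - 2) ≤ (y / t) ^ (p - 2) :=
          Real.rpow_le_rpow hx.le h1 (by linarith)
        rw [Real.div_rpow hy ht.le, div_eq_mul_inv, ← Real.rpow_neg ht.le, neg_sub] at h2
        rw [exy y hy0]
        have : 0 ≤ t ^ 2 * x ^ p := by positivity
        have := mul_le_mul_of_nonneg_right h2 (sq_nonneg y)
        linarith
    have hclose : ∀ n M, L ≤ M → |(∫ ω, g ω * ((1 + φ ω) ^ (p - 2) * truncAt v n M ω ^ 2) ∂μ) -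
        ∫ ω, g ω * ((1 + φ ω) ^ (p - 2) * truncAt v n L ω ^ 2) ∂μ| ≤ ε / 4 := fun n M hM => by
      have i1 : ∀ K, Integrable (fun ω => g ω * ((1 + φ ω) ^ (p - 2) * truncAt v n K ω ^ 2)) μ :=
        fun K => h.integrable_weight_mul_bdd hp hg ((bddMeas_truncAt h.vmeas n K).pow 2)
      have j1 : Integrable (fun ω => if (L : ℝ) < |v n ω| then (1 + φ ω) ^ p else 0) μ :=
        (h.integrable_one_add_rpow hp).indicator
          (measurableSet_lt measurable_const (h.vmeas n).abs)
      have j2 : Integrable (fun ω => (|C| + 1) * (t ^ 2 *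
          (if (L : ℝ) < |v n ω| then (1 + φ ω) ^ p else 0) + t ^ (2 - p) * |v n ω| ^ p)) μ :=
        ((j1.const_mul _).add ((h.int n).const_mul _)).const_mul _
      rw [← integral_sub (i1 M) (i1 L), ← Real.norm_eq_abs]
      refine (norm_integral_le_of_norm_le j2 (Eventually.of_forall fun ω => ?_)).trans ?_
      · have h0 := h.nonneg ω
        rw [← mul_sub, ← mul_sub, norm_mul, Real.norm_eq_abs, Real.norm_eq_abs]
        refine mul_le_mul ((hC ω).trans (by linarith [le_abs_self C])) ?_ (abs_nonneg _) hC1.le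
        rw [abs_of_nonneg (mul_nonneg (by positivity)
          (sub_nonneg.2 (truncAt_sq_mono v n hM ω)))]
        split_ifs with c
        · refine le_trans ?_ (hyoung (1 + φ ω) |v n ω| (by linarith) (abs_nonneg _))
          refine mul_le_mul_of_nonneg_left ?_ (by positivity)
          have := sq_le_sq' (a := truncAt v n M ω) (b := |v n ω|)
            (by linarith [neg_abs_le (truncAt v n M ω), abs_truncAt_le_abs v n M ω])
            ((le_abs_self _).trans (abs_truncAt_le_abs v n M ω))
          linarith [sq_nonneg (truncAt v n L ω)]
        · have hLM : (L : ℝ) ≤ M := by exact_mod_cast hM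
          have : truncAt v n M ω = truncAt v n L ω := by
            unfold truncAt
            rw [if_pos (not_lt.1 c), if_pos ((not_lt.1 c).trans hLM)]
          rw [this]
          simp only [sub_self, mul_zero, zero_add]
          positivity
      · rw [integral_const_mul, integral_add (j1.const_mul _) ((h.int n).const_mul _),
          integral_const_mul, integral_const_mul]
        have k1 : t ^ 2 * ∫ ω, (if (L : ℝ) < |v n ω| then (1 + φ ω) ^ p else 0) ∂μ ≤
            ε / (8 * (|C| + 1)) := by
          have := mul_le_mul_of_nonneg_left (hL L le_rfl n) (sq_nonneg t)
          rwa [mul_div_cancel₀ _ (by positivity)] at this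
        have k2 : t ^ (2 - p) * ∫ ω, |v n ω| ^ p ∂μ ≤ ε / (8 * (|C| + 1)) :=
          (mul_le_mul_of_nonneg_left (h.bound n) (by positivity)).trans htD
        have k3 := mul_le_mul_of_nonneg_left (add_le_add k1 k2) hC1.le
        refine k3.trans (le_of_eq ?_)
        field_simp
        ring
    obtain ⟨K, hKL, hK⟩ := ((eventually_ge_atTop L).and (Metric.tendsto_nhds.1
      (h.tendsto_weight_f hp hg) (ε / 8) (by positivity))).exists
    refine hev _ ?_
    filter_upwards [Metric.tendsto_nhds.1 (h.tendsto_weight_truncAt hp hg K) (ε / 8)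
      (by positivity)] with n hn
    filter_upwards [eventually_ge_atTop L] with M hM
    rw [h.weakSq_sub hp hg, dist_zero_right, Real.norm_eq_abs]
    rw [Real.dist_eq] at hn hK
    have c1 := abs_le.1 (hclose n M hM)
    have c2 := abs_le.1 (hclose n K hKL)
    exact abs_lt.2 ⟨by linarith [(abs_lt.1 hn).1, (abs_lt.1 hK).1],
      by linarith [(abs_lt.1 hn).2, (abs_lt.1 hK).2]⟩
  · refine le_trans (integral_mono (h.integrable_abs_truncAt_rpow hp n M) (h.int n) fun ω => ?_)
      (h.bound n)
    exact Real.rpow_le_rpow (abs_nonneg _) (abs_truncAt_le_abs v n M ω) (by linarith)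

end WeakSeq

end Stabilization

section Stabilization

open Filter Topology

variable {Ω : Type*} [MeasurableSpace Ω]

lemma norm_rpow_Lp {μ : Measure Ω} {p : ℝ} (hp : 0 < p) (f : Lp ℝ (ENNReal.ofReal p) μ) :
    ‖f‖ ^ p = ∫ ω, |f ω| ^ p ∂μ := by
  have h := (Lp.memLp f).eLpNorm_eq_integral_rpow_norm (ENNReal.ofReal_pos.2 hp).ne'
    ENNReal.ofReal_ne_top
  have h0 : 0 ≤ ∫ ω, |f ω| ^ p ∂μ := integral_nonneg fun ω => by positivity
  rw [Lp.norm_def, h, ENNReal.toReal_ofReal hp.le]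
  simp only [Real.norm_eq_abs]
  rw [ENNReal.toReal_ofReal (by positivity), ← Real.rpow_mul h0, inv_mul_cancel₀ hp.ne',
    Real.rpow_one]

lemma integrable_abs_rpow_Lp {μ : Measure Ω} {p : ℝ} (hp : 0 < p)
    (f : Lp ℝ (ENNReal.ofReal p) μ) : Integrable (fun ω => |f ω| ^ p) μ :=
  integrable_abs_rpow_of_memLp hp (Lp.memLp f)

lemma lintegral_abs_rpow_Lp {μ : Measure Ω} {p : ℝ} (hp : 0 < p)
    (f : Lp ℝ (ENNReal.ofReal p) μ) :
    ∫⁻ ω, ENNReal.ofReal (|f ω| ^ p) ∂μ = ENNReal.ofReal (‖f‖ ^ p) := by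
  rw [norm_rpow_Lp hp, ofReal_integral_eq_lintegral_ofReal (integrable_abs_rpow_Lp hp f)
    (Eventually.of_forall fun ω => by positivity)]

/-- Unit vectors of `ℓ₂`. -/
noncomputable def unitVec (i : ℕ) : ell2 := lp.single 2 i (1 : ℝ)

lemma norm_unitVec (i : ℕ) : ‖unitVec i‖ = 1 := by
  rw [unitVec, lp.norm_single (by norm_num), norm_one]

lemma integral_rpow_quadratic_le {θ a b c : ℝ} (h0 : 0 ≤ θ) (h1 : θ ≤ 1)
    (hnn : ∀ z : ℝ, 0 ≤ a + b * z + c * z ^ 2) :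
    Integrable (fun z : ℝ => (a + b * z + c * z ^ 2) ^ θ) stdG ∧
      ∫ z, (a + b * z + c * z ^ 2) ^ θ ∂stdG ≤ (a + c) ^ θ := by
  have hz : Integrable (fun z : ℝ => z) stdG := by simpa using integrable_pow_stdG 1
  have hi : Integrable (fun z : ℝ => a + b * z + c * z ^ 2) stdG :=
    ((integrable_const a).add (hz.const_mul b)).add ((integrable_pow_stdG 2).const_mul c)
  have h_int : ∫ z, (a + b * z + c * z ^ 2) ∂stdG = a + c := by
    rw [integral_add (f := fun z : ℝ => a + b * z) ((integrable_const a).add (hz.const_mul b))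
      ((integrable_pow_stdG 2).const_mul c), integral_add (integrable_const a) (hz.const_mul b),
      integral_const_mul, integral_const_mul, integral_id_stdG, integral_sq_stdG]
    simp
  have hc : Continuous fun z : ℝ => (a + b * z + c * z ^ 2) ^ θ :=
    Continuous.rpow_const (by fun_prop) fun _ => Or.inr h0
  have hi2 : Integrable (fun z : ℝ => (a + b * z + c * z ^ 2) ^ θ) stdG := by
    have hi1 : Integrable (fun z : ℝ => 1 + (a + b * z + c * z ^ 2)) stdG :=
      (integrable_const 1).add hi
    refine hi1.mono' hc.aestronglyMeasurable (Eventually.of_forall fun z => ?_)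
    have := hnn z
    rw [Real.norm_eq_abs, abs_of_nonneg (by positivity)]
    rcases le_total (a + b * z + c * z ^ 2) 1 with hle | hle
    · exact (Real.rpow_le_one this hle h0).trans (by linarith)
    · exact (Real.rpow_le_rpow_of_exponent_le hle h1).trans (by rw [Real.rpow_one]; linarith)
  refine ⟨hi2, ?_⟩
  have := (Real.concaveOn_rpow h0 h1).le_map_integral
    (continuousOn_id.rpow_const fun _ _ => Or.inr h0) isClosed_Ici
    (Eventually.of_forall fun z => hnn z) hi hi2
  rwa [h_int] at this

variable {μ : Measure Ω} {p : ℝ} [Fact (1 ≤ ENNReal.ofReal p)]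

/-- Gaussian square function estimate, with an arbitrary starting vector. -/
lemma lintegral_gavg_le [SFinite μ] (hp0 : 0 < p) (hp2 : p ≤ 2)
    (T : ell2 →L[ℝ] Lp ℝ (ENNReal.ofReal p) μ) {B : ℝ} (hB : 0 ≤ B) (hT : ∀ w, ‖T w‖ ≤ B * ‖w‖)
    {κ : Type*} (s : Finset κ) (a : κ → ℝ) (k : κ → ℕ) (w : ell2) :
    ∫⁻ ω, ENNReal.ofReal (gavg (fun x => |x| ^ p) (T w ω)
      (√(∑ i ∈ s, (a i * T (unitVec (k i)) ω) ^ 2))) ∂μ ≤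
    ENNReal.ofReal (B ^ p * (‖w‖ ^ 2 + ∑ i ∈ s, a i ^ 2) ^ (p / 2)) := by
  classical
  have hF := polyGrowth_abs_rpow hp0.le
  have hTm : ∀ w, Measurable (T w) := fun w => (Lp.stronglyMeasurable (T w)).measurable
  induction s using Finset.induction_on generalizing w with
  | empty =>
    simp only [Finset.sum_empty, Real.sqrt_zero, gavg_zero_right, add_zero]
    rw [lintegral_abs_rpow_Lp hp0]
    refine ENNReal.ofReal_le_ofReal ?_
    rw [← Real.rpow_natCast ‖w‖ 2, ← Real.rpow_mul (norm_nonneg _),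
      show ((2 : ℕ) : ℝ) * (p / 2) = p by push_cast; ring, ← Real.mul_rpow hB (norm_nonneg _)]
    exact Real.rpow_le_rpow (norm_nonneg _) (hT w) hp0.le
  | insert j s hj ih =>
    have hsm : Measurable fun ω => √(∑ i ∈ s, (a i * T (unitVec (k i)) ω) ^ 2) :=
      (Finset.measurable_sum s fun i _ => ((hTm _).const_mul _).pow_const 2).sqrt
    have hkey : ∀ ω, ENNReal.ofReal (gavg (fun x => |x| ^ p) (T w ω)
        (√(∑ i ∈ insert j s, (a i * T (unitVec (k i)) ω) ^ 2))) =
        ∫⁻ z, ENNReal.ofReal (gavg (fun x => |x| ^ p) (T w ω + a j * T (unitVec (k j)) ω * z)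
          (√(∑ i ∈ s, (a i * T (unitVec (k i)) ω) ^ 2))) ∂stdG := fun ω => by
      rw [hF.gavg_of_sq_add_sq (T w ω)
        (σ := √(∑ i ∈ s, (a i * T (unitVec (k i)) ω) ^ 2)) (t := a j * T (unitVec (k j)) ω)]
      · refine ofReal_integral_eq_lintegral_ofReal (TaylorData.integrable_gavg hF _ _ _)
          (Eventually.of_forall fun z => integral_nonneg fun _ => by positivity)
      · rw [Real.sq_sqrt (Finset.sum_nonneg fun i _ => sq_nonneg _),
          Real.sq_sqrt (Finset.sum_nonneg fun i _ => sq_nonneg _), Finset.sum_insert hj, add_comm]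
    simp only [hkey]
    have hmeas : Measurable (Function.uncurry fun (ω : Ω) (z : ℝ) =>
        ENNReal.ofReal (gavg (fun x => |x| ^ p) (T w ω + a j * T (unitVec (k j)) ω * z)
          (√(∑ i ∈ s, (a i * T (unitVec (k i)) ω) ^ 2)))) := by
      refine Measurable.ennreal_ofReal ?_
      have h1 : Measurable fun y : Ω × ℝ => T w y.1 + a j * T (unitVec (k j)) y.1 * y.2 :=
        ((hTm w).comp measurable_fst).add
          ((((hTm _).comp measurable_fst).const_mul _).mul measurable_snd)
      exact hF.continuous_gavg.measurable.comp (h1.prodMk (hsm.comp measurable_fst))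
    rw [lintegral_lintegral_swap hmeas.aemeasurable]
    set c : ℝ := inner ℝ w (unitVec (k j)) with hc
    set S : ℝ := ∑ i ∈ s, a i ^ 2 with hS
    have hS0 : 0 ≤ S := Finset.sum_nonneg fun i _ => sq_nonneg _
    have hnorm : ∀ z : ℝ, ‖w + (a j * z) • unitVec (k j)‖ ^ 2 + S =
        (‖w‖ ^ 2 + S) + (2 * a j * c) * z + a j ^ 2 * z ^ 2 := fun z => by
      rw [norm_add_sq_real, inner_smul_right, norm_smul, norm_unitVec, ← hc, mul_one,
        Real.norm_eq_abs, sq_abs]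
      ring
    have hz : ∀ z : ℝ, ∫⁻ ω, ENNReal.ofReal (gavg (fun x => |x| ^ p)
        (T w ω + a j * T (unitVec (k j)) ω * z)
          (√(∑ i ∈ s, (a i * T (unitVec (k i)) ω) ^ 2))) ∂μ ≤
        ENNReal.ofReal (B ^ p * ((‖w‖ ^ 2 + S) + (2 * a j * c) * z + a j ^ 2 * z ^ 2) ^ (p / 2)) :=
      fun z => by
        rw [← hnorm]
        refine le_trans (le_of_eq (lintegral_congr_ae ?_)) (ih (w + (a j * z) • unitVec (k j)))
        rw [map_add, map_smul]
        filter_upwards [Lp.coeFn_add (T w) ((a j * z) • T (unitVec (k j))),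
          Lp.coeFn_smul (a j * z) (T (unitVec (k j)))] with ω h1 h2
        rw [h1, Pi.add_apply, h2, Pi.smul_apply, smul_eq_mul]
        congr 3
        ring
    obtain ⟨q1, q2⟩ := integral_rpow_quadratic_le (θ := p / 2) (a := ‖w‖ ^ 2 + S)
      (b := 2 * a j * c) (c := a j ^ 2) (by positivity) (by linarith)
      (fun z => by rw [← hnorm]; positivity)
    refine (lintegral_mono hz).trans ?_
    rw [← ofReal_integral_eq_lintegral_ofReal (q1.const_mul _)
      (Eventually.of_forall fun z => by
        have : 0 ≤ (‖w‖ ^ 2 + S) + (2 * a j * c) * z + a j ^ 2 * z ^ 2 := by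
          rw [← hnorm]; positivity
        simp only [Pi.zero_apply]
        positivity), integral_const_mul]
    refine ENNReal.ofReal_le_ofReal ?_
    rw [Finset.sum_insert hj, add_comm (a j ^ 2), ← add_assoc]
    gcongr

lemma gaussMoment_pos {r : ℝ} (hr : 0 ≤ r) : 0 < gaussMoment r := by
  refine (integral_pos_iff_support_of_nonneg (fun z => by positivity) ?_).2 ?_
  · simpa using (polyGrowth_abs_rpow hr).integrable 0 1
  · have h1 : NullMeasurableSet ({0} : Set ℝ) stdG := (measurableSet_singleton 0).nullMeasurableSet
    have h2 : stdG {(0 : ℝ)} = 0 := by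
      have := nullSingletonClass_gaussianReal (μ := 0) (v := 1) one_ne_zero
      exact measure_singleton 0
    have h3 : ({0} : Set ℝ)ᶜ ⊆ Function.support fun z : ℝ => |z| ^ r := fun z hz => by
      have : z ≠ 0 := hz
      have : 0 < |z| := abs_pos.2 this
      exact (Real.rpow_pos_of_pos this r).ne'
    refine lt_of_lt_of_le ?_ (measure_mono h3)
    rw [prob_compl_eq_one_sub (measurableSet_singleton 0), h2]
    simp

/-- Square function estimate. -/
lemma lintegral_square_function_le [SFinite μ] (hp0 : 0 < p) (hp2 : p ≤ 2)
    (T : ell2 →L[ℝ] Lp ℝ (ENNReal.ofReal p) μ) {B : ℝ} (hB : 0 ≤ B) (hT : ∀ w, ‖T w‖ ≤ B * ‖w‖)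
    {κ : Type*} (s : Finset κ) (a : κ → ℝ) (k : κ → ℕ) :
    ∫⁻ ω, ENNReal.ofReal ((∑ i ∈ s, (a i * T (unitVec (k i)) ω) ^ 2) ^ (p / 2)) ∂μ ≤
    ENNReal.ofReal (B ^ p / gaussMoment p * (∑ i ∈ s, a i ^ 2) ^ (p / 2)) := by
  have h := lintegral_gavg_le hp0 hp2 T hB hT s a k 0
  have hg := gaussMoment_pos hp0.le
  have e : ∫⁻ ω, ENNReal.ofReal (gavg (fun x => |x| ^ p) (T 0 ω)
      (√(∑ i ∈ s, (a i * T (unitVec (k i)) ω) ^ 2))) ∂μ =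
      ∫⁻ ω, ENNReal.ofReal ((∑ i ∈ s, (a i * T (unitVec (k i)) ω) ^ 2) ^ (p / 2)) *
        ENNReal.ofReal (gaussMoment p) ∂μ := by
    refine lintegral_congr_ae ?_
    rw [map_zero]
    filter_upwards [Lp.coeFn_zero ℝ (ENNReal.ofReal p) μ] with ω h0
    have hS : 0 ≤ ∑ i ∈ s, (a i * T (unitVec (k i)) ω) ^ 2 :=
      Finset.sum_nonneg fun i _ => sq_nonneg _
    rw [h0, Pi.zero_apply, gavg_abs_rpow, abs_of_nonneg (Real.sqrt_nonneg _), Real.sqrt_eq_rpow,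
      ← Real.rpow_mul hS, ENNReal.ofReal_mul (by positivity)]
    congr 3
    ring
  rw [e, lintegral_mul_const' _ _ ENNReal.ofReal_ne_top, norm_zero] at h
  rw [div_mul_eq_mul_div, ENNReal.ofReal_div_of_pos hg,
    ENNReal.le_div_iff_mul_le (Or.inl (ENNReal.ofReal_pos.2 hg).ne')
      (Or.inl ENNReal.ofReal_ne_top)]
  simpa using h

end Stabilization

section Stabilization

open Filter Topology

variable {Ω : Type*} [MeasurableSpace Ω]

/-- A moment bound for convex combinations passes to weak limits. -/
lemma lintegral_rpow_le_of_weak_limit {μ : Measure Ω} [IsFiniteMeasure μ] {ι : Type*}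
    {U : Ultrafilter ι} {u : ι → Ω → ℝ} {w : Ω → ℝ} {θ : ℝ} (hθ : 0 ≤ θ)
    (hu : ∀ n, BddMeas (u n)) (hw : BddMeas w)
    (hlim : ∀ G, Integrable G μ →
      Tendsto (fun n => ∫ ω, G ω * u n ω ∂μ) U (𝓝 (∫ ω, G ω * w ω ∂μ))) {D : ℝ≥0∞}
    (hD : ∀ (κ : Type) [Fintype κ] (c : κ → ℝ) (k : κ → ι), (∀ i, 0 ≤ c i) → ∑ i, c i = 1 →
      ∫⁻ ω, ENNReal.ofReal ((∑ i, c i * u (k i) ω) ^ θ) ∂μ ≤ D) :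
    ∫⁻ ω, ENNReal.ofReal (w ω ^ θ) ∂μ ≤ D := by
  have hmem : ∀ {f : Ω → ℝ}, BddMeas f → MemLp f 2 μ := fun ⟨h, C, hC⟩ =>
    MemLp.of_bound h.aestronglyMeasurable C (Eventually.of_forall hC)
  set e : ι → Lp ℝ 2 μ := fun n => (hmem (hu n)).toLp (u n) with he
  set W : Lp ℝ 2 μ := (hmem hw).toLp w with hW
  have hin : ∀ (g : Lp ℝ 2 μ) {f : Ω → ℝ} (hf : BddMeas f),
      inner ℝ g ((hmem hf).toLp f) = ∫ ω, g ω * f ω ∂μ := fun g f hf => by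
    rw [L2.inner_def]
    refine integral_congr_ae ?_
    filter_upwards [(hmem hf).coeFn_toLp] with ω h
    rw [h]
    simp [mul_comm]
  have hcl : W ∈ closure (convexHull ℝ (Set.range e)) := by
    by_contra hn
    obtain ⟨f, c, hf1, hf2⟩ := geometric_hahn_banach_point_closed
      (convex_convexHull ℝ (Set.range e)).closure isClosed_closure hn
    set g := (InnerProductSpace.toDual ℝ (Lp ℝ 2 μ)).symm f with hg
    have hfg : ∀ x, f x = inner ℝ g x := fun x => by
      rw [hg, InnerProductSpace.toDual_symm_apply]
    have hgi : Integrable g μ := (Lp.memLp g).integrable (by norm_num)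
    have h1 := hlim g hgi
    have h2 : c ≤ ∫ ω, g ω * w ω ∂μ := by
      refine ge_of_tendsto h1 (Eventually.of_forall fun n => ?_)
      have := hf2 (e n) (subset_closure (subset_convexHull ℝ _ ⟨n, rfl⟩))
      rw [hfg, he] at this
      simp only [hin g (hu n)] at this
      exact this.le
    rw [hfg, hW, hin g hw] at hf1
    linarith
  obtain ⟨x, hx, hxl⟩ := mem_closure_iff_seq_limit.1 hcl
  have hmes : ∀ n, Measurable (x n) := fun n => (Lp.stronglyMeasurable (x n)).measurable
  have hbd : ∀ n, ∫⁻ ω, ENNReal.ofReal (x n ω ^ θ) ∂μ ≤ D := fun n => by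
    obtain ⟨κ, _, c, z, hc0, hc1, hz, hsum⟩ := mem_convexHull_iff_exists_fintype.1 (hx n)
    choose k hk using hz
    refine le_trans (le_of_eq (lintegral_congr_ae ?_)) (hD κ c k hc0 hc1)
    have hall : ∀ᵐ ω ∂μ, ∀ i, (c i • z i : Lp ℝ 2 μ) ω = c i * u (k i) ω := by
      refine ae_all_iff.2 fun i => ?_
      filter_upwards [Lp.coeFn_smul (c i) (z i), (hmem (hu (k i))).coeFn_toLp] with ω h1 h2
      rw [h1, Pi.smul_apply, smul_eq_mul, ← hk i, he]
      simp only [h2]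
    filter_upwards [hall, Lp.coeFn_finsetSum Finset.univ fun i => c i • z i] with ω h1 h2
    rw [← hsum, h2, Finset.sum_apply]
    simp only [h1]
  have hmeasure : TendstoInMeasure μ (fun n => x n) atTop W := tendstoInMeasure_of_tendsto_Lp hxl
  obtain ⟨s, hs, hsl⟩ := hmeasure.exists_seq_tendsto_ae
  calc ∫⁻ ω, ENNReal.ofReal (w ω ^ θ) ∂μ
      = ∫⁻ ω, liminf (fun n => ENNReal.ofReal (x (s n) ω ^ θ)) atTop ∂μ := by
        refine lintegral_congr_ae ?_
        filter_upwards [hsl, (hmem hw).coeFn_toLp] with ω h1 h2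
        rw [hW, h2] at h1
        exact (ENNReal.tendsto_ofReal (h1.rpow_const (Or.inr hθ))).liminf_eq.symm
    _ ≤ liminf (fun n => ∫⁻ ω, ENNReal.ofReal (x (s n) ω ^ θ) ∂μ) atTop :=
        lintegral_liminf_le fun n => ((hmes (s n)).pow_const θ).ennreal_ofReal
    _ ≤ D := by
        refine liminf_le_of_le (by isBoundedDefault) fun b hb => ?_
        obtain ⟨n, hn⟩ := hb.exists
        exact hn.trans (hbd _)

variable {μ : Measure Ω} {p : ℝ} [Fact (1 ≤ ENNReal.ofReal p)]

/-- The coordinates of a functional on `ℓ₂` tend to zero. -/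
lemma tendsto_apply_unitVec (F : ell2 →L[ℝ] ℝ) :
    Tendsto (fun n => F (unitVec n)) cofinite (𝓝 0) := by
  set y := (InnerProductSpace.toDual ℝ ell2).symm F with hy
  have h : ∀ n, F (unitVec n) = y n := fun n => by
    have := InnerProductSpace.toDual_symm_apply (𝕜 := ℝ) (x := unitVec n) (y := F)
    rw [← this, ← hy, unitVec, lp.inner_single_right]
    simp
  simp only [h]
  have h2 : Summable fun n => ‖y n‖ ^ (2 : ℝ≥0∞).toReal := (lp.memℓp y).summable (by norm_num)
  have h3 := h2.tendsto_cofinite_zero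
  have h4 := h3.rpow_const (p := 1 / 2) (Or.inr (by norm_num))
  rw [Real.zero_rpow (by norm_num)] at h4
  rw [tendsto_zero_iff_norm_tendsto_zero]
  refine h4.congr fun n => ?_
  rw [← Real.rpow_mul (norm_nonneg _)]
  norm_num

/-- Images of the unit vectors are weakly null. -/
lemma tendsto_integral_mul_unitVec (hp : 1 < p) (T : ell2 →L[ℝ] Lp ℝ (ENNReal.ofReal p) μ)
    {G : Ω → ℝ} (hG : MemLp G (ENNReal.ofReal (p / (p - 1))) μ) :
    Tendsto (fun n => ∫ ω, G ω * T (unitVec n) ω ∂μ) cofinite (𝓝 0) := by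
  have hconj : p.HolderConjugate (p / (p - 1)) := Real.HolderConjugate.conjExponent hp
  have hq : 1 ≤ ENNReal.ofReal (p / (p - 1)) := by
    rw [ENNReal.one_le_ofReal]; exact hconj.symm.lt.le
  have : Fact (1 ≤ ENNReal.ofReal (p / (p - 1))) := ⟨hq⟩
  have hc := hconj.symm.ennrealOfReal
  let L := ContinuousLinearMap.lpPairing μ (ENNReal.ofReal (p / (p - 1))) (ENNReal.ofReal p)
    (ContinuousLinearMap.mul ℝ ℝ)
  refine (tendsto_apply_unitVec ((L (hG.toLp G)).comp T)).congr fun n => ?_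
  simp only [L, ContinuousLinearMap.comp_apply]
  rw [ContinuousLinearMap.lpPairing_eq_integral]
  refine integral_congr_ae ?_
  filter_upwards [hG.coeFn_toLp] with ω h
  rw [h]
  rfl

end Stabilization

section Stabilization

open Filter Topology

variable {Ω : Type*} [MeasurableSpace Ω] {μ : Measure Ω} {p : ℝ} [Fact (1 ≤ ENNReal.ofReal p)]

lemma lintegral_convexComb_truncAt_le [IsFiniteMeasure μ] (hp0 : 0 < p)
    (T : ell2 →L[ℝ] Lp ℝ (ENNReal.ofReal p) μ) {B : ℝ} (hB : 0 ≤ B) (hT : ∀ w, ‖T w‖ ≤ B * ‖w‖)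
    (M : ℕ) {κ : Type*} [Fintype κ] (c : κ → ℝ) (k : κ → ℕ) (hc : ∀ i, 0 ≤ c i)
    (hc1 : ∑ i, c i = 1) :
    ∫⁻ ω, ENNReal.ofReal ((∑ i, c i * truncAt (fun n => T (unitVec n)) (k i) M ω ^ 2) ^ (p / 2)) ∂μ
      ≤ ENNReal.ofReal (B ^ p + B ^ p / gaussMoment p) := by
  have hg := gaussMoment_pos hp0.le
  have hsq : ∀ n ω, truncAt (fun n => T (unitVec n)) n M ω ^ 2 ≤ T (unitVec n) ω ^ 2 :=
    fun n ω => sq_le_sq.2 (abs_truncAt_le_abs (fun n => T (unitVec n)) n M ω)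
  rcases le_total p 2 with hp2 | hp2
  · have h := lintegral_square_function_le hp0 hp2 T hB hT Finset.univ (fun i => √(c i)) k
    simp only [Real.sq_sqrt (hc _), hc1, Real.one_rpow, mul_one, mul_pow] at h
    refine le_trans (lintegral_mono fun ω => ENNReal.ofReal_le_ofReal ?_)
      (h.trans (ENNReal.ofReal_le_ofReal (by linarith [Real.rpow_nonneg hB p])))
    refine Real.rpow_le_rpow (Finset.sum_nonneg fun i _ => mul_nonneg (hc i) (sq_nonneg _))
      (Finset.sum_le_sum fun i _ => mul_le_mul_of_nonneg_left (hsq _ _) (hc i)) (by positivity)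
  · have hpt : ∀ ω, (∑ i, c i * truncAt (fun n => T (unitVec n)) (k i) M ω ^ 2) ^ (p / 2) ≤
        ∑ i, c i * |T (unitVec (k i)) ω| ^ p := fun ω => by
      refine ((convexOn_rpow (p := p / 2) (by linarith)).map_sum_le (t := Finset.univ) (w := c)
        (p := fun i => truncAt (fun n => T (unitVec n)) (k i) M ω ^ 2) (fun i _ => hc i) hc1
        (fun i _ => sq_nonneg (truncAt (fun n => T (unitVec n)) (k i) M ω))).trans ?_
      refine Finset.sum_le_sum fun i _ => mul_le_mul_of_nonneg_left ?_ (hc i)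
      refine (Real.rpow_le_rpow (sq_nonneg _) (hsq _ _) (by positivity)).trans_eq ?_
      rw [← sq_abs, ← Real.rpow_natCast, ← Real.rpow_mul (abs_nonneg _)]
      congr 1
      push_cast; ring
    have hi : ∀ i, Integrable (fun ω => c i * |T (unitVec (k i)) ω| ^ p) μ := fun i =>
      (integrable_abs_rpow_Lp hp0 _).const_mul _
    refine (lintegral_mono fun ω => ENNReal.ofReal_le_ofReal (hpt ω)).trans ?_
    rw [← ofReal_integral_eq_lintegral_ofReal (integrable_finsetSum _ fun i _ => hi i)
      (Eventually.of_forall fun ω => Finset.sum_nonneg fun i _ =>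
        mul_nonneg (hc i) (by positivity))]
    refine ENNReal.ofReal_le_ofReal ?_
    rw [integral_finsetSum _ fun i _ => hi i]
    calc ∑ i, ∫ ω, c i * |T (unitVec (k i)) ω| ^ p ∂μ ≤ ∑ i, c i * B ^ p := by
          refine Finset.sum_le_sum fun i _ => ?_
          rw [integral_const_mul, ← norm_rpow_Lp hp0]
          refine mul_le_mul_of_nonneg_left ?_ (hc i)
          refine Real.rpow_le_rpow (norm_nonneg _) ?_ hp0.le
          simpa [norm_unitVec] using hT (unitVec (k i))
      _ = B ^ p := by rw [← Finset.sum_mul, hc1, one_mul]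
      _ ≤ _ := by
          have : 0 ≤ B ^ p / gaussMoment p := by positivity
          linarith

lemma integral_abs_rpow_unitVec_le (hp0 : 0 < p) (T : ell2 →L[ℝ] Lp ℝ (ENNReal.ofReal p) μ) {B : ℝ}
    (hT : ∀ w, ‖T w‖ ≤ B * ‖w‖) (n : ℕ) : ∫ ω, |T (unitVec n) ω| ^ p ∂μ ≤ B ^ p := by
  rw [← norm_rpow_Lp hp0]
  refine Real.rpow_le_rpow (norm_nonneg _) ?_ hp0.le
  simpa [norm_unitVec] using hT (unitVec n)

/-- For exponents below two, the images of the unit vectors have uniformly small tails. -/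
lemma exists_forall_tail_unitVec_le [IsFiniteMeasure μ] (hp0 : 0 < p) (hp2 : p < 2)
    (T : ell2 →L[ℝ] Lp ℝ (ENNReal.ofReal p) μ) {B : ℝ} (hB : 0 ≤ B) (hT : ∀ w, ‖T w‖ ≤ B * ‖w‖)
    {η : ℝ} (hη : 0 < η) :
    ∃ M : ℕ, ∀ n, ∫ ω, (if (M : ℝ) < |T (unitVec n) ω| then |T (unitVec n) ω| ^ p else 0) ∂μ ≤
      η := by
  by_contra! hcon
  have hTm : ∀ n, Measurable (T (unitVec n)) := fun n =>
    (Lp.stronglyMeasurable (T (unitVec n))).measurable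
  have hi : ∀ n, Integrable (fun ω => |T (unitVec n) ω| ^ p) μ := fun n =>
    integrable_abs_rpow_Lp hp0 _
  have hθ : 0 ≤ p / 2 := by positivity
  have hg := gaussMoment_pos hp0.le
  have hS0 : ∀ (k : ℕ → ℕ) (m : ℕ) ω, 0 ≤ ∑ i ∈ Finset.range m, T (unitVec (k i)) ω ^ 2 :=
    fun k m ω => Finset.sum_nonneg fun i _ => sq_nonneg _
  have hsf : ∀ (k : ℕ → ℕ) (m : ℕ),
      ∫⁻ ω, ENNReal.ofReal ((∑ i ∈ Finset.range m, T (unitVec (k i)) ω ^ 2) ^ (p / 2)) ∂μ ≤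
      ENNReal.ofReal (B ^ p / gaussMoment p * (m : ℝ) ^ (p / 2)) := fun k m => by
    simpa using lintegral_square_function_le hp0 hp2.le T hB hT (Finset.range m) (fun _ => 1) k
  have hSm : ∀ (k : ℕ → ℕ) (m : ℕ),
      Measurable fun ω => (∑ i ∈ Finset.range m, T (unitVec (k i)) ω ^ 2) ^ (p / 2) := fun k m =>
    (Finset.measurable_sum _ fun i _ => (hTm _).pow_const 2).pow_const _
  have hSi : ∀ (k : ℕ → ℕ) (m : ℕ),
      Integrable (fun ω => (∑ i ∈ Finset.range m, T (unitVec (k i)) ω ^ 2) ^ (p / 2)) μ :=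
    fun k m => by
      refine ⟨(hSm k m).aestronglyMeasurable, ?_⟩
      rw [hasFiniteIntegral_iff_ofReal (Eventually.of_forall fun ω => Real.rpow_nonneg (hS0 k m ω) _)]
      exact (hsf k m).trans_lt ENNReal.ofReal_lt_top
  have hSle : ∀ (k : ℕ → ℕ) (m : ℕ),
      ∫ ω, (∑ i ∈ Finset.range m, T (unitVec (k i)) ω ^ 2) ^ (p / 2) ∂μ ≤
      B ^ p / gaussMoment p * (m : ℝ) ^ (p / 2) := fun k m => by
    rw [← ENNReal.ofReal_le_ofReal_iff (by positivity), ofReal_integral_eq_lintegral_ofReal (hSi k m)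
      (Eventually.of_forall fun ω => Real.rpow_nonneg (hS0 k m ω) _)]
    exact hsf k m
  have hstep : ∀ m : ℕ, ∃ k : ℕ → ℕ,
      m * (η / 2) ≤ ∫ ω, (∑ i ∈ Finset.range m, T (unitVec (k i)) ω ^ 2) ^ (p / 2) ∂μ := by
    intro m
    induction m with
    | zero =>
      refine ⟨id, ?_⟩
      rw [Nat.cast_zero, zero_mul]
      exact integral_nonneg fun ω => Real.rpow_nonneg (hS0 id 0 ω) _
    | succ m ih =>
      obtain ⟨k, hk⟩ := ih
      obtain ⟨M, hM⟩ := exists_forall_tail_le hp0 hTm hi (integral_abs_rpow_unitVec_le hp0 T hT)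
        (hSi k m) (fun ω => Real.rpow_nonneg (hS0 k m ω) _) (half_pos hη)
      obtain ⟨n, hn⟩ := hcon M
      have hMn := hM M le_rfl n
      refine ⟨Function.update k m n, ?_⟩
      have hsum : ∀ ω, ∑ i ∈ Finset.range (m + 1), T (unitVec (Function.update k m n i)) ω ^ 2 =
          ∑ i ∈ Finset.range m, T (unitVec (k i)) ω ^ 2 + T (unitVec n) ω ^ 2 := fun ω => by
        rw [Finset.sum_range_succ, Function.update_self]
        congr 1
        refine Finset.sum_congr rfl fun i hi => ?_
        rw [Function.update_of_ne (Finset.mem_range.1 hi).ne]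
      have hms : MeasurableSet {ω | (M : ℝ) < |T (unitVec n) ω|} :=
        measurableSet_lt measurable_const (hTm n).abs
      have i1 : Integrable (fun ω => if (M : ℝ) < |T (unitVec n) ω| then |T (unitVec n) ω| ^ p else 0)
          μ := (hi n).indicator hms
      have i2 : Integrable (fun ω => if (M : ℝ) < |T (unitVec n) ω| then
          (∑ i ∈ Finset.range m, T (unitVec (k i)) ω ^ 2) ^ (p / 2) else 0) μ :=
        (hSi k m).indicator hms
      have hmono := integral_mono (((hSi k m).add i1).sub i2) (hSi (Function.update k m n) (m + 1))
        (fun ω => by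
          simp only [Pi.sub_apply, Pi.add_apply]
          rw [hsum]
          split_ifs with hlt
          · have : (T (unitVec n) ω ^ 2) ^ (p / 2) = |T (unitVec n) ω| ^ p := by
              rw [← sq_abs, ← Real.rpow_natCast, ← Real.rpow_mul (abs_nonneg _)]
              congr 1
              push_cast; ring
            rw [← this]
            have := Real.rpow_le_rpow (sq_nonneg _) (le_add_of_nonneg_left (hS0 k m ω) :
              T (unitVec n) ω ^ 2 ≤ _) hθ
            linarith
          · have := Real.rpow_le_rpow (hS0 k m ω) (le_add_of_nonneg_right (sq_nonneg _) :
              _ ≤ _ + T (unitVec n) ω ^ 2) hθ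
            linarith)
      rw [integral_sub' ((hSi k m).add i1) i2, integral_add' (hSi k m) i1] at hmono
      push_cast
      linarith
  have hbd : ∀ m : ℕ, 0 < m → (m : ℝ) ^ (1 - p / 2) ≤ B ^ p / gaussMoment p / (η / 2) :=
    fun m hm => by
      obtain ⟨k, hk⟩ := hstep m
      have := hk.trans (hSle k m)
      have hm0 : (0 : ℝ) < m := by exact_mod_cast hm
      rw [Real.rpow_sub hm0, Real.rpow_one, le_div_iff₀ (by positivity), div_mul_eq_mul_div,
        div_le_iff₀ (by positivity)]
      exact this
  have hlim := (tendsto_rpow_atTop (y := 1 - p / 2) (by linarith)).comp tendsto_natCast_atTop_atTop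
  obtain ⟨m, hm1, hm2⟩ := ((hlim.eventually_gt_atTop (B ^ p / gaussMoment p / (η / 2))).and
    (eventually_gt_atTop 0)).exists
  exact absurd (hbd m hm2) (not_le.2 hm1)

/-- The images of the unit vectors form a weakly null sequence with good truncations. -/
theorem exists_goodTruncation [IsFiniteMeasure μ] (hp : 1 < p) (hp2 : p ≠ 2)
    (T : ell2 →L[ℝ] Lp ℝ (ENNReal.ofReal p) μ) {B : ℝ} (hB : 0 ≤ B) (hT : ∀ w, ‖T w‖ ≤ B * ‖w‖) :
    ∃ f φ D 𝓕, WeakSeq μ (Filter.hyperfilter ℕ) p D (fun n => T (unitVec n)) f φ ∧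
      GoodTruncation μ (Filter.hyperfilter ℕ) p (fun n => T (unitVec n)) φ 𝓕 := by
  have hp0 : 0 < p := by linarith
  have hTm : ∀ n, Measurable (T (unitVec n)) := fun n =>
    (Lp.stronglyMeasurable (T (unitVec n))).measurable
  obtain ⟨f, hf⟩ := exists_weakSquares μ (Filter.hyperfilter ℕ) hTm
  obtain ⟨φ, h1, h2, h3, h4, h5⟩ := exists_sqrt_limit hf.meas hf.nonneg hf.mono hp0
    (D := B ^ p + B ^ p / gaussMoment p) fun M =>
      lintegral_rpow_le_of_weak_limit (by positivity)
        (fun n => (bddMeas_truncAt hTm n M).pow 2)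
        ⟨hf.meas M, (M : ℝ) ^ 2, fun ω => by rw [abs_of_nonneg (hf.nonneg M ω)]; exact hf.le M ω⟩
        (hf.lim M) fun κ _ c k hc hc1 => lintegral_convexComb_truncAt_le hp0 T hB hT M c k hc hc1
  have hw : WeakSeq μ (Filter.hyperfilter ℕ) p (B ^ p) (fun n => T (unitVec n)) f φ :=
    { sq := hf
      vmeas := hTm
      int := fun n => integrable_abs_rpow_Lp hp0 _
      bound := integral_abs_rpow_unitVec_le hp0 T hT
      weak := fun G hGm hG => (tendsto_integral_mul_unitVec hp T
        (memLp_of_integrable_abs_rpow hGm (div_pos hp0 (sub_pos.2 hp)) hG)).mono_left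
        Filter.hyperfilter_le_cofinite
      meas := h1
      nonneg := h2
      φint := h3
      lim := h4
      le := h5 }
  rcases lt_or_gt_of_ne hp2 with h | h
  · refine ⟨f, φ, _, _, hw, hw.goodTruncation_of_lt_two hp h fun η hη => ?_⟩
    obtain ⟨M, hM⟩ := exists_forall_tail_unitVec_le hp0 h T hB hT hη
    exact ⟨M, Eventually.of_forall hM⟩
  · exact ⟨f, φ, _, _, hw, hw.goodTruncation_of_two_lt h⟩

end Stabilization

section Stabilization

open Filter Topology

variable {Ω : Type*} [MeasurableSpace Ω]

lemma rpow_le_rpow_add_rpow {c x C : ℝ} (hc : 0 < c) (h1 : c ≤ x) (h2 : x ≤ C) (s : ℝ) :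
    x ^ s ≤ c ^ s + C ^ s := by
  have hx : 0 < x := hc.trans_le h1
  have hC : 0 < C := hx.trans_le h2
  have a1 := Real.rpow_nonneg hc.le s
  have a2 := Real.rpow_nonneg hC.le s
  rcases le_total 0 s with hs | hs
  · linarith [Real.rpow_le_rpow hx.le h2 hs]
  · linarith [Real.rpow_le_rpow_of_nonpos hc h1 hs]

lemma bddMeas_one_add_rpow {ψ : Ω → ℝ} (hψ : BddMeas ψ) (h0 : ∀ ω, 0 ≤ ψ ω) (s : ℝ) :
    BddMeas fun ω => (1 + ψ ω) ^ s := by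
  obtain ⟨hm, C, hC⟩ := hψ
  refine ⟨(hm.const_add 1).pow_const s, 1 ^ s + (1 + C) ^ s, fun ω => ?_⟩
  have := h0 ω
  rw [abs_of_nonneg (by positivity)]
  exact rpow_le_rpow_add_rpow one_pos (by linarith) (by linarith [(abs_le.1 (hC ω)).2]) s

/-- A uniformly bounded family with weak limits `0` and `ψ²` of itself and its square. -/
lemma cltFamily_of_bounded {μ : Measure Ω} [IsFiniteMeasure μ] {ι : Type*} {𝓕 : Filter ι} {r K : ℝ}
    (hr : 0 < r) {z : ι → Ω → ℝ} {ψ : Ω → ℝ} (hz : ∀ i, Measurable (z i)) (hK : ∀ i ω, |z i ω| ≤ K)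
    (hψ : BddMeas ψ) (h0 : ∀ ω, 0 ≤ ψ ω)
    (hw : ∀ G, BddMeas G → Tendsto (fun i => ∫ ω, G ω * z i ω ∂μ) 𝓕 (𝓝 0))
    (hs : ∀ G, BddMeas G → Tendsto (fun i => ∫ ω, G ω * (z i ω ^ 2 - ψ ω ^ 2) ∂μ) 𝓕 (𝓝 0)) :
    CLTFamily μ r z ψ 𝓕 where
  bdd i := ⟨hz i, K, hK i⟩
  meas := hψ.1
  nonneg := h0
  int := (bddMeas_one_add_rpow hψ h0 r).integrable
  weak g hg := by
    refine (hw _ (hg.mul (bddMeas_one_add_rpow hψ h0 (r - 1)))).congr fun i => ?_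
    simp only [mul_assoc]
  weakSq g hg := by
    refine (hs _ (hg.mul (bddMeas_one_add_rpow hψ h0 (r - 2)))).congr fun i => ?_
    simp only [mul_assoc]
  bound _ := by
    refine ⟨∫ _, K ^ r ∂μ, Eventually.of_forall fun i => ?_⟩
    refine integral_mono_of_nonneg (Eventually.of_forall fun ω => by positivity)
      (integrable_const _) (Eventually.of_forall fun ω => ?_)
    exact Real.rpow_le_rpow (abs_nonneg _) (hK i ω) hr.le
  tail _ η hη := by
    refine ⟨K, Eventually.of_forall fun i => ?_⟩
    refine le_of_eq_of_le (integral_eq_zero_of_ae (Eventually.of_forall fun ω => ?_)) hη.le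
    exact if_neg (not_lt.2 (hK i ω))

lemma CLTFamily.comp_tendsto {μ : Measure Ω} {ι κ : Type*} {𝓕 : Filter ι} {𝓖 : Filter κ} {r : ℝ}
    {z : ι → Ω → ℝ} {ψ : Ω → ℝ} (h : CLTFamily μ r z ψ 𝓕) {g : κ → ι} (hg : Tendsto g 𝓖 𝓕) :
    CLTFamily μ r (fun i => z (g i)) ψ 𝓖 where
  bdd i := h.bdd _
  meas := h.meas
  nonneg := h.nonneg
  int := h.int
  weak G hG := (h.weak G hG).comp hg
  weakSq G hG := (h.weakSq G hG).comp hg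
  bound hr := by
    obtain ⟨C, hC⟩ := h.bound hr
    exact ⟨C, hg.eventually hC⟩
  tail hr η hη := by
    obtain ⟨C, hC⟩ := h.tail hr η hη
    exact ⟨C, hg.eventually hC⟩

variable {μ : Measure Ω} [IsFiniteMeasure μ] {U : Ultrafilter ℕ} {p D : ℝ} {v f : ℕ → Ω → ℝ}
  {φ : Ω → ℝ}

/-- The weight `φ ^ (p - 2)` restricted to the set where `φ` is bounded above and below. -/
noncomputable def cutWeight (φ : Ω → ℝ) (p : ℝ) (M : ℕ) (ω : Ω) : ℝ :=
  if (M : ℝ)⁻¹ ≤ φ ω ∧ φ ω ≤ M then φ ω ^ (p - 2) else 0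

lemma cutWeight_nonneg (h0 : ∀ ω, 0 ≤ φ ω) (M : ℕ) (ω : Ω) : 0 ≤ cutWeight φ p M ω := by
  have := h0 ω
  unfold cutWeight
  split_ifs <;> positivity

lemma bddMeas_cutWeight (hm : Measurable φ) {M : ℕ} (hM : 0 < M) : BddMeas (cutWeight φ p M) := by
  have hM0 : (0 : ℝ) < M := by exact_mod_cast hM
  refine ⟨Measurable.ite ((measurableSet_le measurable_const hm).inter
    (measurableSet_le hm measurable_const)) (hm.pow_const _) measurable_const,
    (M : ℝ)⁻¹ ^ (p - 2) + (M : ℝ) ^ (p - 2), fun ω => ?_⟩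
  unfold cutWeight
  split_ifs with h
  · have : 0 < φ ω := (inv_pos.2 hM0).trans_le h.1
    rw [abs_of_nonneg (by positivity)]
    exact rpow_le_rpow_add_rpow (inv_pos.2 hM0) h.1 h.2 _
  · rw [abs_zero]
    positivity

lemma cutWeight_mul_sq_le (h0 : ∀ ω, 0 ≤ φ ω) {M : ℕ} (hM : 0 < M) (ω : Ω) :
    cutWeight φ p M ω * φ ω ^ 2 ≤ φ ω ^ p := by
  have hM0 : (0 : ℝ) < M := by exact_mod_cast hM
  unfold cutWeight
  split_ifs with h
  · have : 0 < φ ω := (inv_pos.2 hM0).trans_le h.1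
    rw [← Real.rpow_natCast, ← Real.rpow_add this]
    simp
  · rw [zero_mul]
    exact Real.rpow_nonneg (h0 ω) _

lemma cutWeight_mul_le (h0 : ∀ ω, 0 ≤ φ ω) {M : ℕ} (hM : 0 < M) (ω : Ω) :
    cutWeight φ p M ω * φ ω ≤ φ ω ^ (p - 1) := by
  have hM0 : (0 : ℝ) < M := by exact_mod_cast hM
  unfold cutWeight
  split_ifs with h
  · have : 0 < φ ω := (inv_pos.2 hM0).trans_le h.1
    rw [← Real.rpow_add_one this.ne']
    ring_nf
    exact le_rfl
  · rw [zero_mul]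
    exact Real.rpow_nonneg (h0 ω) _

namespace WeakSeq

lemma tendsto_integral_cutWeight (h : WeakSeq μ U p D v f φ) (hp : 1 < p) :
    Tendsto (fun M => ∫ ω, cutWeight φ p M ω * f M ω ∂μ) atTop (𝓝 (∫ ω, φ ω ^ p ∂μ)) := by
  refine tendsto_integral_filter_of_dominated_convergence (fun ω => φ ω ^ p) ?_ ?_ h.φint ?_
  · filter_upwards [eventually_gt_atTop 0] with M hM
    exact ((bddMeas_cutWeight h.meas hM).1.mul (h.sq.meas M)).aestronglyMeasurable
  · filter_upwards [eventually_gt_atTop 0] with M hM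
    filter_upwards [h.le] with ω hω
    rw [Real.norm_eq_abs, abs_of_nonneg (mul_nonneg (cutWeight_nonneg h.nonneg M ω)
      (h.sq.nonneg M ω))]
    exact (mul_le_mul_of_nonneg_left (hω M) (cutWeight_nonneg h.nonneg M ω)).trans
      (cutWeight_mul_sq_le h.nonneg hM ω)
  · filter_upwards [h.lim] with ω hω
    rcases (h.nonneg ω).eq_or_lt with h0 | h0
    · rw [← h0, Real.zero_rpow (by linarith)]
      refine tendsto_const_nhds.congr' ?_
      filter_upwards [eventually_gt_atTop 0] with M hM
      have hM0 : (0 : ℝ) < M := by exact_mod_cast hM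
      rw [cutWeight, if_neg, zero_mul]
      rw [← h0]
      exact fun hc => (inv_pos.2 hM0).not_ge hc.1
    · have hlim := (hω.const_mul (φ ω ^ (p - 2)))
      have e : φ ω ^ (p - 2) * φ ω ^ 2 = φ ω ^ p := by
        rw [← Real.rpow_natCast, ← Real.rpow_add h0]
        simp
      rw [e] at hlim
      refine hlim.congr' ?_
      have l1 := tendsto_natCast_atTop_atTop (R := ℝ)
      filter_upwards [l1.eventually_ge_atTop (φ ω), l1.eventually_ge_atTop (φ ω)⁻¹] with M h1 h2
      rw [cutWeight, if_pos ⟨inv_le_of_inv_le₀ h0 h2, h1⟩]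

/-- A biorthogonal-type family in the dual exponent. -/
theorem exists_dual (h : WeakSeq μ U p D v f φ) (hp : 1 < p) {δ : ℝ} (hδ : 0 < δ) :
    ∃ (z : ℕ → Ω → ℝ) (ψ : Ω → ℝ) (Λ : ℝ), CLTFamily μ (p / (p - 1)) z ψ U ∧
      ∫ ω, ψ ω ^ (p / (p - 1)) ∂μ ≤ ∫ ω, φ ω ^ p ∂μ ∧
      (∫ ω, φ ω ^ p ∂μ) - δ ≤ Λ ∧
      (∀ m, Tendsto (fun n => ∫ ω, z m ω * v n ω ∂μ) U (𝓝 0)) ∧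
      (∀ n, Tendsto (fun m => ∫ ω, z m ω * v n ω ∂μ) U (𝓝 0)) ∧
      Tendsto (fun n => ∫ ω, z n ω * v n ω ∂μ) U (𝓝 Λ) := by
  have hp0 : 0 < p := by linarith
  have hp1 : 0 < p - 1 := by linarith
  have hq : 0 < p / (p - 1) := by positivity
  obtain ⟨M, hM1, hM⟩ := (((h.tendsto_integral_cutWeight hp).eventually_const_lt
    (sub_lt_self _ hδ)).and (eventually_gt_atTop 0)).exists
  set W := cutWeight φ p M with hWdef
  have hW : BddMeas W := bddMeas_cutWeight h.meas hM
  have hW0 : ∀ ω, 0 ≤ W ω := cutWeight_nonneg h.nonneg M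
  obtain ⟨C, hC⟩ := hW.2
  have ht : ∀ n, BddMeas (truncAt v n M) := fun n => bddMeas_truncAt h.vmeas n M
  have hfb : BddMeas (f M) := ⟨h.sq.meas M, (M : ℝ) ^ 2, fun ω => by
    rw [abs_of_nonneg (h.sq.nonneg M ω)]; exact h.sq.le M ω⟩
  have hgb : ∀ n ω, |W ω * truncAt v n M ω| ≤ |C| * M := fun n ω => by
    rw [abs_mul]
    exact mul_le_mul ((hC ω).trans (le_abs_self C)) (abs_truncAt_le v n M ω) (abs_nonneg _)
      (abs_nonneg _)
  obtain ⟨g, hgm, hgC, hgl⟩ := exists_weak_limit μ U (u := fun n ω => W ω * truncAt v n M ω)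
    (fun n => hW.1.mul (ht n).1) (C := |C| * M) (by positivity) hgb
  have hg : BddMeas g := ⟨hgm, _, hgC⟩
  have hG : ∀ n, BddMeas fun ω => W ω * truncAt v n M ω := fun n => hW.mul (ht n)
  set z : ℕ → Ω → ℝ := fun n ω => W ω * truncAt v n M ω - g ω with hz
  have hzb : ∀ n, BddMeas (z n) := fun n => (hG n).sub hg
  set ψ : Ω → ℝ := fun ω => √(W ω ^ 2 * f M ω - g ω ^ 2) with hψ
  have hwk : ∀ G, Integrable G μ → Tendsto (fun n => ∫ ω, G ω * z n ω ∂μ) U (𝓝 0) := fun G hGi => by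
    have := (hgl G hGi).sub_const (∫ ω, G ω * g ω ∂μ)
    rw [sub_self] at this
    refine this.congr fun n => ?_
    rw [← integral_sub]
    · simp only [hz, mul_sub]
    · simpa only [mul_comm] using (hG n).integrable_mul hGi
    · simpa only [mul_comm] using hg.integrable_mul hGi
  have hsq : ∀ G, BddMeas G → Tendsto (fun n => ∫ ω, G ω * z n ω ^ 2 ∂μ) U
      (𝓝 (∫ ω, G ω * (W ω ^ 2 * f M ω - g ω ^ 2) ∂μ)) := fun G hGb => by
    have l1 := h.sq.lim M (fun ω => G ω * W ω ^ 2) (hGb.mul (hW.pow 2)).integrable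
    have l2 := hwk (fun ω => G ω * g ω) (hGb.mul hg).integrable
    have l3 := (l1.sub (l2.const_mul 2)).sub_const (∫ ω, G ω * g ω ^ 2 ∂μ)
    have i1 : ∀ n, Integrable (fun ω => G ω * W ω ^ 2 * truncAt v n M ω ^ 2) μ := fun n =>
      ((hGb.mul (hW.pow 2)).mul ((ht n).pow 2)).integrable
    have i2 : ∀ n, Integrable (fun ω => G ω * g ω * z n ω) μ := fun n =>
      ((hGb.mul hg).mul (hzb n)).integrable
    have i3 : Integrable (fun ω => G ω * g ω ^ 2) μ := (hGb.mul (hg.pow 2)).integrable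
    have i4 : Integrable (fun ω => G ω * W ω ^ 2 * f M ω) μ :=
      ((hGb.mul (hW.pow 2)).mul hfb).integrable
    have e : (∫ ω, G ω * W ω ^ 2 * f M ω ∂μ) - 2 * 0 - (∫ ω, G ω * g ω ^ 2 ∂μ) =
        ∫ ω, G ω * (W ω ^ 2 * f M ω - g ω ^ 2) ∂μ := by
      rw [mul_zero, sub_zero, ← integral_sub i4 i3]
      congr 1; ext ω; ring
    rw [e] at l3
    refine l3.congr fun n => ?_
    rw [← integral_const_mul, ← integral_sub (i1 n) ((i2 n).const_mul 2),
      ← integral_sub (f := fun ω => G ω * W ω ^ 2 * truncAt v n M ω ^ 2 - 2 * (G ω * g ω * z n ω))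
        ((i1 n).sub ((i2 n).const_mul 2)) i3]
    congr 1; ext ω
    simp only [hz]
    ring
  have hdb : BddMeas fun ω => W ω ^ 2 * f M ω - g ω ^ 2 := ((hW.pow 2).mul hfb).sub (hg.pow 2)
  have hnn : ∀ᵐ ω ∂μ, 0 ≤ W ω ^ 2 * f M ω - g ω ^ 2 := by
    refine ae_nonneg_of_forall_setIntegral_nonneg hdb.integrable fun s hs _ => ?_
    have hsb : BddMeas (s.indicator fun _ : Ω => (1 : ℝ)) :=
      ⟨measurable_const.indicator hs, 1, fun ω => by by_cases hω : ω ∈ s <;> simp [hω]⟩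
    have l := hsq _ hsb
    rw [integral_indicator_one_mul hs] at l
    refine ge_of_tendsto l (Eventually.of_forall fun n => ?_)
    rw [integral_indicator_one_mul hs]
    exact integral_nonneg fun ω => sq_nonneg _
  have hψsq : ∀ᵐ ω ∂μ, ψ ω ^ 2 = W ω ^ 2 * f M ω - g ω ^ 2 := by
    filter_upwards [hnn] with ω hω
    exact Real.sq_sqrt hω
  have hψ0 : ∀ ω, 0 ≤ ψ ω := fun ω => Real.sqrt_nonneg _
  have hψb : BddMeas ψ := by
    obtain ⟨hm, K, hK⟩ := hdb
    refine ⟨hm.sqrt, √K, fun ω => ?_⟩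
    rw [abs_of_nonneg (hψ0 ω)]
    exact Real.sqrt_le_sqrt ((le_abs_self _).trans (hK ω))
  have hψle : ∀ᵐ ω ∂μ, ψ ω ^ (p / (p - 1)) ≤ φ ω ^ p := by
    filter_upwards [h.le] with ω hω
    have h1 : ψ ω ≤ φ ω ^ (p - 1) := by
      refine le_trans ?_ (cutWeight_mul_le h.nonneg hM ω)
      refine Real.sqrt_le_iff.2 ⟨mul_nonneg (hW0 ω) (h.nonneg ω), ?_⟩
      rw [mul_pow]
      have := mul_le_mul_of_nonneg_left (hω M) (sq_nonneg (W ω))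
      linarith [sq_nonneg (g ω)]
    refine (Real.rpow_le_rpow (hψ0 ω) h1 hq.le).trans_eq ?_
    rw [← Real.rpow_mul (h.nonneg ω), mul_div_cancel₀ _ hp1.ne']
  have hvint : ∀ n, Integrable (v n) μ := fun n =>
    (memLp_of_integrable_abs_rpow (h.vmeas n) hp0 (h.int n)).integrable
      (by rw [ENNReal.one_le_ofReal]; exact hp.le)
  have hwv : ∀ G, BddMeas G → Tendsto (fun n => ∫ ω, G ω * v n ω ∂μ) U (𝓝 0) := fun G hGb => by
    refine h.weak G hGb.1 ?_
    obtain ⟨hm, K, hK⟩ := hGb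
    refine Integrable.of_bound (hm.abs.pow_const _).aestronglyMeasurable (K ^ (p / (p - 1)))
      (Eventually.of_forall fun ω => ?_)
    rw [Real.norm_eq_abs, abs_of_nonneg (by positivity)]
    exact Real.rpow_le_rpow (abs_nonneg _) (hK ω) hq.le
  refine ⟨z, ψ, ∫ ω, W ω * f M ω ∂μ, ?_, ?_, hM1.le, fun m => hwv _ (hzb m), fun n => ?_, ?_⟩
  · refine cltFamily_of_bounded hq (K := |C| * M + |C| * M) (fun n => (hzb n).1) (fun n ω => ?_) hψb
      hψ0 (fun G hGb => hwk G hGb.integrable) fun G hGb => ?_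
    · exact (abs_sub _ _).trans (add_le_add (hgb n ω) (hgC ω))
    · have l := (hsq G hGb).sub_const (∫ ω, G ω * (W ω ^ 2 * f M ω - g ω ^ 2) ∂μ)
      rw [sub_self] at l
      refine l.congr fun n => ?_
      rw [← integral_sub (hGb.mul ((hzb n).pow 2)).integrable (hGb.mul hdb).integrable]
      refine integral_congr_ae ?_
      filter_upwards [hψsq] with ω hω
      rw [hω]
      ring
  · exact integral_mono_of_nonneg (Eventually.of_forall fun ω => Real.rpow_nonneg (hψ0 ω) _)
      h.φint hψle
  · refine (hwk _ (hvint n)).congr fun m => ?_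
    simp only [mul_comm]
  · have l := (h.sq.lim M W hW.integrable).sub (hwv g hg)
    rw [sub_zero] at l
    refine l.congr fun n => ?_
    rw [← integral_sub (hW.mul ((ht n).pow 2)).integrable (hg.integrable_mul (hvint n))]
    congr 1; ext ω
    have : truncAt v n M ω ^ 2 = truncAt v n M ω * v n ω := by
      unfold truncAt
      split_ifs
      · ring
      · simp
    rw [this]
    simp only [hz]
    ring

end WeakSeq

end Stabilization

section Stabilization

open Filter Topology

variable {Ω : Type*} [MeasurableSpace Ω]

lemma norm_sum_smul_toLp_rpow {μ : Measure Ω} {r : ℝ} [Fact (1 ≤ ENNReal.ofReal r)] (hr : 0 < r)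
    {κ : Type*} {u : κ → Ω → ℝ} (hu : ∀ k, MemLp (u k) (ENNReal.ofReal r) μ) (s : Finset κ)
    (a : κ → ℝ) :
    ‖∑ k ∈ s, a k • (hu k).toLp (u k)‖ ^ r = ∫ ω, |∑ k ∈ s, a k * u k ω| ^ r ∂μ := by
  rw [norm_rpow_Lp hr]
  refine integral_congr_ae ?_
  have hall : ∀ᵐ ω ∂μ, ∀ k ∈ s, (a k • (hu k).toLp (u k) : Lp ℝ (ENNReal.ofReal r) μ) ω =
      a k * u k ω := by
    refine (Finset.eventually_all s).2 fun k _ => ?_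
    filter_upwards [Lp.coeFn_smul (a k) ((hu k).toLp (u k)), (hu k).coeFn_toLp] with ω h1 h2
    rw [h1, Pi.smul_apply, smul_eq_mul, h2]
  filter_upwards [hall, Lp.coeFn_finsetSum s fun k => a k • (hu k).toLp (u k)] with ω h1 h2
  rw [h2, Finset.sum_apply, Finset.sum_congr rfl h1]

lemma FlatMoments.norm {μ : Measure Ω} {r c : ℝ} [Fact (1 ≤ ENNReal.ofReal r)] (hr : 0 < r)
    {ι : Type*} {𝓕 : Filter ι} {z : ι → Ω → ℝ} (h : FlatMoments μ r z 𝓕 c)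
    (hz : ∀ i, MemLp (z i) (ENNReal.ofReal r) μ) {ε : ℝ} (hε : 0 < ε) :
    ∃ τ > 0, ∃ St : (k : ℕ) → (Fin k → ι) → ι → Prop, (∀ k f, ∀ᶠ i in 𝓕, St k f i) ∧
      ∀ x : ℕ → ι, (∀ k, St k (fun j => x j) (x k)) → ∀ (N : ℕ) (a : ℕ → ℝ),
        ∑ k ∈ Finset.range N, a k ^ 2 = 1 → (∀ k, |a k| ≤ τ) →
        |‖∑ k ∈ Finset.range N, a k • (hz (x k)).toLp (z (x k))‖ - c ^ (1 / r)| ≤ ε := by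
  have hct : ContinuousAt (fun y : ℝ => y ^ (1 / r)) c :=
    Real.continuousAt_rpow_const _ _ (Or.inr (by positivity))
  obtain ⟨η, hη, hball⟩ := Metric.continuousAt_iff.1 hct ε hε
  obtain ⟨τ, hτ, St, hSt, hx⟩ := h (η / 2) (by positivity)
  refine ⟨τ, hτ, St, hSt, fun x hxs N a ha hat => ?_⟩
  have h1 := hx x hxs N a ha hat
  rw [← norm_sum_smul_toLp_rpow hr (fun k => hz (x k))] at h1
  have h2 := hball (x := ‖∑ k ∈ Finset.range N, a k • (hz (x k)).toLp (z (x k))‖ ^ r)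
    (by rw [Real.dist_eq]; linarith)
  rw [Real.dist_eq, ← Real.rpow_mul (norm_nonneg _), mul_one_div_cancel hr.ne', Real.rpow_one] at h2
  exact h2.le

lemma BddMeas.memLp {μ : Measure Ω} [IsFiniteMeasure μ] {g : Ω → ℝ} (hg : BddMeas g) (r : ℝ≥0∞) :
    MemLp g r μ := by
  obtain ⟨hm, C, hC⟩ := hg
  exact MemLp.of_bound hm.aestronglyMeasurable C (Eventually.of_forall hC)

lemma sum_mul_geometric_le {δ : ℝ} (hδ : 0 ≤ δ) (N : ℕ) {b : ℕ → ℝ}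
    (hb : ∀ k, b k ≤ δ * (1 / 2) ^ k) : ∑ k ∈ Finset.range N, b k ≤ 2 * δ := by
  refine (Finset.sum_le_sum fun k _ => hb k).trans ?_
  rw [← Finset.mul_sum]
  have := Summable.sum_le_tsum (Finset.range N) (fun k _ => by positivity) summable_geometric_two
  rw [tsum_geometric_two] at this
  nlinarith

variable {μ : Measure Ω} [IsFiniteMeasure μ] {p : ℝ} [Fact (1 ≤ ENNReal.ofReal p)]
  [Fact (1 ≤ ENNReal.ofReal (p / (p - 1)))]

/-- A subsequence of the unit vectors on which `T` has flat combinations of nearly constant norm,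
together with a nearly biorthogonal sequence in the dual exponent. -/
theorem exists_flat_selection (hp : 1 < p) (hp2 : p ≠ 2)
    (T : ell2 →L[ℝ] Lp ℝ (ENNReal.ofReal p) μ) {B : ℝ} (hB : 0 ≤ B) (hT : ∀ w, ‖T w‖ ≤ B * ‖w‖) :
    ∃ Φ : ℝ, 0 ≤ Φ ∧ ∀ δ > 0, ∃ (Λ : ℝ) (n : ℕ → ℕ) (H : ℕ → Lp ℝ (ENNReal.ofReal (p / (p - 1))) μ)
      (τ : ℝ), Φ - δ ≤ Λ ∧ StrictMono n ∧ 0 < τ ∧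
      (∀ (N : ℕ) (a : ℕ → ℝ), ∑ k ∈ Finset.range N, a k ^ 2 = 1 → (∀ k, |a k| ≤ τ) →
        |‖∑ k ∈ Finset.range N, a k • T (unitVec (n k))‖ - (gaussMoment p * Φ) ^ (1 / p)| ≤ δ ∧
        ‖∑ k ∈ Finset.range N, a k • H k‖ ≤
          (gaussMoment (p / (p - 1)) * Φ) ^ (1 / (p / (p - 1))) + δ) ∧
      ∀ k l, |(∫ ω, H k ω * T (unitVec (n l)) ω ∂μ) - if k = l then Λ else 0| ≤
        δ * (1 / 2) ^ k * (1 / 2) ^ l := by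
  have hp0 : 0 < p := by linarith
  have hp1 : 0 < p - 1 := by linarith
  have hq0 : 0 < p / (p - 1) := by positivity
  have hq1 : 1 < p / (p - 1) := by rw [one_lt_div hp1]; linarith
  have hq2 : p / (p - 1) ≠ 2 := fun hc => hp2 (by
    rw [div_eq_iff hp1.ne'] at hc
    linarith)
  obtain ⟨f, φ, D, 𝓕, hw, hF⟩ := exists_goodTruncation hp hp2 T hB hT
  have := hF.neBot
  have hΦ0 : 0 ≤ ∫ ω, φ ω ^ p ∂μ := integral_nonneg fun ω => Real.rpow_nonneg (hw.nonneg ω) _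
  refine ⟨∫ ω, φ ω ^ p ∂μ, hΦ0, fun δ hδ => ?_⟩
  set v : ℕ → Ω → ℝ := fun n => T (unitVec n) with hv
  obtain ⟨z, ψ, Λ, hcz, hψ, hΛ, hz1, hz2, hz3⟩ := hw.exists_dual hp hδ
  have htm : ∀ i : ℕ × ℕ, MemLp (truncAt v i.1 i.2) (ENNReal.ofReal p) μ := fun i =>
    (bddMeas_truncAt hw.vmeas i.1 i.2).memLp _
  have hzm : ∀ i : ℕ × ℕ, MemLp (z i.1) (ENNReal.ofReal (p / (p - 1))) μ := fun i =>
    (hcz.bdd i.1).memLp _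
  obtain ⟨τ₁, hτ₁, S₁, hS₁, hx₁⟩ := (hF.clt.flatMoments hp hp2).norm hp0 htm (half_pos hδ)
  obtain ⟨τ₂, hτ₂, S₂, hS₂, hx₂⟩ := ((hcz.comp_tendsto hF.fst).flatMoments hq1 hq2).norm hq0 hzm hδ
  set d : ℕ → ℝ := fun k => δ / 4 * (1 / 2) ^ k with hd
  have hd0 : ∀ k, 0 < d k := fun k => by positivity
  have hsmall : ∀ {g : ℕ → ℝ} {c : ℝ}, Tendsto g (hyperfilter ℕ) (𝓝 c) → ∀ k : ℕ,
      ∀ᶠ i in 𝓕, |g i.1 - c| ≤ δ * (1 / 4) ^ k := fun hg k => by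
    have := hF.fst.eventually (Metric.tendsto_nhds.1 hg (δ * (1 / 4) ^ k) (by positivity))
    filter_upwards [this] with i hi
    rw [Real.dist_eq] at hi
    exact hi.le
  have hlarge : ∀ m : ℕ, ∀ᶠ i in 𝓕, m < i.1 := fun m =>
    hF.fst.eventually
      (Filter.hyperfilter_le_cofinite (Nat.cofinite_eq_atTop ▸ eventually_gt_atTop m))
  let St : (k : ℕ) → (Fin k → ℕ × ℕ) → ℕ × ℕ → Prop := fun k g i =>
    S₁ k g i ∧ S₂ k g i ∧ ∫ ω, |v i.1 ω - truncAt v i.1 i.2 ω| ^ p ∂μ ≤ d k ^ p ∧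
      (∀ j, (g j).1 < i.1) ∧ |(∫ ω, z i.1 ω * v i.1 ω ∂μ) - Λ| ≤ δ * (1 / 4) ^ k ∧
      (∀ j, |(∫ ω, z (g j).1 ω * v i.1 ω ∂μ) - 0| ≤ δ * (1 / 4) ^ k) ∧
      ∀ j, |(∫ ω, z i.1 ω * v (g j).1 ω ∂μ) - 0| ≤ δ * (1 / 4) ^ k
  have hSt : ∀ k g, ∀ᶠ i in 𝓕, St k g i := fun k g => by
    filter_upwards [hS₁ k g, hS₂ k g, hF.approx (d k ^ p) (Real.rpow_pos_of_pos (hd0 k) p),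
      eventually_all.2 fun j => hlarge (g j).1, hsmall hz3 k,
      eventually_all.2 fun j => hsmall (hz1 (g j).1) k,
      eventually_all.2 fun j => hsmall (hz2 (g j).1) k] with i h1 h2 h3 h4 h5 h6 h7
    exact ⟨h1, h2, h3, h4, h5, h6, h7⟩
  obtain ⟨x, hx⟩ := exists_seq_of_forall_exists fun k g => (hSt k g).exists
  have hcoe : ∀ k, (hzm (x k)).toLp (z (x k).1) =ᵐ[μ] z (x k).1 := fun k => (hzm (x k)).coeFn_toLp
  have hpair : ∀ k l, ∫ ω, (hzm (x k)).toLp (z (x k).1) ω * T (unitVec (x l).1) ω ∂μ =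
      ∫ ω, z (x k).1 ω * v (x l).1 ω ∂μ := fun k l => by
    refine integral_congr_ae ?_
    filter_upwards [hcoe k] with ω h
    rw [h]
  have hclose : ∀ k, ‖T (unitVec (x k).1) - (htm (x k)).toLp (truncAt v (x k).1 (x k).2)‖ ≤ d k :=
    fun k => by
      have h3 := (hx k).2.2.1
      rw [← Real.rpow_le_rpow_iff (norm_nonneg _) (hd0 k).le hp0, norm_rpow_Lp hp0]
      refine le_of_eq_of_le (integral_congr_ae ?_) h3
      filter_upwards [Lp.coeFn_sub (T (unitVec (x k).1))
        ((htm (x k)).toLp (truncAt v (x k).1 (x k).2)), (htm (x k)).coeFn_toLp] with ω h1 h2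
      rw [h1, Pi.sub_apply, h2]
  refine ⟨Λ, fun k => (x k).1, fun k => (hzm (x k)).toLp (z (x k).1), min (min τ₁ τ₂) 1, hΛ,
    strictMono_nat_of_lt_succ fun k => (hx (k + 1)).2.2.2.1 (Fin.last k), by positivity,
    fun N a ha hat => ⟨?_, ?_⟩, fun k l => ?_⟩
  · have h1 := hx₁ x (fun k => (hx k).1) N a ha fun k =>
      (hat k).trans ((min_le_left _ _).trans (min_le_left _ _))
    set y := ∑ k ∈ Finset.range N, a k • (htm (x k)).toLp (truncAt v (x k).1 (x k).2)
    have h2 : ‖(∑ k ∈ Finset.range N, a k • T (unitVec (x k).1)) - y‖ ≤ 2 * (δ / 4) := by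
      rw [← Finset.sum_sub_distrib]
      refine (norm_sum_le _ _).trans (sum_mul_geometric_le (by positivity) N fun k => ?_)
      rw [← smul_sub, norm_smul, Real.norm_eq_abs]
      calc |a k| * _ ≤ 1 * d k := mul_le_mul ((hat k).trans (min_le_right _ _)) (hclose k)
            (norm_nonneg _) zero_le_one
        _ = _ := one_mul _
    have h3 := (abs_norm_sub_norm_le _ _).trans h2
    rw [abs_le] at h1 h3 ⊢
    constructor <;> linarith
  · have h1 := hx₂ x (fun k => (hx k).2.1) N a ha fun k =>
      (hat k).trans ((min_le_left _ _).trans (min_le_right _ _))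
    have h2 : (gaussMoment (p / (p - 1)) * ∫ ω, ψ ω ^ (p / (p - 1)) ∂μ) ^ (1 / (p / (p - 1))) ≤
        (gaussMoment (p / (p - 1)) * ∫ ω, φ ω ^ p ∂μ) ^ (1 / (p / (p - 1))) := by
      have := gaussMoment_nonneg (p / (p - 1))
      have h0 : 0 ≤ ∫ ω, ψ ω ^ (p / (p - 1)) ∂μ :=
        integral_nonneg fun ω => Real.rpow_nonneg (hcz.nonneg ω) _
      gcongr
    linarith [(abs_le.1 h1).2]
  · simp only [hpair]
    have hpow : ∀ {k l : ℕ}, l ≤ k → δ * (1 / 4) ^ k ≤ δ * (1 / 2) ^ k * (1 / 2) ^ l :=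
      fun {k l} hlk => by
        rw [mul_assoc]
        refine mul_le_mul_of_nonneg_left ?_ hδ.le
        rw [show (1 / 4 : ℝ) = 1 / 2 * (1 / 2) by norm_num, mul_pow]
        exact mul_le_mul_of_nonneg_left
          (pow_le_pow_of_le_one (by norm_num) (by norm_num) hlk) (by positivity)
    rcases lt_trichotomy k l with h | h | h
    · rw [if_neg h.ne, mul_right_comm]
      exact ((hx l).2.2.2.2.2.1 ⟨k, h⟩).trans (hpow h.le)
    · rw [if_pos h]
      subst h
      exact (hx k).2.2.2.2.1.trans (hpow le_rfl)
    · rw [if_neg h.ne']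
      exact ((hx k).2.2.2.2.2.2 ⟨l, h⟩).trans (hpow h.le)

end Stabilization

section Stabilization

open Filter Topology

lemma sum_range_mul_eq {M : Type*} [AddCommMonoid M] (F : ℕ → M) (N m : ℕ) :
    ∑ k ∈ Finset.range (N * m), F k =
      ∑ l ∈ Finset.range N, ∑ i ∈ Finset.range m, F (l * m + i) := by
  induction N with
  | zero => simp
  | succ N ih => rw [Nat.succ_mul, Finset.sum_range_add, ih, Finset.sum_range_succ]

/-- The normalised sum of the `l`-th block of `m` consecutive terms of a sequence. -/
noncomputable def block {E : Type*} [AddCommGroup E] [Module ℝ E] (w : ℕ → E) (m l : ℕ) : E :=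
  (√(m : ℝ))⁻¹ • ∑ i ∈ Finset.range m, w (l * m + i)

section Block

variable {E F : Type*} [AddCommGroup E] [Module ℝ E] [AddCommGroup F] [Module ℝ F] {m : ℕ}

lemma map_block (f : E →ₗ[ℝ] F) (w : ℕ → E) (l : ℕ) : f (block w m l) = block (fun k => f (w k)) m l := by
  simp [block, map_sum]

lemma block_index_div (hm : 0 < m) (l : ℕ) {i : ℕ} (hi : i < m) : (l * m + i) / m = l := by
  rw [mul_comm, Nat.mul_add_div hm, Nat.div_eq_of_lt hi, add_zero]

lemma sum_smul_block (hm : 0 < m) (w : ℕ → E) (b : ℕ → ℝ) (N : ℕ) :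
    ∑ l ∈ Finset.range N, b l • block w m l =
      ∑ k ∈ Finset.range (N * m), (b (k / m) * (√(m : ℝ))⁻¹) • w k := by
  rw [sum_range_mul_eq]
  refine Finset.sum_congr rfl fun l _ => ?_
  rw [block, smul_smul, Finset.smul_sum]
  refine Finset.sum_congr rfl fun i hi => ?_
  rw [block_index_div hm l (Finset.mem_range.1 hi)]

lemma sum_block_coeff_sq (hm : 0 < m) (b : ℕ → ℝ) (N : ℕ) :
    ∑ k ∈ Finset.range (N * m), (b (k / m) * (√(m : ℝ))⁻¹) ^ 2 = ∑ l ∈ Finset.range N, b l ^ 2 := by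
  rw [sum_range_mul_eq]
  refine Finset.sum_congr rfl fun l _ => ?_
  have h : ∀ i ∈ Finset.range m, (b ((l * m + i) / m) * (√(m : ℝ))⁻¹) ^ 2 = b l ^ 2 * (m : ℝ)⁻¹ := by
    intro i hi
    rw [block_index_div hm l (Finset.mem_range.1 hi), mul_pow, inv_pow, Real.sq_sqrt m.cast_nonneg]
  rw [Finset.sum_congr rfl h, Finset.sum_const, Finset.card_range, nsmul_eq_mul]
  have : (m : ℝ) ≠ 0 := by positivity
  field_simp

/-- An estimate for flat coefficients gives one for all normalised coefficients of blocks. -/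
lemma block_of_flat (hm : 0 < m) {τ : ℝ} (hτ : (√(m : ℝ))⁻¹ ≤ τ) {w : ℕ → E} {Q : E → Prop}
    (h : ∀ (N : ℕ) (a : ℕ → ℝ), ∑ k ∈ Finset.range N, a k ^ 2 = 1 → (∀ k, |a k| ≤ τ) →
      Q (∑ k ∈ Finset.range N, a k • w k))
    (N : ℕ) (b : ℕ → ℝ) (hb : ∑ l ∈ Finset.range N, b l ^ 2 = 1) :
    Q (∑ l ∈ Finset.range N, b l • block w m l) := by
  set c : ℕ → ℝ := fun l => if l < N then b l else 0 with hc
  have hcb : ∀ l ∈ Finset.range N, c l = b l := fun l hl => if_pos (Finset.mem_range.1 hl)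
  have h1 : ∑ l ∈ Finset.range N, b l • block w m l = ∑ l ∈ Finset.range N, c l • block w m l :=
    Finset.sum_congr rfl fun l hl => by rw [hcb l hl]
  have h2 : ∑ l ∈ Finset.range N, c l ^ 2 = 1 := by
    rw [← hb]
    exact Finset.sum_congr rfl fun l hl => by rw [hcb l hl]
  have h3 : ∀ l, |c l| ≤ 1 := fun l => by
    by_cases hl : l < N
    · rw [← sq_le_one_iff_abs_le_one, ← h2]
      exact Finset.single_le_sum (f := fun l => c l ^ 2) (fun _ _ => sq_nonneg _)
        (Finset.mem_range.2 hl)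
    · simp [hc, hl]
  rw [h1, sum_smul_block hm]
  refine h _ _ (by rw [sum_block_coeff_sq hm, h2]) fun k => ?_
  rw [abs_mul, abs_of_nonneg (by positivity : (0 : ℝ) ≤ (√(m : ℝ))⁻¹)]
  exact (mul_le_of_le_one_left (by positivity) (h3 _)).trans hτ

end Block

lemma block_geometric_le {m : ℕ} (hm : 0 < m) (l : ℕ) :
    block (fun k => (1 / 2 : ℝ) ^ k) m l ≤ 2 * (1 / 2) ^ l := by
  have h1 : (√(m : ℝ))⁻¹ ≤ 1 := inv_le_one_of_one_le₀ (Real.one_le_sqrt.2 (Nat.one_le_cast.2 hm))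
  have h2 : ∑ i ∈ Finset.range m, (1 / 2 : ℝ) ^ i ≤ 2 := by
    have := Summable.sum_le_tsum (Finset.range m) (fun i _ => by positivity) summable_geometric_two
    rwa [tsum_geometric_two] at this
  have h3 : ((1 : ℝ) / 2) ^ (l * m) ≤ (1 / 2) ^ l :=
    pow_le_pow_of_le_one (by norm_num) (by norm_num) (Nat.le_mul_of_pos_right l hm)
  rw [block, smul_eq_mul]
  simp only [pow_add]
  rw [← Finset.mul_sum]
  calc (√(m : ℝ))⁻¹ * ((1 / 2) ^ (l * m) * ∑ i ∈ Finset.range m, (1 / 2 : ℝ) ^ i)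
      ≤ 1 * ((1 / 2) ^ l * 2) := by gcongr
    _ = _ := by ring

lemma block_index_inj {m k l i j : ℕ} (hi : i < m) (hj : j < m) (h : k * m + i = l * m + j) :
    k = l ∧ i = j := by
  have hm : 0 < m := by omega
  have h1 := block_index_div hm k hi
  rw [h, block_index_div hm l hj] at h1
  subst h1
  exact ⟨rfl, by omega⟩

/-- Blocks in both variables of an almost diagonal matrix are almost diagonal. -/
lemma abs_block_block_sub_le {m : ℕ} (hm : 0 < m) {M : ℕ → ℕ → ℝ} {Λ δ : ℝ} (hδ : 0 ≤ δ)
    (h : ∀ k l, |M k l - if k = l then Λ else 0| ≤ δ * (1 / 2) ^ k * (1 / 2) ^ l) (k l : ℕ) :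
    |block (fun i => block (fun j => M i j) m l) m k - if k = l then Λ else 0| ≤
      4 * δ * (1 / 2) ^ k * (1 / 2) ^ l := by
  have hm0 : (m : ℝ) ≠ 0 := by positivity
  have hsq : (√(m : ℝ))⁻¹ * ((√(m : ℝ))⁻¹ * m) = 1 := by
    have : √(m : ℝ) ≠ 0 := by positivity
    field_simp
    rw [Real.sq_sqrt m.cast_nonneg]
  have hD : (if k = l then Λ else 0) =
      block (fun i => block (fun j => if i = j then Λ else 0) m l) m k := by
    simp only [block, smul_eq_mul, ← Finset.mul_sum]
    split_ifs with hkl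
    · subst hkl
      have : ∀ i ∈ Finset.range m,
          ∑ j ∈ Finset.range m, (if k * m + i = k * m + j then Λ else 0) = Λ := by
        intro i hi
        simp only [add_right_inj]
        rw [Finset.sum_ite_eq, if_pos hi]
      rw [Finset.sum_congr rfl this, Finset.sum_const, Finset.card_range, nsmul_eq_mul]
      linear_combination (-Λ) * hsq
    · rw [Finset.sum_eq_zero, mul_zero, mul_zero]
      intro i hi
      refine Finset.sum_eq_zero fun j hj => if_neg fun h => hkl ?_
      exact (block_index_inj (Finset.mem_range.1 hi) (Finset.mem_range.1 hj) h).1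
  have hkey : |block (fun i => block (fun j => M i j - if i = j then Λ else 0) m l) m k| ≤
      δ * (block (fun k => (1 / 2 : ℝ) ^ k) m k * block (fun k => (1 / 2 : ℝ) ^ k) m l) := by
    simp only [block, smul_eq_mul]
    rw [← Finset.mul_sum, abs_mul, abs_mul, abs_of_nonneg (by positivity : (0 : ℝ) ≤ (√(m : ℝ))⁻¹)]
    have : |∑ i ∈ Finset.range m, ∑ j ∈ Finset.range m,
        (M (k * m + i) (l * m + j) - if k * m + i = l * m + j then Λ else 0)| ≤
        ∑ i ∈ Finset.range m, ∑ j ∈ Finset.range m,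
          δ * (1 / 2) ^ (k * m + i) * (1 / 2) ^ (l * m + j) := by
      refine (Finset.abs_sum_le_sum_abs _ _).trans (Finset.sum_le_sum fun i _ => ?_)
      exact (Finset.abs_sum_le_sum_abs _ _).trans (Finset.sum_le_sum fun j _ => h _ _)
    calc _ ≤ (√(m : ℝ))⁻¹ * ((√(m : ℝ))⁻¹ * ∑ i ∈ Finset.range m, ∑ j ∈ Finset.range m,
          δ * (1 / 2) ^ (k * m + i) * (1 / 2) ^ (l * m + j)) := by gcongr
      _ = _ := by
        have : ∑ i ∈ Finset.range m, ∑ j ∈ Finset.range m,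
            δ * (1 / 2) ^ (k * m + i) * (1 / 2) ^ (l * m + j) =
            δ * ((∑ i ∈ Finset.range m, (1 / 2) ^ (k * m + i)) *
              ∑ j ∈ Finset.range m, (1 / 2) ^ (l * m + j)) := by
          rw [Finset.sum_mul_sum, Finset.mul_sum]
          refine Finset.sum_congr rfl fun i _ => ?_
          rw [Finset.mul_sum]
          exact Finset.sum_congr rfl fun j _ => mul_assoc _ _ _
        rw [this]
        ring
  have hsub : block (fun i => block (fun j => M i j) m l) m k - (if k = l then Λ else 0) =
      block (fun i => block (fun j => M i j - if i = j then Λ else 0) m l) m k := by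
    rw [hD]
    simp only [block, smul_eq_mul, Finset.sum_sub_distrib, mul_sub]
  rw [hsub]
  refine hkey.trans ?_
  have h0 : 0 ≤ block (fun k => (1 / 2 : ℝ) ^ k) m l := by
    rw [block, smul_eq_mul]
    exact mul_nonneg (by positivity) (Finset.sum_nonneg fun i _ => pow_nonneg (by norm_num) _)
  calc _ ≤ δ * ((2 * (1 / 2) ^ k) * (2 * (1 / 2) ^ l)) := by
        refine mul_le_mul_of_nonneg_left (mul_le_mul (block_geometric_le hm k)
          (block_geometric_le hm l) h0 (by positivity)) hδ
    _ = _ := by ring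

lemma inner_unitVec (i j : ℕ) : inner ℝ (unitVec i) (unitVec j) = if i = j then (1 : ℝ) else 0 := by
  rw [unitVec, lp.inner_single_left, unitVec, lp.single_apply]
  by_cases h : i = j
  · subst h; simp
  · simp [h]

lemma orthonormal_block_unitVec {n : ℕ → ℕ} (hn : StrictMono n) {m : ℕ} (hm : 0 < m) :
    Orthonormal ℝ fun l => block (fun k => unitVec (n k)) m l := by
  rw [orthonormal_iff_ite]
  intro k l
  have := abs_block_block_sub_le hm (M := fun i j => inner ℝ (unitVec (n i)) (unitVec (n j)))
    (Λ := 1) le_rfl (fun i j => by rw [inner_unitVec]; simp [hn.injective.eq_iff]) k l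
  simp only [mul_zero, zero_mul, abs_nonpos_iff, sub_eq_zero] at this
  rw [← this]
  simp only [block, real_inner_smul_left, real_inner_smul_right, sum_inner, inner_sum, smul_eq_mul,
    Finset.mul_sum]
  exact Finset.sum_comm

end Stabilization

section Stabilization

open Filter Topology

variable {Ω : Type*} [MeasurableSpace Ω] {μ : Measure Ω} {p : ℝ} [Fact (1 ≤ ENNReal.ofReal p)]

lemma exists_integral_pairing [Fact (1 ≤ ENNReal.ofReal (p / (p - 1)))] (hp : 1 < p) :
    ∃ L : Lp ℝ (ENNReal.ofReal (p / (p - 1))) μ →ₗ[ℝ] (Lp ℝ (ENNReal.ofReal p) μ →L[ℝ] ℝ),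
      (∀ h, ‖L h‖ ≤ ‖h‖) ∧ ∀ h f, L h f = ∫ ω, h ω * f ω ∂μ := by
  have hconj : p.HolderConjugate (p / (p - 1)) := Real.HolderConjugate.conjExponent hp
  have hc := hconj.symm.ennrealOfReal
  let L := ContinuousLinearMap.lpPairing μ (ENNReal.ofReal (p / (p - 1))) (ENNReal.ofReal p)
    (ContinuousLinearMap.mul ℝ ℝ)
  have hL : ∀ h f, L h f = ∫ ω, h ω * f ω ∂μ := fun h f =>
    ContinuousLinearMap.lpPairing_eq_integral _ _ _
  refine ⟨L, fun h => ContinuousLinearMap.opNorm_le_bound _ (norm_nonneg _) fun f => ?_, hL⟩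
  have h1 := (ContinuousLinearMap.mul ℝ ℝ).coeFn_holder (r := 1) h f
  have h2 : L h f = ∫ ω, (ContinuousLinearMap.mul ℝ ℝ).holder 1 h f ω ∂μ := by
    rw [hL]
    refine integral_congr_ae ?_
    filter_upwards [h1] with ω hω
    rw [hω]
    rfl
  rw [ContinuousLinearMap.coe_coe, h2, ← L1.integral_eq_integral]
  refine (L1.norm_integral_le _).trans
    ((ContinuousLinearMap.mul ℝ ℝ).norm_holder_apply_apply_le h f |>.trans ?_)
  gcongr
  exact mul_le_of_le_one_left (norm_nonneg _) (ContinuousLinearMap.opNorm_mul_le ℝ ℝ)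

/-- An orthonormal sequence on which `T` is nearly a multiple of an isometry, and functionals nearly
biorthogonal to its image. -/
theorem exists_stable_system [IsFiniteMeasure μ] (hp : 1 < p) (hp2 : p ≠ 2)
    (T : ell2 →L[ℝ] Lp ℝ (ENNReal.ofReal p) μ) {B : ℝ} (hB : 0 ≤ B) (hT : ∀ w, ‖T w‖ ≤ B * ‖w‖) :
    ∃ Φ : ℝ, 0 ≤ Φ ∧ ∀ δ > 0, ∃ (Λ : ℝ) (u : ℕ → ell2)
      (φ : ℕ → (Lp ℝ (ENNReal.ofReal p) μ →L[ℝ] ℝ)), Φ - δ ≤ Λ ∧ Orthonormal ℝ u ∧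
      (∀ (N : ℕ) (b : ℕ → ℝ), ∑ l ∈ Finset.range N, b l ^ 2 = 1 →
        |‖∑ l ∈ Finset.range N, b l • T (u l)‖ - (gaussMoment p * Φ) ^ (1 / p)| ≤ δ) ∧
      (∀ (N : ℕ) (b : ℕ → ℝ), ∑ l ∈ Finset.range N, b l ^ 2 = 1 →
        ‖∑ l ∈ Finset.range N, b l • φ l‖ ≤
          (gaussMoment (p / (p - 1)) * Φ) ^ (1 / (p / (p - 1))) + δ) ∧
      ∀ k l, |φ k (T (u l)) - if k = l then Λ else 0| ≤ 4 * δ * (1 / 2) ^ k * (1 / 2) ^ l := by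
  have : Fact (1 ≤ ENNReal.ofReal (p / (p - 1))) :=
    ⟨ENNReal.one_le_ofReal.2 (Real.HolderConjugate.conjExponent hp).symm.lt.le⟩
  obtain ⟨Φ, hΦ, hs⟩ := exists_flat_selection hp hp2 T hB hT
  obtain ⟨L, hL1, hL2⟩ := exists_integral_pairing (μ := μ) hp
  refine ⟨Φ, hΦ, fun δ hδ => ?_⟩
  obtain ⟨Λ, n, H, τ, hΛ, hn, hτ, hflat, hbi⟩ := hs δ hδ
  obtain ⟨m, hm⟩ := exists_nat_gt ((τ⁻¹) ^ 2)
  have hm0 : 0 < m := by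
    have : (0 : ℝ) < m := lt_of_le_of_lt (sq_nonneg _) hm
    exact_mod_cast this
  have hmτ : (√(m : ℝ))⁻¹ ≤ τ := inv_le_of_inv_le₀ hτ (Real.le_sqrt_of_sq_le hm.le)
  have hTu : ∀ l, T (block (fun k => unitVec (n k)) m l) = block (fun k => T (unitVec (n k))) m l :=
    map_block (T : ell2 →ₗ[ℝ] Lp ℝ (ENNReal.ofReal p) μ) _
  refine ⟨Λ, block (fun k => unitVec (n k)) m, block (fun k => L (H k)) m, hΛ,
    orthonormal_block_unitVec hn hm0, fun N b hb => ?_, fun N b hb => ?_, fun k l => ?_⟩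
  · simp only [hTu]
    exact block_of_flat hm0 hmτ (w := fun k => T (unitVec (n k)))
      (Q := fun x => |‖x‖ - (gaussMoment p * Φ) ^ (1 / p)| ≤ δ)
      (fun N a ha hat => (hflat N a ha hat).1) N b hb
  · refine block_of_flat hm0 hmτ (w := fun k => L (H k)) (Q := fun x => ‖x‖ ≤
      (gaussMoment (p / (p - 1)) * Φ) ^ (1 / (p / (p - 1))) + δ) (fun N a ha hat => ?_) N b hb
    have := (hL1 _).trans (hflat N a ha hat).2
    simpa only [map_sum, map_smul] using this
  · have h := abs_block_block_sub_le hm0 hδ.le (M := fun i j => L (H i) (T (unitVec (n j))))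
      (fun i j => by rw [hL2]; exact hbi i j) k l
    convert h using 3
    simp only [block, map_smul, map_sum, smul_apply,
      sum_apply, smul_eq_mul, Finset.mul_sum]
    exact Finset.sum_comm

end Stabilization

section Stabilization

open Filter Topology

lemma hasSum_smul_unitVec (x : ell2) : HasSum (fun i => x i • unitVec i) x := by
  refine (lp.hasSum_single (by norm_num) x).congr_fun fun i => ?_
  rw [unitVec, ← lp.single_smul, smul_eq_mul, mul_one]

lemma norm_sum_smul_unitVec_sq (b : ℕ → ℝ) (N : ℕ) :
    ‖∑ i ∈ Finset.range N, b i • unitVec i‖ ^ 2 = ∑ i ∈ Finset.range N, b i ^ 2 := by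
  have h := lp.norm_sum_single (p := 2) (E := fun _ : ℕ => ℝ) (by norm_num) b (Finset.range N)
  have h1 : ∀ i, b i • unitVec i = lp.single 2 i (b i) := fun i => by
    rw [unitVec, ← lp.single_smul, smul_eq_mul, mul_one]
  simp only [h1]
  simpa using h

lemma norm_le_of_abs_apply_le_geometric {y : ell2} {c : ℝ} (h : ∀ k, |y k| ≤ c * (1 / 2) ^ k) :
    ‖y‖ ≤ 2 * c := by
  have h1 := hasSum_geometric_two.mul_left c
  rw [mul_comm c 2] at h1
  refine (hasSum_smul_unitVec y).norm_le_of_bounded h1 fun k => ?_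
  rw [norm_smul, norm_unitVec, mul_one]
  exact h k

lemma norm_le_of_abs_matrix_le_geometric {D : ell2 →L[ℝ] ell2} {C : ℝ} (hC : 0 ≤ C)
    (h : ∀ k l, |D (unitVec l) k| ≤ C * (1 / 2) ^ k * (1 / 2) ^ l) : ‖D‖ ≤ 4 * C := by
  refine D.opNorm_le_bound (by positivity) fun x => ?_
  have h1 := (hasSum_geometric_two.mul_left (2 * C * ‖x‖))
  rw [show 2 * C * ‖x‖ * 2 = 4 * C * ‖x‖ by ring] at h1
  refine ((hasSum_smul_unitVec x).mapL D).norm_le_of_bounded h1 fun l => ?_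
  rw [map_smul, norm_smul]
  have h2 : ‖D (unitVec l)‖ ≤ 2 * (C * (1 / 2) ^ l) :=
    norm_le_of_abs_apply_le_geometric fun k => (h k l).trans_eq (by ring)
  have h3 : ‖x l‖ ≤ ‖x‖ := lp.norm_apply_le_norm (by norm_num) x l
  calc ‖x l‖ * ‖D (unitVec l)‖ ≤ ‖x‖ * (2 * (C * (1 / 2) ^ l)) := by gcongr
    _ = _ := by ring

section Bounds

variable {E : Type*} [NormedAddCommGroup E] [NormedSpace ℝ E]

lemma abs_norm_sub_le_of_normalized {w : ℕ → E} {c δ : ℝ}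
    (h : ∀ (N : ℕ) (b : ℕ → ℝ), ∑ l ∈ Finset.range N, b l ^ 2 = 1 →
      |‖∑ l ∈ Finset.range N, b l • w l‖ - c| ≤ δ) (N : ℕ) (b : ℕ → ℝ) :
    |‖∑ l ∈ Finset.range N, b l • w l‖ - c * √(∑ l ∈ Finset.range N, b l ^ 2)| ≤
      δ * √(∑ l ∈ Finset.range N, b l ^ 2) := by
  set s := ∑ l ∈ Finset.range N, b l ^ 2 with hs
  have hs0 : 0 ≤ s := Finset.sum_nonneg fun _ _ => sq_nonneg _
  rcases hs0.eq_or_lt with h0 | h0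
  · have hb : ∀ l ∈ Finset.range N, b l • w l = 0 := fun l hl => by
      have := (Finset.sum_eq_zero_iff_of_nonneg fun _ _ => sq_nonneg _).1 h0.symm l hl
      rw [pow_eq_zero_iff two_ne_zero] at this
      rw [this, zero_smul]
    rw [Finset.sum_eq_zero hb, ← h0]
    simp
  · have hr : 0 < √s := Real.sqrt_pos.2 h0
    have h1 := h N (fun l => (√s)⁻¹ * b l) (by
      simp only [mul_pow, ← Finset.mul_sum, inv_pow, Real.sq_sqrt hs0]
      exact inv_mul_cancel₀ h0.ne')
    simp only [mul_smul, ← Finset.smul_sum] at h1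
    rw [norm_smul, norm_inv, Real.norm_eq_abs, abs_of_pos hr] at h1
    set X := ‖∑ l ∈ Finset.range N, b l • w l‖
    have h2 : X - c * √s = √s * ((√s)⁻¹ * X - c) := by
      rw [mul_sub, mul_inv_cancel_left₀ hr.ne']
      ring
    rw [h2, abs_mul, abs_of_pos hr, mul_comm]
    exact mul_le_mul_of_nonneg_right h1 hr.le

lemma abs_norm_apply_sub_le_of_normalized {J : ell2 →L[ℝ] E} {c δ : ℝ}
    (h : ∀ (N : ℕ) (b : ℕ → ℝ), ∑ l ∈ Finset.range N, b l ^ 2 = 1 →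
      |‖∑ l ∈ Finset.range N, b l • J (unitVec l)‖ - c| ≤ δ) (x : ell2) :
    |‖J x‖ - c * ‖x‖| ≤ δ * ‖x‖ := by
  have hx := (hasSum_smul_unitVec x).tendsto_sum_nat
  have h1 := (((J.continuous.tendsto x).comp hx).norm.sub (hx.norm.const_mul c)).abs
  refine le_of_tendsto_of_tendsto' h1 (hx.norm.const_mul δ) fun N => ?_
  have h2 := abs_norm_sub_le_of_normalized h N x
  rw [← norm_sum_smul_unitVec_sq, Real.sqrt_sq (norm_nonneg _)] at h2
  simpa only [Function.comp_apply, map_sum, map_smul] using h2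

lemma sum_apply_sq_le_of_normalized {φ : ℕ → (E →L[ℝ] ℝ)} {K : ℝ}
    (h : ∀ (N : ℕ) (b : ℕ → ℝ), ∑ l ∈ Finset.range N, b l ^ 2 = 1 →
      ‖∑ l ∈ Finset.range N, b l • φ l‖ ≤ K) (f : E) (N : ℕ) :
    ∑ l ∈ Finset.range N, φ l f ^ 2 ≤ (K * ‖f‖) ^ 2 := by
  set s := ∑ l ∈ Finset.range N, φ l f ^ 2 with hs
  have hs0 : 0 ≤ s := Finset.sum_nonneg fun _ _ => sq_nonneg _
  rcases hs0.eq_or_lt with h0 | h0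
  · rw [← h0]
    positivity
  · have hr : 0 < √s := Real.sqrt_pos.2 h0
    have h1 := h N (fun l => (√s)⁻¹ * φ l f) (by
      simp only [mul_pow, ← Finset.mul_sum, inv_pow, Real.sq_sqrt hs0]
      exact inv_mul_cancel₀ h0.ne')
    have h2 : (∑ l ∈ Finset.range N, ((√s)⁻¹ * φ l f) • φ l) f = √s := by
      simp only [sum_apply, smul_apply, smul_eq_mul, mul_assoc, ← Finset.mul_sum, ← sq]
      rw [← hs, inv_mul_eq_div, Real.div_sqrt]
    have h3 := ((ContinuousLinearMap.le_opNorm _ f).trans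
      (mul_le_mul_of_nonneg_right h1 (norm_nonneg f)))
    rw [h2, Real.norm_eq_abs, abs_of_pos hr] at h3
    calc s = √s ^ 2 := (Real.sq_sqrt hs0).symm
      _ ≤ _ := by gcongr

lemma exists_coefficient_map {φ : ℕ → (E →L[ℝ] ℝ)} {K : ℝ} (hK : 0 ≤ K)
    (h : ∀ (N : ℕ) (b : ℕ → ℝ), ∑ l ∈ Finset.range N, b l ^ 2 = 1 →
      ‖∑ l ∈ Finset.range N, b l • φ l‖ ≤ K) :
    ∃ R : E →L[ℝ] ell2, ‖R‖ ≤ K ∧ ∀ f l, R f l = φ l f := by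
  have hsum : ∀ (f : E) (s : Finset ℕ),
      ∑ l ∈ s, ‖φ l f‖ ^ (2 : ℝ≥0∞).toReal ≤ (K * ‖f‖) ^ (2 : ℝ≥0∞).toReal := fun f s => by
    obtain ⟨N, hN⟩ := s.exists_nat_subset_range
    simp only [ENNReal.toReal_ofNat, Real.rpow_ofNat, Real.norm_eq_abs, sq_abs]
    exact (Finset.sum_le_sum_of_subset_of_nonneg hN fun _ _ _ => sq_nonneg _).trans
      (sum_apply_sq_le_of_normalized h f N)
  let R : E →ₗ[ℝ] ell2 :=
    { toFun f := ⟨fun l => φ l f, memℓp_gen' (hsum f)⟩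
      map_add' f g := by ext l; exact map_add (φ l) f g
      map_smul' c f := by ext l; exact map_smul (φ l) c f }
  refine ⟨R.mkContinuous K fun f => lp.norm_le_of_forall_sum_le (by norm_num) (by positivity)
    (hsum f), R.mkContinuous_norm_le hK _, fun f l => rfl⟩

end Bounds

end Stabilization

section Stabilization

open Filter Topology

lemma exists_linearIsometry_of_orthonormal {u : ℕ → ell2} (hu : Orthonormal ℝ u) :
    ∃ V : ell2 →ₗᵢ[ℝ] ell2, ∀ l, V (unitVec l) = u l := by
  refine ⟨hu.orthogonalFamily.linearIsometry, fun l => ?_⟩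
  rw [unitVec]
  refine (hu.orthogonalFamily.linearIsometry_apply_single (1 : ℝ)).trans ?_
  simp

lemma not_finiteDimensional_range (V : ell2 →ₗᵢ[ℝ] ell2) :
    ¬ FiniteDimensional ℝ (LinearMap.range V.toLinearMap) := by
  intro hfin
  have h1 : FiniteDimensional ℝ ell2 :=
    (LinearEquiv.ofInjective V.toLinearMap V.injective).symm.finiteDimensional
  have h2 : Orthonormal ℝ unitVec := orthonormal_iff_ite.2 inner_unitVec
  have h3 : Finite ℕ := h2.linearIndependent.finite_of_isNoetherian
  exact not_finite ℕ

lemma exists_leftInverse_of_norm_sub_le {F : Type*} [NormedAddCommGroup F] [NormedSpace ℝ F]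
    [CompleteSpace F] {M : F →L[ℝ] F} {Λ η : ℝ} (hη : 0 ≤ η) (hΛ : η < Λ)
    (h : ‖M - Λ • ContinuousLinearMap.id ℝ F‖ ≤ η) :
    ∃ S : F →L[ℝ] F, ‖S‖ ≤ (Λ - η)⁻¹ ∧ ∀ x, S (M x) = x := by
  have hΛ0 : 0 < Λ := hη.trans_lt hΛ
  have ht : ‖(-Λ⁻¹) • (M - Λ • ContinuousLinearMap.id ℝ F)‖ < 1 := by
    rw [norm_smul, norm_neg, norm_inv, Real.norm_eq_abs, abs_of_pos hΛ0, inv_mul_lt_iff₀ hΛ0]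
    linarith
  set U := Units.oneSub _ ht with hU
  have hUM : ∀ x, (U : F →L[ℝ] F) x = Λ⁻¹ • M x := fun x => by
    rw [hU, Units.val_oneSub]
    simp only [sub_apply, smul_apply, one_apply_eq_self, ContinuousLinearMap.id_apply]
    rw [smul_sub, smul_smul, neg_mul, inv_mul_cancel₀ hΛ0.ne']
    module
  set S : F →L[ℝ] F := Λ⁻¹ • ((U⁻¹ : (F →L[ℝ] F)ˣ) : F →L[ℝ] F) with hS
  have hl : ∀ x, S (M x) = x := fun x => by
    have h1 : ((U⁻¹ : (F →L[ℝ] F)ˣ) : F →L[ℝ] F) ((U : F →L[ℝ] F) x) = x :=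
      congrArg (fun f : F →L[ℝ] F => f x) U.inv_mul
    rw [hUM, map_smul] at h1
    exact h1
  have hr : ∀ x, M (S x) = x := fun x => by
    have h1 : (U : F →L[ℝ] F) (((U⁻¹ : (F →L[ℝ] F)ˣ) : F →L[ℝ] F) x) = x :=
      congrArg (fun f : F →L[ℝ] F => f x) U.mul_inv
    rw [hUM, ← map_smul] at h1
    exact h1
  refine ⟨S, S.opNorm_le_bound (inv_nonneg.2 (by linarith)) fun y => ?_, hl⟩
  have h1 : ‖M (S y) - Λ • S y‖ ≤ η * ‖S y‖ := ContinuousLinearMap.le_of_opNorm_le _ h (S y)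
  rw [hr] at h1
  have h2 := norm_sub_norm_le (Λ • S y) y
  rw [norm_sub_rev, norm_smul, Real.norm_eq_abs, abs_of_pos hΛ0] at h2
  rw [inv_mul_eq_div, le_div_iff₀ (by linarith)]
  linarith

/-- A nearly biorthogonal system of functionals produces a projection onto the image of the span of
an orthonormal sequence. -/
theorem exists_projection_of_stable_system {E : Type*} [NormedAddCommGroup E] [NormedSpace ℝ E]
    (T : ell2 →L[ℝ] E) {u : ℕ → ell2} (hu : Orthonormal ℝ u) {φ : ℕ → (E →L[ℝ] ℝ)}
    {c δ K Λ C : ℝ} (hc : 0 ≤ c) (hδ : 0 ≤ δ) (hK : 0 ≤ K) (hC : 0 ≤ C) (hΛ : 4 * C < Λ)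
    (hT : ∀ (N : ℕ) (b : ℕ → ℝ), ∑ l ∈ Finset.range N, b l ^ 2 = 1 →
      |‖∑ l ∈ Finset.range N, b l • T (u l)‖ - c| ≤ δ)
    (hφ : ∀ (N : ℕ) (b : ℕ → ℝ), ∑ l ∈ Finset.range N, b l ^ 2 = 1 →
      ‖∑ l ∈ Finset.range N, b l • φ l‖ ≤ K)
    (hbi : ∀ k l, |φ k (T (u l)) - if k = l then Λ else 0| ≤ C * (1 / 2) ^ k * (1 / 2) ^ l) :
    ∃ X : Submodule ℝ ell2, ¬ FiniteDimensional ℝ X ∧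
      (∀ x ∈ X, (c - δ) * ‖x‖ ≤ ‖T x‖ ∧ ‖T x‖ ≤ (c + δ) * ‖x‖) ∧
      ∃ P : E →L[ℝ] E, ‖P‖ ≤ (c + δ) * K * (Λ - 4 * C)⁻¹ ∧
        (∀ f, P f ∈ X.map (T : ell2 →ₗ[ℝ] E)) ∧ ∀ f ∈ X.map (T : ell2 →ₗ[ℝ] E), P f = f := by
  obtain ⟨V, hV⟩ := exists_linearIsometry_of_orthonormal hu
  set J : ell2 →L[ℝ] E := T.comp V.toContinuousLinearMap with hJ
  have hJu : ∀ l, J (unitVec l) = T (u l) := fun l => by rw [← hV]; rfl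
  have hJn : ∀ x, |‖J x‖ - c * ‖x‖| ≤ δ * ‖x‖ :=
    abs_norm_apply_sub_le_of_normalized fun N b hb => by
      simp only [hJu]
      exact hT N b hb
  obtain ⟨R, hRn, hR⟩ := exists_coefficient_map hK hφ
  have hD : ‖R.comp J - Λ • ContinuousLinearMap.id ℝ ell2‖ ≤ 4 * C := by
    refine norm_le_of_abs_matrix_le_geometric hC fun k l => ?_
    convert hbi k l using 2
    have h1 : R (J (unitVec l)) k = φ k (T (u l)) := by rw [hR, hJu]
    have h2 : (unitVec l) k = if k = l then (1 : ℝ) else 0 := by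
      rw [unitVec, lp.single_apply]
      by_cases h : k = l
      · subst h; simp
      · simp [h]
    simp only [sub_apply, smul_apply, ContinuousLinearMap.comp_apply, ContinuousLinearMap.id_apply,
      lp.coeFn_sub, lp.coeFn_smul, Pi.sub_apply, Pi.smul_apply, h1, h2, smul_eq_mul, mul_ite,
      mul_one, mul_zero]
  obtain ⟨S, hSn, hS⟩ := exists_leftInverse_of_norm_sub_le (by positivity) hΛ hD
  have hJop : ‖J‖ ≤ c + δ := J.opNorm_le_bound (by positivity) fun x => by
    linarith [(abs_le.1 (hJn x)).2]
  refine ⟨LinearMap.range V.toLinearMap, not_finiteDimensional_range V, ?_, J.comp (S.comp R), ?_,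
    fun f => ?_, ?_⟩
  · rintro _ ⟨x, rfl⟩
    have h1 := abs_le.1 (hJn x)
    have h2 : ‖V x‖ = ‖x‖ := V.norm_map x
    have h3 : J x = T (V x) := rfl
    rw [h3] at h1
    rw [LinearIsometry.coe_toLinearMap, h2]
    constructor <;> linarith
  · calc ‖J.comp (S.comp R)‖ ≤ ‖J‖ * (‖S‖ * ‖R‖) := (J.opNorm_comp_le _).trans
          (mul_le_mul_of_nonneg_left (S.opNorm_comp_le R) (norm_nonneg _))
      _ ≤ (c + δ) * ((Λ - 4 * C)⁻¹ * K) := by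
        have : 0 < Λ - 4 * C := by linarith
        gcongr
      _ = _ := by ring
  · exact ⟨V (S (R f)), ⟨_, rfl⟩, rfl⟩
  · rintro _ ⟨_, ⟨x, rfl⟩, rfl⟩
    have h1 : S (R (J x)) = x := hS x
    exact congrArg J h1

end Stabilization

section Stabilization

open Filter Topology

lemma gaussNorm_eq (r : ℝ) : gaussNorm r = gaussMoment r ^ (1 / r) := rfl

lemma gaussNorm_pos {r : ℝ} (hr : 0 ≤ r) : 0 < gaussNorm r :=
  Real.rpow_pos_of_pos (gaussMoment_pos hr) _

lemma gaussNorm_le_one {r : ℝ} (h0 : 0 < r) (h2 : r ≤ 2) : gaussNorm r ≤ 1 := by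
  have h := (integral_rpow_quadratic_le (θ := r / 2) (a := 0) (b := 0) (c := 1) (by linarith)
    (by linarith) fun z => by nlinarith).2
  rw [zero_add, Real.one_rpow] at h
  have h1 : gaussMoment r ≤ 1 := by
    refine le_of_eq_of_le (integral_congr_ae (Eventually.of_forall fun z => ?_)) h
    simp only [zero_mul, zero_add, one_mul]
    rw [← sq_abs, ← Real.rpow_natCast, ← Real.rpow_mul (abs_nonneg z)]
    congr 1
    push_cast
    ring
  exact Real.rpow_le_one (gaussMoment_nonneg r) h1 (by positivity)

lemma gaussNorm_mul_le {p : ℝ} (hp : 1 < p) :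
    gaussNorm p * gaussNorm (p / (p - 1)) ≤
      if 2 < p then gaussNorm p else gaussNorm (p / (p - 1)) := by
  have h1 : 0 < p - 1 := by linarith
  have hq : 0 < p / (p - 1) := by positivity
  split_ifs with h
  · refine mul_le_of_le_one_right (gaussNorm_pos (by linarith)).le (gaussNorm_le_one hq ?_)
    rw [div_le_iff₀ h1]
    linarith
  · exact mul_le_of_le_one_left (gaussNorm_pos hq.le).le
      (gaussNorm_le_one (by linarith) (not_lt.1 h))

lemma mul_rpow_mul_mul_rpow_conj {p : ℝ} (hp : 1 < p) {Φ : ℝ} (hΦ : 0 < Φ) :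
    (gaussMoment p * Φ) ^ (1 / p) *
        (gaussMoment (p / (p - 1)) * Φ) ^ (1 / (p / (p - 1))) =
      gaussNorm p * gaussNorm (p / (p - 1)) * Φ := by
  have h1 : 0 < p - 1 := by linarith
  rw [Real.mul_rpow (gaussMoment_nonneg _) hΦ.le, Real.mul_rpow (gaussMoment_nonneg _) hΦ.le,
    gaussNorm_eq, gaussNorm_eq, mul_mul_mul_comm, ← Real.rpow_add hΦ]
  have : 1 / p + 1 / (p / (p - 1)) = 1 := by
    field_simp
    ring
  rw [this, Real.rpow_one]

lemma exists_small_perturbation {c d Φ M ε : ℝ} (hc : 0 < c) (hΦ : 0 < Φ) (hM : 0 < M) (hε : 0 < ε)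
    (h : c * d ≤ M * Φ) :
    ∃ δ > 0, δ < c ∧ c + δ ≤ (1 + ε) * (c - δ) ∧ 17 * δ < Φ ∧
      (c + δ) * (d + δ) ≤ (1 + ε) * M * (Φ - 17 * δ) := by
  have h1 : ∀ᶠ δ : ℝ in 𝓝 0, δ < c := eventually_lt_nhds hc
  have h2 : ∀ᶠ δ : ℝ in 𝓝 0, c + δ < (1 + ε) * (c - δ) := by
    have ha : ContinuousAt (fun δ : ℝ => c + δ) 0 := by fun_prop
    have hb : ContinuousAt (fun δ : ℝ => (1 + ε) * (c - δ)) 0 := by fun_prop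
    refine ha.eventually_lt hb ?_
    nlinarith
  have h3 : ∀ᶠ δ : ℝ in 𝓝 0, 17 * δ < Φ := by
    have ha : ContinuousAt (fun δ : ℝ => 17 * δ) 0 := by fun_prop
    exact ha.eventually_lt continuousAt_const (by simpa using hΦ)
  have h4 : ∀ᶠ δ : ℝ in 𝓝 0, (c + δ) * (d + δ) < (1 + ε) * M * (Φ - 17 * δ) := by
    have ha : ContinuousAt (fun δ : ℝ => (c + δ) * (d + δ)) 0 := by fun_prop
    have hb : ContinuousAt (fun δ : ℝ => (1 + ε) * M * (Φ - 17 * δ)) 0 := by fun_prop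
    refine ha.eventually_lt hb ?_
    simp only [add_zero, mul_zero, sub_zero]
    nlinarith [mul_pos hM hΦ, mul_pos hε (mul_pos hM hΦ)]
  have hall := (h1.and (h2.and (h3.and h4))).filter_mono (nhdsWithin_le_nhds (s := Set.Ioi 0))
  obtain ⟨δ, ⟨a1, a2, a3, a4⟩, a0⟩ := (hall.and self_mem_nhdsWithin).exists
  exact ⟨δ, a0, a1, a2.le, a3, a4.le⟩

end Stabilization

/-- Stabilization for `ℓ₂`: an isomorphic embedding `T : ℓ₂ → L_p[0,1]` restricts to a
`(1+ε)`-isomorphism on an infinite-dimensional subspace `X` with `T(X)` complemented by a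
projection of norm at most `(1+ε)γ_p` for `p > 2` and `(1+ε)γ_{p/(p-1)}` for `1 < p < 2`. -/
theorem stabilizing_embedding_l2 (p : ℝ) (hp₁ : 1 < p) (hp₂ : p ≠ 2)
    [Fact (1 ≤ ENNReal.ofReal p)]
    (ε : ℝ) (hε : 0 < ε)
    (T : ell2 →L[ℝ] Lp ℝ (ENNReal.ofReal p) μ01)
    (A B : ℝ) (hA : 0 < A) (hB : 0 < B)
    (hT : ∀ v : ell2, A⁻¹ * ‖v‖ ≤ ‖T v‖ ∧ ‖T v‖ ≤ B * ‖v‖) :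
    ∃ X : Submodule ℝ ell2,
      ¬ FiniteDimensional ℝ X ∧
      (∃ A' B' : ℝ, 0 < A' ∧ 0 < B' ∧ A' * B' ≤ 1 + ε ∧
        ∀ x ∈ X, A'⁻¹ * ‖x‖ ≤ ‖T x‖ ∧ ‖T x‖ ≤ B' * ‖x‖) ∧
      (∃ P : Lp ℝ (ENNReal.ofReal p) μ01 →L[ℝ] Lp ℝ (ENNReal.ofReal p) μ01,
        ‖P‖ ≤ (1 + ε) * (if 2 < p then gaussNorm p else gaussNorm (p / (p - 1))) ∧
        (∀ f, P f ∈ (X.map (T : ell2 →ₗ[ℝ] Lp ℝ (ENNReal.ofReal p) μ01)).topologicalClosure) ∧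
        (∀ f ∈ X.map (T : ell2 →ₗ[ℝ] Lp ℝ (ENNReal.ofReal p) μ01), P f = f)) := by
  have hfin : IsFiniteMeasure μ01 := by
    unfold μ01
    infer_instance
  obtain ⟨Φ, hΦ, hs⟩ := exists_stable_system hp₁ hp₂ T hB.le fun w => (hT w).2
  have hc : 0 < (gaussMoment p * Φ) ^ (1 / p) := by
    have hA2 : 0 < A⁻¹ / 2 := by positivity
    obtain ⟨Λ, u, φ, -, hu, h, -, -⟩ := hs _ hA2
    have h1 := h 1 (fun _ => 1) (by simp)
    rw [Finset.sum_range_one, one_smul] at h1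
    have h2 := (hT (u 0)).1
    rw [hu.1 0, mul_one] at h2
    linarith [(abs_le.1 h1).2]
  have hp0 : 0 < p := by linarith
  have hΦ0 : 0 < Φ := hΦ.lt_of_ne fun h => hc.ne' <| by
    rw [← h, mul_zero, Real.zero_rpow (by positivity)]
  have hq : 0 < p / (p - 1) := div_pos hp0 (by linarith)
  have hM : 0 < if 2 < p then gaussNorm p else gaussNorm (p / (p - 1)) := by
    split_ifs
    · exact gaussNorm_pos hp0.le
    · exact gaussNorm_pos hq.le
  have hd : 0 ≤ (gaussMoment (p / (p - 1)) * Φ) ^ (1 / (p / (p - 1))) :=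
    Real.rpow_nonneg (mul_nonneg (gaussMoment_nonneg _) hΦ) _
  have hcd := (mul_rpow_mul_mul_rpow_conj hp₁ hΦ0).le.trans
    (mul_le_mul_of_nonneg_right (gaussNorm_mul_le hp₁) hΦ)
  set M := if 2 < p then gaussNorm p else gaussNorm (p / (p - 1))
  set c := (gaussMoment p * Φ) ^ (1 / p)
  set d := (gaussMoment (p / (p - 1)) * Φ) ^ (1 / (p / (p - 1)))
  obtain ⟨δ, hδ, hδc, hδε, hδΦ, hδM⟩ := exists_small_perturbation hc hΦ0 hM hε hcd
  obtain ⟨Λ, u, φ, hΛ, hu, h1, h2, h3⟩ := hs δ hδ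
  obtain ⟨X, hX, hXT, P, hP, hPX, hPid⟩ := exists_projection_of_stable_system T hu hc.le hδ.le
    (add_nonneg hd hδ.le) (by positivity : 0 ≤ 4 * δ) (by linarith) h1 h2 h3
  have hcδ : 0 < c - δ := by linarith
  refine ⟨X, hX, ⟨(c - δ)⁻¹, c + δ, inv_pos.2 hcδ, by positivity, ?_, fun x hx => ?_⟩, P, ?_,
    fun f => Submodule.le_topologicalClosure _ (hPX f), hPid⟩
  · rwa [inv_mul_le_iff₀ hcδ, mul_comm]
  · rw [inv_inv]
    exact hXT x hx
  · have h5 : 0 < Λ - 4 * (4 * δ) := by linarith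
    refine hP.trans ?_
    rw [← div_eq_mul_inv, div_le_iff₀ h5]
    exact hδM.trans (mul_le_mul_of_nonneg_left (by linarith) (by positivity))
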